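/- Let G be a finite group and let ε be a constant with 0 < ε ≤ 0.1 such that β(H) ≤ 2^{−ε} · |H|^{1−ε} holds for every almost simple group H whose socle is isomorphic to a composition factor of G. Let C be a characteristic cyclic subgroup of maximal order in G. Then β(G) ≤ |C|^{ε} · |G|^{1−ε}. -/

import Mathlib

/-!  Definition of the Noether number `β(G)` of a group `G`, over the field `ℂ`
(of characteristic 0).  A finite-dimensional `ℂG`-module is (up to isomorphism)
given by a representation `ρ : Representation ℂ G (Fin n → ℂ)`; the algebra of
polynomial invariants is realised inside `MvPolynomial (Fin n) ℂ` as the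
common equalizer of the substitution maps induced by the group elements. -/

/-- The algebra endomorphism of the polynomial ring induced by the linear action of
`g : G` on the underlying space (substitution of the variables by linear forms). -/
noncomputable def Representation.polySubst {G : Type*} [Group G] {n : ℕ}
    (ρ : Representation ℂ G (Fin n → ℂ)) (g : G) :
    MvPolynomial (Fin n) ℂ →ₐ[ℂ] MvPolynomial (Fin n) ℂ :=
  MvPolynomial.aeval fun i =>
    ∑ j, MvPolynomial.C (LinearMap.toMatrix' (ρ g) i j) * MvPolynomial.X j

/-- The subalgebra of `G`-invariant polynomials. -/
noncomputable def Representation.invariantAlgebra {G : Type*} [Group G] {n : ℕ}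
    (ρ : Representation ℂ G (Fin n → ℂ)) : Subalgebra ℂ (MvPolynomial (Fin n) ℂ) :=
  ⨅ g : G, AlgHom.equalizer (ρ.polySubst g) (AlgHom.id ℂ (MvPolynomial (Fin n) ℂ))

/-- The invariant algebra is generated by its elements of (total) degree at most `d`. -/
def Representation.InvariantsGeneratedInDegree {G : Type*} [Group G] {n : ℕ}
    (ρ : Representation ℂ G (Fin n → ℂ)) (d : ℕ) : Prop :=
  Algebra.adjoin ℂ {f : MvPolynomial (Fin n) ℂ | f ∈ ρ.invariantAlgebra ∧ f.totalDegree ≤ d}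
    = ρ.invariantAlgebra

/-- The Noether number `β(G)`: the smallest degree bound `d` such that for every
finite-dimensional `ℂG`-module the algebra of polynomial invariants is generated
by its elements of degree at most `d`.  (Equivalently, the maximum over all
finite-dimensional modules `V` of the minimal generating degree `β(G,V)`.) -/
noncomputable def noetherNumber (G : Type*) [Group G] : ℕ :=
  sInf {d : ℕ | ∀ (n : ℕ) (ρ : Representation ℂ G (Fin n → ℂ)),
    ρ.InvariantsGeneratedInDegree d}

/-- The Noether index `n(G) = |G| / β(G)`, as a real number. -/
noncomputable def noetherIndex (G : Type*) [Group G] : ℝ :=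
  (Nat.card G : ℝ) / (noetherNumber G : ℝ)

/-- `Q` is a *composition factor* of the group `G`: there is a composition series
`⊥ = H₀ ⊴ H₁ ⊴ ⋯ ⊴ Hₙ = G` (each term normal in the next, with no intermediate
normal subgroup, i.e. each successive quotient is simple) such that `Q` is
isomorphic to one of the successive quotients `H_{i+1}/H_i` (the isomorphism is
encoded by a surjective homomorphism `H_{i+1} →* Q` with kernel `H_i`). -/
def IsCompositionFactor (Q : Type*) [Group Q] (G : Type*) [Group G] : Prop :=
  ∃ (n : ℕ) (H : Fin (n + 1) → Subgroup G),
    H 0 = ⊥ ∧ H (Fin.last n) = ⊤ ∧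
    (∀ i : Fin n,
      H i.castSucc ≤ H i.succ ∧
      ((H i.castSucc).subgroupOf (H i.succ)).Normal ∧
      H i.castSucc ≠ H i.succ ∧
      ∀ L : Subgroup G, H i.castSucc ≤ L → L ≤ H i.succ →
        (L.subgroupOf (H i.succ)).Normal → L = H i.castSucc ∨ L = H i.succ) ∧
    ∃ (i : Fin n) (φ : ↥(H i.succ) →* Q),
      Function.Surjective φ ∧ φ.ker = (H i.castSucc).subgroupOf (H i.succ)

/-- `NoetherBound G d`: for every action of `G` on a commutative `ℂ`-algebra and every stable
ideal `I`, the power `I ^ d` lies in the ideal generated by the invariants contained in `I`. -/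
def NoetherBound (G : Type) [Group G] (d : ℕ) : Prop :=
  ∀ (A : Type) [CommRing A] [Algebra ℂ A] (φ : G →* (A →ₐ[ℂ] A)) (I : Ideal A),
    (∀ g, ∀ a ∈ I, φ g a ∈ I) → I ^ d ≤ Ideal.span {a | a ∈ I ∧ ∀ g, φ g a = a}

theorem Ideal.span_pow_le_of_multiset_prod {A : Type*} [CommRing A] {S : Set A} {J : Ideal A}
    {n : ℕ} (h : ∀ s : Multiset A, s.card = n → (∀ a ∈ s, a ∈ S) → s.prod ∈ J) :
    Ideal.span S ^ n ≤ J := by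
  have := Submodule.span_pow (R := A) (A := A) S n
  rw [Ideal.span, Ideal.submodule_span_eq]  at *
  rw [this, Ideal.span_le]
  intro x hx
  rw [Set.mem_pow] at hx
  obtain ⟨f, rfl⟩ := hx
  have := h (Multiset.ofList (List.ofFn fun i => (f i : A))) (by simp) (by
    intro a ha
    simp only [Multiset.mem_coe, List.mem_ofFn] at ha
    obtain ⟨i, rfl⟩ := ha
    exact (f i).2)
  simpa using this

theorem Ideal.pow_le_of_prod_fintype {A : Type*} [CommRing A] {I J : Ideal A}
    {ι : Type*} [Fintype ι] (h : ∀ f : ι → A, (∀ i, f i ∈ I) → ∏ i, f i ∈ J) :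
    I ^ Fintype.card ι ≤ J := by
  rw [← Ideal.span_eq I]
  refine Ideal.span_pow_le_of_multiset_prod fun s hs hmem => ?_
  obtain ⟨l, rfl⟩ := Quot.exists_rep s
  have hl : l.length = Fintype.card ι := by simpa using hs
  let e : ι ≃ Fin l.length := (Fintype.equivFin ι).trans (finCongr hl.symm)
  have := h (fun i => l.get (e i)) (fun i => hmem _ (by simp))
  rw [Equiv.prod_comp e (fun i => l.get i)] at this
  simpa using this

theorem noetherBound_card (G : Type) [Group G] [Finite G] : NoetherBound G (Nat.card G) := by
  classical
  intro A _ _ φ I hI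
  have := Fintype.ofFinite G
  rw [Nat.card_eq_fintype_card]
  refine Ideal.pow_le_of_prod_fintype fun a ha => ?_
  set J := Ideal.span {a | a ∈ I ∧ ∀ g, φ g a = a} with hJ
  have h0 : ∑ τ : G, ∏ σ : G, (φ (τ * σ) (a σ) - a σ) = 0 := by
    refine Finset.sum_eq_zero fun τ _ => Finset.prod_eq_zero (Finset.mem_univ τ⁻¹) ?_
    simp
  have hterm : ∀ t ∈ (Finset.univ : Finset G).powerset, t ≠ ∅ →
      ∑ τ : G, (∏ σ ∈ t, φ (τ * σ) (a σ)) * ∏ σ ∈ Finset.univ \ t, (- a σ) ∈ J := by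
    intro t _ ht
    rw [← Finset.sum_mul]
    refine Ideal.mul_mem_right _ _ (Ideal.subset_span ⟨?_, ?_⟩)
    · refine Ideal.sum_mem _ fun τ _ => ?_
      obtain ⟨σ, hσ⟩ := Finset.nonempty_iff_ne_empty.2 ht
      exact Ideal.mem_of_dvd _ (Finset.dvd_prod_of_mem _ hσ) (hI _ _ (ha σ))
    · intro g
      rw [map_sum]
      conv_rhs => rw [← Equiv.sum_comp (Equiv.mulLeft g)]
      refine Finset.sum_congr rfl fun τ _ => ?_
      rw [map_prod]
      refine Finset.prod_congr rfl fun σ _ => ?_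
      rw [← AlgHom.mul_apply, ← map_mul]
      simp [mul_assoc]
  simp_rw [sub_eq_add_neg, Finset.prod_add] at h0
  rw [Finset.sum_comm, ← Finset.add_sum_erase _ _ (Finset.empty_mem_powerset _)] at h0
  have h1 : ∑ t ∈ (Finset.univ : Finset G).powerset.erase ∅,
      ∑ τ : G, (∏ σ ∈ t, φ (τ * σ) (a σ)) * ∏ σ ∈ Finset.univ \ t, (- a σ) ∈ J :=
    Ideal.sum_mem _ fun t ht => hterm t (Finset.mem_of_mem_erase ht) (Finset.ne_of_mem_erase ht)
  have h2 := neg_mem h1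
  rw [← eq_neg_of_add_eq_zero_left h0] at h2
  simp only [Finset.prod_empty, Finset.sdiff_empty, one_mul, Finset.sum_const, Finset.card_univ,
    nsmul_eq_mul, Finset.prod_neg] at h2
  have h3 := J.mul_mem_left ((-1) ^ Fintype.card G *
    algebraMap ℂ A ((Fintype.card G : ℂ)⁻¹)) h2
  have h4 : algebraMap ℂ A ((Fintype.card G : ℂ)⁻¹) * (Fintype.card G : A) = 1 := by
    rw [← map_natCast (algebraMap ℂ A), ← map_mul, inv_mul_cancel₀, map_one]
    exact_mod_cast Fintype.card_ne_zero
  convert h3 using 1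
  have h5 : ((-1 : A) ^ Fintype.card G) * (-1) ^ Fintype.card G = 1 := by
    rw [← mul_pow]; simp
  linear_combination (-(algebraMap ℂ A ((Fintype.card G : ℂ)⁻¹)) * (Fintype.card G : A) *
    ∏ i, a i) * h5 - (∏ i, a i) * h4

section Quotient

variable {G Q : Type} [Group G] [Group Q] {A : Type} [CommRing A] [Algebra ℂ A]

/-- The subalgebra of elements fixed by the kernel of a homomorphism. -/
def kerFixed (f : G →* Q) (φ : G →* (A →ₐ[ℂ] A)) : Subalgebra ℂ A where
  carrier := {x | ∀ n ∈ f.ker, φ n x = x}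
  mul_mem' ha hb n hn := by rw [map_mul, ha n hn, hb n hn]
  add_mem' ha hb n hn := by rw [map_add, ha n hn, hb n hn]
  algebraMap_mem' r n _ := by simp

theorem map_mem_kerFixed (f : G →* Q) (φ : G →* (A →ₐ[ℂ] A)) (g : G) (x : A)
    (hx : x ∈ kerFixed f φ) : φ g x ∈ kerFixed f φ := by
  intro n hn
  have h : n * g = g * (g⁻¹ * n * g) := by group
  rw [← AlgHom.mul_apply, ← map_mul, h, map_mul, AlgHom.mul_apply, hx]
  have := f.normal_ker.conj_mem n hn g⁻¹
  simpa using this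

/-- The action of `G` on the elements fixed by the kernel. -/
def kerFixedAction (f : G →* Q) (φ : G →* (A →ₐ[ℂ] A)) :
    G →* (kerFixed f φ →ₐ[ℂ] kerFixed f φ) where
  toFun g := ((φ g).comp (kerFixed f φ).val).codRestrict (kerFixed f φ)
    fun x => map_mem_kerFixed f φ g x x.2
  map_one' := by ext; simp
  map_mul' g h := by
    ext x
    change φ (g * h) x = φ g (φ h x)
    simp

theorem NoetherBound.span_kerFixed_pow_le {b : ℕ} (hQ : NoetherBound Q b) (f : G →* Q)
    (hf : Function.Surjective f) (φ : G →* (A →ₐ[ℂ] A)) (I : Ideal A)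
    (hI : ∀ g, ∀ a ∈ I, φ g a ∈ I) :
    Ideal.span {x | x ∈ I ∧ ∀ n ∈ f.ker, φ n x = x} ^ b ≤
      Ideal.span {a | a ∈ I ∧ ∀ g, φ g a = a} := by
  let B := kerFixed f φ
  have hker : f.ker ≤ (kerFixedAction f φ).ker := by
    intro n hn
    rw [MonoidHom.mem_ker]
    ext x
    exact x.2 n hn
  let ψ : Q →* (B →ₐ[ℂ] B) := (QuotientGroup.lift f.ker (kerFixedAction f φ) hker).comp
    (QuotientGroup.quotientKerEquivOfSurjective f hf).symm.toMonoidHom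
  have hψ : ∀ g (x : B), (ψ (f g) x : A) = φ g x := by
    intro g x
    have : (QuotientGroup.quotientKerEquivOfSurjective f hf).symm (f g) =
        QuotientGroup.mk' f.ker g := by
      rw [MulEquiv.symm_apply_eq]; rfl
    have h2 : ψ (f g) = kerFixedAction f φ g := by
      change (QuotientGroup.lift f.ker (kerFixedAction f φ) hker)
        ((QuotientGroup.quotientKerEquivOfSurjective f hf).symm (f g)) = _
      rw [this]; rfl
    rw [h2]; rfl
  have h := hQ B ψ (I.comap B.val) (by
    intro q x hx
    obtain ⟨g, rfl⟩ := hf q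
    rw [Ideal.mem_comap] at hx ⊢
    change (ψ (f g) x : A) ∈ I
    rw [hψ]
    exact hI g x hx)
  have h' := Ideal.map_mono (f := B.val) h
  rw [Ideal.map_pow, Ideal.map_span] at h'
  refine (Ideal.pow_right_mono ?_ b).trans (h'.trans ?_)
  · rw [Ideal.span_le]
    rintro x ⟨hxI, hx⟩
    exact Ideal.mem_map_of_mem B.val (I := I.comap B.val) (x := ⟨x, hx⟩) hxI
  · refine Ideal.span_mono ?_
    rintro _ ⟨x, ⟨hx, hinv⟩, rfl⟩
    refine ⟨hx, fun g => ?_⟩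
    change φ g (x : A) = x
    rw [← hψ, hinv]

theorem NoetherBound.of_surjective {a b : ℕ} (f : G →* Q) (hf : Function.Surjective f)
    (hN : NoetherBound f.ker a) (hQ : NoetherBound Q b) : NoetherBound G (a * b) := by
  intro A _ _ φ I hI
  rw [pow_mul]
  refine (Ideal.pow_right_mono ?_ b).trans (hQ.span_kerFixed_pow_le f hf φ I hI)
  refine (hN A (φ.comp f.ker.subtype) I fun g => hI g).trans (Ideal.span_mono ?_)
  rintro x ⟨hx, h⟩
  exact ⟨hx, fun n hn => h ⟨n, hn⟩⟩

theorem NoetherBound.congr {a : ℕ} (e : G ≃* Q) (h : NoetherBound Q a) : NoetherBound G a := by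
  have hb : (e : G →* Q).ker = ⊥ := (MonoidHom.ker_eq_bot_iff _).2 e.injective
  have h1 : NoetherBound (e : G →* Q).ker 1 := by
    have := noetherBound_card (⊥ : Subgroup G)
    rw [hb]
    simpa using this
  simpa using NoetherBound.of_surjective (e : G →* Q) e.surjective h1 h

end Quotient

namespace MvPolynomial

theorem coeff_aeval_C_mul_X {σ B : Type*} [CommRing B] [Algebra ℂ B] (u : σ → B)
    (F : MvPolynomial σ ℂ) (m : ℕ) :
    (aeval (fun i => Polynomial.C (u i) * Polynomial.X) F).coeff m =
      aeval u (homogeneousComponent m F) := by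
  induction F using MvPolynomial.induction_on' with
  | add p q hp hq => simp [hp, hq]
  | monomial v a =>
    have h1 : aeval (fun i => Polynomial.C (u i) * Polynomial.X) (monomial v a) =
        Polynomial.C (aeval u (monomial v a)) * Polynomial.X ^ v.degree := by
      simp only [aeval_monomial, Finsupp.prod, mul_pow, Finset.prod_mul_distrib,
        Finset.prod_pow_eq_pow_sum, map_mul, map_prod, map_pow, Finsupp.degree, mul_assoc]
      rfl
    rw [h1, Polynomial.coeff_C_mul, Polynomial.coeff_X_pow]
    by_cases h : m = v.degree
    · rw [if_pos h, mul_one, homogeneousComponent_eq_self]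
      exact isHomogeneous_monomial _ h.symm
    · rw [if_neg h, mul_zero, homogeneousComponent_of_mem
        (isHomogeneous_monomial a rfl), if_neg h, map_zero]

theorem homogeneousComponent_mul_antidiagonal {σ : Type*} (F F' : MvPolynomial σ ℂ) (m : ℕ) :
    homogeneousComponent m (F * F') = ∑ x ∈ Finset.HasAntidiagonal.antidiagonal m,
      homogeneousComponent x.1 F * homogeneousComponent x.2 F' := by
  have h := fun (G : MvPolynomial σ ℂ) k => coeff_aeval_C_mul_X (B := MvPolynomial σ ℂ) X G k
  simp only [aeval_X_left, AlgHom.id_apply] at h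
  rw [← h, map_mul, Polynomial.coeff_mul]
  simp_rw [h]

theorem homogeneousComponent_aeval_of_isHomogeneous_one {σ τ : Type*}
    {u : σ → MvPolynomial τ ℂ} (hu : ∀ i, (u i).IsHomogeneous 1)
    (F : MvPolynomial σ ℂ) (m : ℕ) :
    homogeneousComponent m (aeval u F) = aeval u (homogeneousComponent m F) := by
  have key : ∀ k, (aeval u (homogeneousComponent k F)).IsHomogeneous k := fun k => by
    have := (homogeneousComponent_isHomogeneous k F).aeval u hu
    rwa [one_mul] at this
  conv_lhs => rw [← sum_homogeneousComponent F]
  rw [map_sum, map_sum]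
  simp_rw [homogeneousComponent_of_mem (key _)]
  rw [Finset.sum_ite_eq]
  split_ifs with h
  · rfl
  · rw [homogeneousComponent_eq_zero, map_zero]
    simpa using h

end MvPolynomial

section

open MvPolynomial

variable {G : Type} [Group G] {n : ℕ} (ρ : Representation ℂ G (Fin n → ℂ))

theorem Representation.polySubst_mul (g h : G) :
    ρ.polySubst (g * h) = (ρ.polySubst h).comp (ρ.polySubst g) := by
  ext1 i
  simp only [Representation.polySubst, aeval_X, AlgHom.comp_apply, map_sum, map_mul,
    LinearMap.toMatrix'_mul, Matrix.mul_apply, Finset.sum_mul, Finset.mul_sum, algHom_C]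
  rw [Finset.sum_comm]
  simp [mul_assoc]

theorem Representation.polySubst_one : ρ.polySubst 1 = AlgHom.id ℂ _ := by
  ext1 i
  simp [Representation.polySubst, Pi.single_apply, Finset.sum_ite_eq, apply_ite C]

/-- The left action of `G` on polynomials by substitution. -/
noncomputable def Representation.polyAction :
    G →* (MvPolynomial (Fin n) ℂ →ₐ[ℂ] MvPolynomial (Fin n) ℂ) where
  toFun g := ρ.polySubst g⁻¹
  map_one' := by rw [inv_one, polySubst_one]; rfl
  map_mul' g h := by rw [mul_inv_rev, polySubst_mul]; rfl

theorem Representation.mem_invariantAlgebra {F : MvPolynomial (Fin n) ℂ} :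
    F ∈ ρ.invariantAlgebra ↔ ∀ g, ρ.polySubst g F = F := by
  simp [invariantAlgebra, Algebra.mem_iInf, AlgHom.mem_equalizer]

theorem Representation.mem_invariantAlgebra' {F : MvPolynomial (Fin n) ℂ} :
    F ∈ ρ.invariantAlgebra ↔ ∀ g, ρ.polyAction g F = F := by
  rw [mem_invariantAlgebra]
  refine ⟨fun h g => h g⁻¹, fun h g => ?_⟩
  have := h g⁻¹
  simpa [polyAction] using this

theorem Representation.homogeneousComponent_polyAction (g : G) (F : MvPolynomial (Fin n) ℂ)
    (m : ℕ) : homogeneousComponent m (ρ.polyAction g F) =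
      ρ.polyAction g (homogeneousComponent m F) := by
  refine homogeneousComponent_aeval_of_isHomogeneous_one (fun i => ?_) F m
  exact IsHomogeneous.sum _ _ _ fun j _ => isHomogeneous_C_mul_X _ _

theorem Representation.homogeneousComponent_mem_invariantAlgebra {F : MvPolynomial (Fin n) ℂ}
    (hF : F ∈ ρ.invariantAlgebra) (m : ℕ) : homogeneousComponent m F ∈ ρ.invariantAlgebra := by
  rw [mem_invariantAlgebra'] at hF ⊢
  intro g
  rw [← homogeneousComponent_polyAction, hF]

/-- The averaging operator on polynomials. -/
noncomputable def Representation.reynolds [Fintype G] :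
    MvPolynomial (Fin n) ℂ →ₗ[ℂ] MvPolynomial (Fin n) ℂ :=
  (Fintype.card G : ℂ)⁻¹ • ∑ g : G, (ρ.polyAction g).toLinearMap

theorem Representation.reynolds_apply [Fintype G] (F : MvPolynomial (Fin n) ℂ) :
    ρ.reynolds F = (Fintype.card G : ℂ)⁻¹ • ∑ g : G, ρ.polyAction g F := by
  simp [reynolds]

theorem Representation.reynolds_mem [Fintype G] (F : MvPolynomial (Fin n) ℂ) :
    ρ.reynolds F ∈ ρ.invariantAlgebra := by
  rw [reynolds_apply]
  refine Subalgebra.smul_mem _ ?_ _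
  rw [mem_invariantAlgebra']
  intro g
  rw [map_sum]
  conv_rhs => rw [← Equiv.sum_comp (Equiv.mulLeft g)]
  refine Finset.sum_congr rfl fun h _ => ?_
  rw [← AlgHom.mul_apply, ← map_mul]
  rfl

theorem Representation.reynolds_eq [Fintype G] {F : MvPolynomial (Fin n) ℂ}
    (hF : F ∈ ρ.invariantAlgebra) : ρ.reynolds F = F := by
  rw [mem_invariantAlgebra'] at hF
  rw [reynolds_apply]
  simp only [hF, Finset.sum_const, Finset.card_univ, ← Nat.cast_smul_eq_nsmul ℂ, smul_smul]
  rw [inv_mul_cancel₀, one_smul]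
  exact_mod_cast Fintype.card_ne_zero

theorem Representation.reynolds_mul [Fintype G] (F : MvPolynomial (Fin n) ℂ)
    {F' : MvPolynomial (Fin n) ℂ} (hF : F' ∈ ρ.invariantAlgebra) :
    ρ.reynolds (F * F') = ρ.reynolds F * F' := by
  rw [mem_invariantAlgebra'] at hF
  simp only [reynolds_apply, map_mul, hF, smul_mul_assoc, Finset.sum_mul]

theorem Representation.reynolds_isHomogeneous [Fintype G] {F : MvPolynomial (Fin n) ℂ} {m : ℕ}
    (hF : F.IsHomogeneous m) : (ρ.reynolds F).IsHomogeneous m := by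
  rw [reynolds_apply]
  refine Submodule.smul_mem (homogeneousSubmodule (Fin n) ℂ m) _
    (Submodule.sum_mem _ fun g _ => ?_)
  have := ρ.homogeneousComponent_polyAction g F m
  rw [homogeneousComponent_eq_self hF] at this
  rw [← this]
  exact homogeneousComponent_isHomogeneous _ _

theorem NoetherBound.invariantsGeneratedInDegree [Finite G] {d : ℕ} (hd : NoetherBound G d) :
    ρ.InvariantsGeneratedInDegree d := by
  have := Fintype.ofFinite G
  set U := Algebra.adjoin ℂ {f | f ∈ ρ.invariantAlgebra ∧ f.totalDegree ≤ d} with hU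
  set 𝔪 := idealOfVars (Fin n) ℂ with h𝔪
  have h𝔪0 : ∀ c, c ∈ 𝔪 ↔ homogeneousComponent 0 c = 0 := by
    intro c
    have := mem_pow_idealOfVars_iff' 1 c
    rw [pow_one] at this
    rw [this, homogeneousComponent_zero]
    constructor
    · intro h
      rw [h 0 (by simp), C_0]
    · intro h x hx
      have : x = 0 := by
        rw [← Finsupp.degree_eq_zero_iff]; omega
      subst this
      simpa using h
  have hstab : ∀ g, ∀ a ∈ 𝔪, ρ.polyAction g a ∈ 𝔪 := by
    intro g a ha
    rw [h𝔪0] at ha ⊢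
    rw [ρ.homogeneousComponent_polyAction, ha, map_zero]
  have hbound := hd _ ρ.polyAction 𝔪 hstab
  have hom : ∀ m (F : MvPolynomial (Fin n) ℂ), F.IsHomogeneous m → F ∈ ρ.invariantAlgebra →
      F ∈ U := by
    intro m
    induction m using Nat.strong_induction_on with
    | _ m ih =>
    intro F hF hinv
    by_cases hmd : m ≤ d
    · exact Algebra.subset_adjoin ⟨hinv, hF.totalDegree_le.trans hmd⟩
    have hmem : F ∈ 𝔪 * Ideal.span {a | a ∈ 𝔪 ∧ ∀ g, ρ.polyAction g a = a} := by
      have h1 : F ∈ 𝔪 ^ (d + 1) := by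
        rw [mem_pow_idealOfVars_iff']
        intro x hx
        refine hF.coeff_eq_zero ?_
        omega
      rw [pow_succ'] at h1
      exact Ideal.mul_mono_right hbound h1
    have key : ∀ x ∈ 𝔪 * Ideal.span {a | a ∈ 𝔪 ∧ ∀ g, ρ.polyAction g a = a},
        ρ.reynolds (homogeneousComponent m x) ∈ U := by
      intro x hx
      induction hx using Submodule.mul_induction_on' with
      | add x _ y _ hx hy => rw [map_add, map_add]; exact add_mem hx hy
      | mem_mul_mem c hc y hy =>
        induction hy using Submodule.span_induction generalizing c with
        | zero => simp
        | add x y _ _ hx hy =>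
          rw [mul_add, map_add, map_add]; exact add_mem (hx c hc) (hy c hc)
        | smul r y _ hy =>
          rw [smul_eq_mul, ← mul_assoc]
          exact hy _ (𝔪.mul_mem_right r hc)
        | mem a ha =>
          rw [homogeneousComponent_mul_antidiagonal, map_sum]
          refine sum_mem fun x hx => ?_
          rw [Finset.HasAntidiagonal.mem_antidiagonal] at hx
          have ha1 := (ρ.mem_invariantAlgebra').2 ha.2
          rw [ρ.reynolds_mul _ (ρ.homogeneousComponent_mem_invariantAlgebra ha1 _)]
          by_cases h1 : x.1 = 0
          · rw [h1, (h𝔪0 c).1 hc]; simp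
          by_cases h2 : x.2 = 0
          · rw [h2, (h𝔪0 a).1 ha.1]; simp
          refine mul_mem (ih x.1 (by omega) _ (ρ.reynolds_isHomogeneous
            (homogeneousComponent_isHomogeneous _ _)) (ρ.reynolds_mem _))
            (ih x.2 (by omega) _ (homogeneousComponent_isHomogeneous _ _)
              (ρ.homogeneousComponent_mem_invariantAlgebra ha1 _))
    have := key F hmem
    rwa [homogeneousComponent_eq_self hF, ρ.reynolds_eq hinv] at this
  refine le_antisymm (Algebra.adjoin_le fun f hf => hf.1) fun F hF => ?_
  rw [← sum_homogeneousComponent F]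
  exact sum_mem fun m _ => hom m _ (homogeneousComponent_isHomogeneous _ _)
    (ρ.homogeneousComponent_mem_invariantAlgebra hF m)

theorem NoetherBound.noetherNumber_le [Finite G] {d : ℕ} (hd : NoetherBound G d) :
    noetherNumber G ≤ d :=
  Nat.sInf_le fun _ ρ => hd.invariantsGeneratedInDegree ρ

end

section

open MvPolynomial

variable {G : Type} [Group G]

/-- The permutation representation on functions on `Fin N`, transported from a `G`-set `σ`. -/
noncomputable def permRep {σ : Type} [MulAction G σ] {N : ℕ} (e : σ ≃ Fin N) :
    Representation ℂ G (Fin N → ℂ) where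
  toFun g := LinearMap.funLeft ℂ ℂ fun i => e (g⁻¹ • e.symm i)
  map_one' := by ext; simp [LinearMap.funLeft]
  map_mul' g h := by ext; simp [LinearMap.funLeft, mul_smul]

theorem polySubst_permRep {σ : Type} [MulAction G σ] {N : ℕ} (e : σ ≃ Fin N) (g : G) :
    (permRep e).polySubst g = rename fun i => e (g⁻¹ • e.symm i) := by
  ext1 i
  simp [Representation.polySubst, permRep, LinearMap.toMatrix'_apply, LinearMap.funLeft,
    Pi.single_apply, apply_ite C]

theorem mem_adjoin_of_invariantsGeneratedInDegree {d : ℕ}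
    (hd : ∀ (n : ℕ) (ρ : Representation ℂ G (Fin n → ℂ)), ρ.InvariantsGeneratedInDegree d)
    {σ : Type} [Fintype σ] [MulAction G σ] (F : MvPolynomial σ ℂ)
    (hF : ∀ g : G, rename (fun i => g • i) F = F) :
    F ∈ Algebra.adjoin ℂ {f : MvPolynomial σ ℂ |
      (∀ g : G, rename (fun i => g • i) f = f) ∧ f.totalDegree ≤ d} := by
  let e := Fintype.equivFin σ
  have h := hd _ (permRep (G := G) e)
  unfold Representation.InvariantsGeneratedInDegree at h
  have h1 : rename e F ∈ (permRep (G := G) e).invariantAlgebra := by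
    rw [Representation.mem_invariantAlgebra]
    intro g
    rw [polySubst_permRep, rename_rename]
    conv_rhs => rw [← hF g⁻¹, rename_rename]
    congr 1
    ext i; simp
  rw [← h] at h1
  have h2 : rename e.symm (rename e F) ∈ _ :=
    Subalgebra.mem_map.2 ⟨_, h1, rfl⟩
  rw [AlgHom.map_adjoin, rename_rename, Equiv.symm_comp_self, rename_id_apply] at h2
  refine Algebra.adjoin_mono ?_ h2
  rintro _ ⟨f, ⟨hf, hdeg⟩, rfl⟩
  refine ⟨fun g => ?_, (totalDegree_rename_le _ _).trans hdeg⟩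
  rw [Representation.mem_invariantAlgebra] at hf
  conv_rhs => rw [← hf g⁻¹, polySubst_permRep, rename_rename]
  rw [rename_rename]
  congr 1
  ext i; simp

/-- Polynomials over dual numbers whose positive-degree coefficients are infinitesimal and vanish
beyond degree `d`. -/
def infinitesimalSubalgebra (B : Type) [CommRing B] [Algebra ℂ B] (d : ℕ) :
    Subalgebra ℂ (Polynomial (DualNumber B)) where
  carrier := {p | (∀ m, 0 < m → (p.coeff m).fst = 0) ∧ ∀ m, d < m → p.coeff m = 0}
  add_mem' ha hb := ⟨fun m hm => by simp [ha.1 m hm, hb.1 m hm],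
    fun m hm => by simp [ha.2 m hm, hb.2 m hm]⟩
  algebraMap_mem' r := by
    have h : ∀ m, 0 < m →
        (algebraMap ℂ (Polynomial (DualNumber B)) r).coeff m = 0 := by
      intro m hm
      rw [Polynomial.algebraMap_apply, Polynomial.coeff_C, if_neg hm.ne']
    exact ⟨fun m hm => by rw [h m hm, TrivSqZeroExt.fst_zero], fun m hm => h m (by omega)⟩
  mul_mem' {a b} ha hb := by
    constructor
    · intro m hm
      rw [Polynomial.coeff_mul, TrivSqZeroExt.fst_sum]
      refine Finset.sum_eq_zero fun x hx => ?_
      rw [Finset.HasAntidiagonal.mem_antidiagonal] at hx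
      rw [TrivSqZeroExt.fst_mul]
      by_cases h1 : x.1 = 0
      · rw [hb.1 x.2 (by omega), mul_zero]
      · rw [ha.1 x.1 (by omega), zero_mul]
    · intro m hm
      rw [Polynomial.coeff_mul]
      refine Finset.sum_eq_zero fun x hx => ?_
      rw [Finset.HasAntidiagonal.mem_antidiagonal] at hx
      by_cases h1 : d < x.1
      · rw [ha.2 _ h1, zero_mul]
      by_cases h2 : d < x.2
      · rw [hb.2 _ h2, mul_zero]
      have h3 := ha.1 x.1 (by omega)
      have h4 := hb.1 x.2 (by omega)
      ext <;> simp [h3, h4]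

theorem noetherBound_of_invariantsGeneratedInDegree [Finite G] {d : ℕ}
    (hd : ∀ (n : ℕ) (ρ : Representation ℂ G (Fin n → ℂ)), ρ.InvariantsGeneratedInDegree d) :
    NoetherBound G d := by
  classical
  have := Fintype.ofFinite G
  intro A _ _ φ I hI
  set J := Ideal.span {a | a ∈ I ∧ ∀ g, φ g a = a} with hJ
  have hc : d = Fintype.card (Fin d) := by simp
  rw [hc]
  refine Ideal.pow_le_of_prod_fintype fun a ha => ?_
  let σ : Type := (Fin d × G) ⊕ G
  let : MulAction G σ :=
    { smul := fun g => Sum.map (Prod.map id (g * ·)) (g * ·)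
      one_smul := by
        rintro (⟨i, h⟩ | h)
        · change (Sum.inl (i, 1 * h) : σ) = _; rw [one_mul]
        · change (Sum.inr (1 * h) : σ) = _; rw [one_mul]
      mul_smul := by
        rintro x y (⟨i, h⟩ | h)
        · change (Sum.inl (i, x * y * h) : σ) = Sum.inl (i, x * (y * h)); rw [mul_assoc]
        · change (Sum.inr (x * y * h) : σ) = Sum.inr (x * (y * h)); rw [mul_assoc] }
  have smul_inl : ∀ (g : G) i h, g • (Sum.inl (i, h) : σ) = Sum.inl (i, g * h) := fun _ _ _ => rfl
  have smul_inr : ∀ (g : G) h, g • (Sum.inr h : σ) = Sum.inr (g * h) := fun _ _ => rfl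
  let Θ : MvPolynomial σ ℂ := ∑ h : G, (∏ j : Fin d, X (Sum.inl (j, h))) * X (Sum.inr h)
  have hΘ : ∀ g : G, rename (fun i => g • i) Θ = Θ := by
    intro g
    simp only [Θ, map_sum, map_mul, map_prod, rename_X, smul_inl, smul_inr]
    exact Equiv.sum_comp (Equiv.mulLeft g)
      fun h => (∏ j : Fin d, (X (Sum.inl (j, h)) : MvPolynomial σ ℂ)) * X (Sum.inr h)
  have hmem := mem_adjoin_of_invariantsGeneratedInDegree hd Θ hΘ
  let B := A ⧸ J
  let w : σ → A := Sum.elim (fun x => φ x.2 (a x.1)) fun _ => 0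
  have hwI : ∀ i, w i ∈ I := by
    rintro (⟨i, h⟩ | h)
    · exact hI _ _ (ha i)
    · exact I.zero_mem
  let u : σ → DualNumber B := Sum.elim
    (fun x => TrivSqZeroExt.inl (Ideal.Quotient.mk J (φ x.2 (a x.1))))
    (fun h => if h = 1 then DualNumber.eps else 0)
  have hfst : ∀ f : MvPolynomial σ ℂ, (aeval u f).fst = Ideal.Quotient.mk J (aeval w f) := by
    intro f
    have : (TrivSqZeroExt.fstHom ℂ B B).comp (aeval u) =
        (Ideal.Quotient.mkₐ ℂ J).comp (aeval w) := by
      ext1 i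
      rcases i with ⟨i, h⟩ | h
      · simp [u, w]
      · by_cases hh : h = 1 <;> simp [u, w, hh]
    exact DFunLike.congr_fun this f
  let Ψ : MvPolynomial σ ℂ →ₐ[ℂ] Polynomial (DualNumber B) :=
    aeval fun i => Polynomial.C (u i) * Polynomial.X
  have hsub : Algebra.adjoin ℂ {f : MvPolynomial σ ℂ |
      (∀ g : G, rename (fun i => g • i) f = f) ∧ f.totalDegree ≤ d} ≤
      (infinitesimalSubalgebra B d).comap Ψ := by
    refine Algebra.adjoin_le ?_
    rintro f ⟨hf, hdeg⟩
    refine ⟨fun m hm => ?_, fun m hm => ?_⟩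
    · rw [show (Ψ : _ →+* Polynomial (DualNumber B)) f = Ψ f from rfl, coeff_aeval_C_mul_X, hfst,
        Ideal.Quotient.eq_zero_iff_mem]
      set f' := homogeneousComponent m f with hf'
      refine Ideal.subset_span ⟨?_, fun g => ?_⟩
      · have h0 : homogeneousComponent 0 f' = 0 := by
          rw [hf', homogeneousComponent_of_mem (homogeneousComponent_isHomogeneous m f),
            if_neg hm.ne]
        rw [← Ideal.Quotient.eq_zero_iff_mem]
        have h2 : (Ideal.Quotient.mkₐ ℂ I).comp (aeval w) =
            aeval (fun _ => (0 : A ⧸ I)) := by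
          ext1 i
          simp only [AlgHom.comp_apply, aeval_X, Ideal.Quotient.mkₐ_eq_mk]
          exact Ideal.Quotient.eq_zero_iff_mem.2 (hwI i)
        have h3 := DFunLike.congr_fun h2 f'
        rw [AlgHom.comp_apply, Ideal.Quotient.mkₐ_eq_mk] at h3
        rw [h3]
        have := aeval_zero (S₁ := A ⧸ I) f'
        rw [show (fun _ : σ => (0 : A ⧸ I)) = 0 from rfl, this]
        rw [homogeneousComponent_zero] at h0
        rw [constantCoeff_eq, C_injective _ _ (h0.trans C_0.symm), map_zero]
      · have h1 : rename (fun i => g • i) f' = f' := by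
          rw [hf', rename_homogeneousComponent, hf]
        have h2 : (φ g).comp (aeval w) = (aeval w).comp (rename fun i => g • i) := by
          ext1 i
          rcases i with ⟨i, h⟩ | h
          · simp [w, smul_inl]
          · simp [w, smul_inr]
        have h3 := DFunLike.congr_fun h2 f'
        rw [AlgHom.comp_apply, AlgHom.comp_apply, h1] at h3
        exact h3
    · rw [show (Ψ : _ →+* Polynomial (DualNumber B)) f = Ψ f from rfl, coeff_aeval_C_mul_X,
        homogeneousComponent_eq_zero _ _ (by omega), map_zero]
  have h1 := (hsub hmem).2 (d + 1) (by omega)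
  rw [show (Ψ : _ →+* Polynomial (DualNumber B)) Θ = Ψ Θ from rfl, coeff_aeval_C_mul_X,
    homogeneousComponent_eq_self] at h1
  · have h2 : aeval u Θ = TrivSqZeroExt.inl (Ideal.Quotient.mk J (∏ j, a j)) * DualNumber.eps := by
      simp only [Θ, map_sum, map_mul, map_prod, aeval_X, u, Sum.elim_inl, Sum.elim_inr]
      rw [Finset.sum_eq_single 1]
      · simp only [map_one, AlgHom.one_apply, if_true]
        congr 1
        exact (map_prod (TrivSqZeroExt.inlHom B B) _ _).symm
      · intro b _ hb
        rw [if_neg hb, mul_zero]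
      · simp
    rw [h2] at h1
    have h3 := congrArg TrivSqZeroExt.snd h1
    simp only [TrivSqZeroExt.snd_mul, TrivSqZeroExt.fst_inl, DualNumber.snd_eps,
      TrivSqZeroExt.snd_zero, TrivSqZeroExt.snd_inl, smul_eq_mul, mul_one, smul_zero,
      add_zero] at h3
    exact Ideal.Quotient.eq_zero_iff_mem.1 h3
  · refine IsHomogeneous.sum _ _ _ fun h _ => ?_
    refine IsHomogeneous.mul ?_ (isHomogeneous_X _ _)
    simpa using IsHomogeneous.prod Finset.univ (fun j : Fin d =>
      (X (Sum.inl (j, h)) : MvPolynomial σ ℂ)) (fun _ => 1) fun j _ => isHomogeneous_X _ _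

theorem noetherBound_noetherNumber (G : Type) [Group G] [Finite G] :
    NoetherBound G (noetherNumber G) := by
  refine noetherBound_of_invariantsGeneratedInDegree ?_
  exact Nat.sInf_mem (s := {d : ℕ | ∀ (n : ℕ) (ρ : Representation ℂ G (Fin n → ℂ)),
    ρ.InvariantsGeneratedInDegree d})
    ⟨_, fun _ ρ => (noetherBound_card G).invariantsGeneratedInDegree ρ⟩

theorem noetherNumber_le_card (G : Type) [Group G] [Finite G] : noetherNumber G ≤ Nat.card G :=
  (noetherBound_card G).noetherNumber_le

theorem noetherNumber_le_mul {G Q : Type} [Group G] [Group Q] [Finite G] (f : G →* Q)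
    (hf : Function.Surjective f) :
    noetherNumber G ≤ noetherNumber f.ker * noetherNumber Q := by
  have := Finite.of_surjective f hf
  exact ((noetherBound_noetherNumber f.ker).of_surjective f hf
    (noetherBound_noetherNumber Q)).noetherNumber_le

theorem noetherNumber_congr {G Q : Type} [Group G] [Group Q] [Finite G] (e : G ≃* Q) :
    noetherNumber G = noetherNumber Q := by
  have := Finite.of_equiv _ e.toEquiv
  exact le_antisymm ((noetherBound_noetherNumber Q).congr e).noetherNumber_le
    ((noetherBound_noetherNumber G).congr e.symm).noetherNumber_le

theorem noetherNumber_le_mul_quotient {G : Type} [Group G] [Finite G] (N : Subgroup G)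
    [N.Normal] : noetherNumber G ≤ noetherNumber N * noetherNumber (G ⧸ N) := by
  have := noetherNumber_le_mul (QuotientGroup.mk' N) (QuotientGroup.mk'_surjective N)
  rwa [QuotientGroup.ker_mk'] at this

end

section Eigen

variable {V Ω A : Type} [Group V] [Fintype V] [Fintype Ω] [CommRing A] [Algebra ℂ A]

/-- An ideal stable under `V` is spanned by its eigenvectors, for characters satisfying column
orthogonality. -/
theorem Ideal.le_span_eigenvectors [DecidableEq V] (c : Ω → V →* ℂ)
    (hc : ∀ v, ∑ ω, c ω v = if v = 1 then (Fintype.card V : ℂ) else 0)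
    (φ : V →* (A →ₐ[ℂ] A)) (I : Ideal A) (hI : ∀ v, ∀ a ∈ I, φ v a ∈ I) :
    I ≤ Ideal.span {x | x ∈ I ∧ ∃ ω, ∀ v, φ v x = c ω v • x} := by
  intro x hx
  let P : Ω → A := fun ω => (Fintype.card V : ℂ)⁻¹ • ∑ v, c ω v⁻¹ • φ v x
  have hP : ∀ ω v, φ v (P ω) = c ω v • P ω := by
    intro ω u
    simp only [P, map_smul, map_sum]
    rw [smul_comm (c ω u)]
    congr 1
    rw [Finset.smul_sum]
    conv_rhs => rw [← Equiv.sum_comp (Equiv.mulLeft u)]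
    refine Finset.sum_congr rfl fun v _ => ?_
    have h : c ω u * c ω (u * v)⁻¹ = c ω v⁻¹ := by
      rw [mul_comm, ← map_mul]; simp
    rw [← AlgHom.mul_apply, ← map_mul, smul_smul, Equiv.coe_mulLeft, h]
  have hsum : x = ∑ ω, P ω := by
    simp only [P]
    rw [← Finset.smul_sum, Finset.sum_comm]
    simp_rw [← Finset.sum_smul, hc]
    simp [smul_smul]
  rw [hsum]
  refine Ideal.sum_mem _ fun ω _ => Ideal.subset_span ⟨?_, ω, hP ω⟩
  have hsmul : ∀ (r : ℂ), ∀ a ∈ I, r • a ∈ I := fun r a ha => by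
    rw [Algebra.smul_def]; exact I.mul_mem_left _ ha
  exact hsmul _ _ (Ideal.sum_mem _ fun v _ => hsmul _ _ (hI _ _ hx))

end Eigen

/-- The characters of `(ZMod q)^k`. -/
noncomputable def vecChar (q k : ℕ) [NeZero q] (w : Fin k → ZMod q) :
    Multiplicative (Fin k → ZMod q) →* ℂ where
  toFun v := ZMod.stdAddChar (∑ i, w i * v.toAdd i)
  map_one' := by simp
  map_mul' u v := by simp [mul_add, Finset.sum_add_distrib, AddChar.map_add_eq_mul]

theorem vecChar_apply (q k : ℕ) [NeZero q] (w : Fin k → ZMod q)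
    (v : Multiplicative (Fin k → ZMod q)) :
    vecChar q k w v = ∏ i, ZMod.stdAddChar (w i * v.toAdd i) := by
  change ZMod.stdAddChar (∑ i, w i * v.toAdd i) = _
  exact map_prod ZMod.stdAddChar.toMonoidHom (fun i => Multiplicative.ofAdd (w i * v.toAdd i)) _

theorem vecChar_sum {q k : ℕ} [NeZero q] (S : Multiset (Fin k → ZMod q))
    (v : Multiplicative (Fin k → ZMod q)) :
    vecChar q k S.sum v = (S.map fun w => vecChar q k w v).prod := by
  induction S using Multiset.induction_on with
  | empty => simp [vecChar_apply]
  | cons a S ih =>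
    rw [Multiset.sum_cons, Multiset.map_cons, Multiset.prod_cons, ← ih]
    simp [vecChar_apply, add_mul, AddChar.map_add_eq_mul, Finset.prod_mul_distrib]

theorem sum_vecChar (q k : ℕ) [NeZero q] (v : Multiplicative (Fin k → ZMod q)) :
    ∑ w, vecChar q k w v =
      if v = 1 then (Fintype.card (Multiplicative (Fin k → ZMod q)) : ℂ) else 0 := by
  simp_rw [vecChar_apply]
  have h := Finset.prod_univ_sum (fun _ : Fin k => (Finset.univ : Finset (ZMod q)))
    fun i x => (ZMod.stdAddChar (x * v.toAdd i) : ℂ)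
  rw [Fintype.piFinset_univ] at h
  rw [← h]
  simp_rw [AddChar.sum_mulShift _ (ZMod.isPrimitive_stdAddChar q)]
  split_ifs with hv
  · subst hv; simp [ZMod.card]
  · have : ∃ i, v.toAdd i ≠ 0 := by
      by_contra! hcon
      exact hv (Multiplicative.toAdd.injective (funext hcon))
    obtain ⟨i, hi⟩ := this
    exact Finset.prod_eq_zero (Finset.mem_univ i) (by simp [hi])

theorem Multiset.exists_map_eq_of_le_map {α β : Type*} {f : α → β} {T : Multiset α}
    {S : Multiset β} (h : S ≤ T.map f) : ∃ S' ≤ T, S'.map f = S := by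
  obtain ⟨t, rfl⟩ := Quot.exists_rep T
  obtain ⟨s, rfl⟩ := Quot.exists_rep S
  obtain ⟨l, hl, hsub⟩ := (Multiset.coe_le.1 h : s.Subperm (t.map f))
  obtain ⟨l', hl', rfl⟩ := List.sublist_map_iff.1 hsub
  exact ⟨l', Multiset.coe_le.2 hl'.subperm, Multiset.coe_eq_coe.2 hl⟩

theorem exists_sum_eq_zero_of_lt_card {q k : ℕ} [Fact q.Prime] (T : Multiset (Fin k → ZMod q))
    (hT : k * (q - 1) < T.card) : ∃ S ≤ T, S ≠ 0 ∧ S.sum = 0 := by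
  classical
  obtain ⟨l, rfl⟩ := Quot.exists_rep T
  have hl : k * (q - 1) < l.length := hT
  let f : Fin k → MvPolynomial (Fin l.length) (ZMod q) := fun i =>
    ∑ j, MvPolynomial.C (l.get j i) * MvPolynomial.X j ^ (q - 1)
  have hdeg : ∑ i, (f i).totalDegree < Fintype.card (Fin l.length) := by
    rw [Fintype.card_fin]
    refine lt_of_le_of_lt (Finset.sum_le_sum (g := fun _ => q - 1) fun i _ => ?_) (by simpa)
    refine (MvPolynomial.totalDegree_finsetSum _ _).trans (Finset.sup_le fun j _ => ?_)
    refine (MvPolynomial.totalDegree_mul _ _).trans ?_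
    rw [MvPolynomial.totalDegree_C, zero_add]
    exact (MvPolynomial.totalDegree_pow _ _).trans (by simp)
  have hdvd : q ∣ Nat.card {x : Fin l.length → ZMod q //
      ∀ i, MvPolynomial.eval x (f i) = 0} := by
    rw [Nat.card_eq_fintype_card]
    convert char_dvd_card_solutions_of_fintype_sum_lt q hdeg
  have hq := (Fact.out : q.Prime)
  have heval : ∀ x i, MvPolynomial.eval x (f i) = ∑ j, l.get j i * x j ^ (q - 1) := by
    intro x i; simp [f]
  have h0 : ∀ i, MvPolynomial.eval 0 (f i) = 0 := by
    intro i; rw [heval]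
    refine Finset.sum_eq_zero fun j _ => ?_
    rw [Pi.zero_apply, zero_pow (Nat.sub_ne_zero_of_lt hq.one_lt), mul_zero]
  have hne : ∃ x : {x : Fin l.length → ZMod q // ∀ i, MvPolynomial.eval x (f i) = 0},
      x ≠ ⟨0, h0⟩ := by
    by_contra! hcon
    rw [Nat.card_eq_one_iff_exists.2 ⟨_, hcon⟩] at hdvd
    exact hq.one_lt.ne' (Nat.dvd_one.1 hdvd)
  obtain ⟨⟨x, hx⟩, hx0⟩ := hne
  have hx0' : ∃ j, x j ≠ 0 := by
    by_contra! hcon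
    exact hx0 (Subtype.ext (funext hcon))
  let s : Finset (Fin l.length) := Finset.univ.filter fun j => x j ≠ 0
  refine ⟨s.val.map l.get, ?_, ?_, ?_⟩
  · have : (Quot.mk _ l : Multiset (Fin k → ZMod q)) =
        (Finset.univ : Finset (Fin l.length)).val.map l.get := by
      change (l : Multiset (Fin k → ZMod q)) = _
      simp [Fin.univ_val_map]
    rw [this]
    exact Multiset.map_le_map (Finset.val_le_iff.2 (Finset.subset_univ s))
  · obtain ⟨j, hj⟩ := hx0'
    intro h
    rw [Multiset.map_eq_zero, Finset.val_eq_zero] at h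
    have : j ∈ s := by simp [s, hj]
    simp [h] at this
  · funext i
    have h1 := hx i
    rw [heval] at h1
    change (∑ j ∈ s, l.get j) i = 0
    rw [Finset.sum_apply, ← h1, Finset.sum_filter]
    refine Finset.sum_congr rfl fun j _ => ?_
    split_ifs with h
    · rw [ZMod.pow_card_sub_one_eq_one h, mul_one]
    · rw [not_not.1 h, zero_pow (Nat.sub_ne_zero_of_lt hq.one_lt), mul_zero]

theorem noetherBound_pi_zmod (q k : ℕ) [Fact q.Prime] :
    NoetherBound (Multiplicative (Fin k → ZMod q)) (k * (q - 1) + 1) := by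
  classical
  intro A _ _ φ I hI
  refine (Ideal.pow_right_mono (Ideal.le_span_eigenvectors (vecChar q k) (sum_vecChar q k)
    φ I hI) _).trans (Ideal.span_pow_le_of_multiset_prod fun T hT hmem => ?_)
  have hw : ∀ x : A, ∃ w, x ∈ T → ∀ v, φ v x = vecChar q k w v • x := by
    intro x
    by_cases hx : x ∈ T
    · obtain ⟨w, hw⟩ := (hmem x hx).2
      exact ⟨w, fun _ => hw⟩
    · exact ⟨0, fun h => absurd h hx⟩
  choose w hw using hw
  obtain ⟨S', hS', hne, hsum⟩ := exists_sum_eq_zero_of_lt_card (T.map w) (by simp [hT])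
  obtain ⟨S, hS, rfl⟩ := Multiset.exists_map_eq_of_le_map hS'
  refine Ideal.mem_of_dvd _ (Multiset.prod_dvd_prod_of_le hS) (Ideal.subset_span ⟨?_, fun v => ?_⟩)
  · obtain ⟨x, hx⟩ := Multiset.exists_mem_of_ne_zero
      (fun h => hne (by rw [h]; rfl) : S ≠ 0)
    exact Ideal.mem_of_dvd _ (Multiset.dvd_prod hx) (hmem x (Multiset.mem_of_le hS hx)).1
  · have h1 : ∀ R : Multiset A, R ≤ T →
        φ v R.prod = vecChar q k (R.map w).sum v • R.prod := by
      intro R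
      induction R using Multiset.induction_on with
      | empty => intro _; simp [vecChar_apply]
      | cons a R ih =>
        intro hR
        have haR : a ∈ T := Multiset.mem_of_le hR (Multiset.mem_cons_self a R)
        rw [Multiset.prod_cons, map_mul, hw a haR v, ih ((Multiset.le_cons_self R a).trans hR),
          smul_mul_smul_comm, vecChar_sum, vecChar_sum]
        simp
    rw [h1 S hS, hsum]
    simp [vecChar_apply]

theorem exists_addEquiv_pi_zmod {M : Type} [AddCommGroup M] [Finite M] {q : ℕ}
    [Fact q.Prime] [Module (ZMod q) M] :
    ∃ k, Nat.card M = q ^ k ∧ Nonempty (M ≃+ (Fin k → ZMod q)) := by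
  let b := Module.finBasis (ZMod q) M
  refine ⟨Module.finrank (ZMod q) M, ?_, ⟨b.equivFun.toAddEquiv⟩⟩
  have := Nat.card_congr b.equivFun.toEquiv
  rw [Nat.card_fun, Nat.card_zmod] at this
  simpa using this

theorem exists_mulEquiv_pi_zmod {V : Type} [Group V] [Finite V] {q : ℕ} [Fact q.Prime]
    (hcomm : ∀ a b : V, a * b = b * a) (hexp : ∀ a : V, a ^ q = 1) :
    ∃ k, Nat.card V = q ^ k ∧ Nonempty (V ≃* Multiplicative (Fin k → ZMod q)) := by
  let : CommGroup V := { ‹Group V› with mul_comm := hcomm }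
  let : Module (ZMod q) (Additive V) := AddCommGroup.zmodModule fun x => by
    change Additive.ofMul (x.toMul ^ q) = 0
    rw [hexp]; rfl
  have : Finite (Additive V) := inferInstanceAs (Finite V)
  obtain ⟨k, hk, ⟨e⟩⟩ := exists_addEquiv_pi_zmod (M := Additive V) (q := q)
  exact ⟨k, hk, ⟨AddEquiv.toMultiplicativeRight e⟩⟩

theorem noetherNumber_le_of_elementary {V : Type} [Group V] [Finite V] {q k : ℕ}
    (hq : q.Prime) (hcomm : ∀ a b : V, a * b = b * a) (hexp : ∀ a : V, a ^ q = 1)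
    (hk : Nat.card V = q ^ k) : noetherNumber V ≤ k * (q - 1) + 1 := by
  have := Fact.mk hq
  obtain ⟨k', hk', ⟨e⟩⟩ := exists_mulEquiv_pi_zmod hcomm hexp
  rw [hk] at hk'
  rw [Nat.pow_right_injective hq.two_le hk']
  exact ((noetherBound_pi_zmod q k').congr e).noetherNumber_le

section ZeroSum

open scoped Pointwise

variable {p : ℕ}

/-- `w` has a nonempty zero-sum sub-multiset with at most `t` elements. -/
def HasShortZeroSum (w : Multiset (ZMod p)) (t : ℕ) : Prop :=
  ∃ S ≤ w, S ≠ 0 ∧ S.card ≤ t ∧ S.sum = 0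

theorem HasShortZeroSum.of_zero_mem {w : Multiset (ZMod p)} {t : ℕ} (h : 0 ∈ w) (ht : 1 ≤ t) :
    HasShortZeroSum w t :=
  ⟨{0}, Multiset.singleton_le.2 h, by simp, by simpa, by simp⟩

variable [hp : Fact p.Prime]

theorem exists_many_sums_of_card_eq (t r : ℕ) (ht : 1 ≤ t) (w : Multiset (ZMod p))
    (h : t + r ≤ ∑ a, min (w.count a) t) :
    ∃ D : Finset (ZMod p), (∀ x ∈ D, ∃ S ≤ w, S.card = t ∧ S.sum = x) ∧
      min p (r + 1) ≤ D.card := by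
  classical
  induction t, ht using Nat.le_induction generalizing r w with
  | base =>
    refine ⟨w.toFinset, fun x hx => ⟨{x}, ?_, by simp, by simp⟩, ?_⟩
    · simpa using hx
    · have : ∑ a, min (w.count a) 1 ≤ w.toFinset.card := by
        rw [Finset.card_eq_sum_ones, ← Finset.sum_filter_add_sum_filter_not _ (· ∈ w.toFinset)]
        have h2 : ∑ a with a ∉ w.toFinset, min (w.count a) 1 = 0 := by
          refine Finset.sum_eq_zero fun a ha => ?_
          simp only [Multiset.mem_toFinset, Finset.mem_filter, Finset.mem_univ, true_and] at ha
          rw [Multiset.count_eq_zero_of_notMem ha]; simp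
        rw [h2, add_zero]
        exact (Finset.sum_le_sum (g := fun _ => 1) fun a _ => min_le_right _ _).trans
          (by simpa using Finset.card_le_card fun x => by simp)
      omega
  | succ t ht ih =>
    obtain ⟨r₀, hr₀⟩ := Nat.exists_eq_add_of_le ((Nat.le_add_right _ _).trans h)
    have hrr : r ≤ r₀ := by omega
    let F : Finset (ZMod p) := Finset.univ.filter fun a => t + 1 ≤ w.count a
    have hF : F.card * (t + 1) ≤ t + 1 + r₀ := by
      rw [← hr₀, ← smul_eq_mul, ← Finset.sum_const]
      refine (Finset.sum_le_sum fun a ha => ?_).trans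
        (Finset.sum_le_sum_of_subset (Finset.subset_univ F))
      have := (Finset.mem_filter.1 ha).2
      omega
    obtain ⟨B, hBw, hFB, hB1, hBr⟩ : ∃ B : Finset (ZMod p), (∀ a ∈ B, 1 ≤ w.count a) ∧
        F ⊆ B ∧ 1 ≤ B.card ∧ B.card ≤ r₀ + 1 := by
      rcases Finset.eq_empty_or_nonempty F with hE | hne
      · have : ∃ a, 1 ≤ w.count a := by
          by_contra! hcon
          have : ∑ a, min (w.count a) (t + 1) = 0 :=
            Finset.sum_eq_zero fun a _ => by have := hcon a; omega
          omega
        obtain ⟨a, ha⟩ := this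
        exact ⟨{a}, by simpa using ha, by simp [hE], by simp, by simp⟩
      · refine ⟨F, fun a ha => ?_, le_rfl, hne.card_pos, ?_⟩
        · have := (Finset.mem_filter.1 ha).2
          omega
        · have := hne.card_pos
          nlinarith
    have hBle : B.val ≤ w := by
      rw [Multiset.le_iff_count]
      intro a
      by_cases ha : a ∈ B
      · rw [Multiset.count_eq_one_of_mem B.nodup ha]; exact hBw a ha
      · rw [Multiset.count_eq_zero_of_notMem ha]; exact Nat.zero_le _
    have hcount : ∀ a, min ((w - B.val).count a) t + (if a ∈ B then 1 else 0) =
        min (w.count a) (t + 1) := by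
      intro a
      rw [Multiset.count_sub]
      by_cases ha : a ∈ B
      · rw [if_pos ha, Multiset.count_eq_one_of_mem B.nodup ha]
        have := hBw a ha
        omega
      · rw [if_neg ha, Multiset.count_eq_zero_of_notMem ha]
        have : a ∉ F := fun h => ha (hFB h)
        simp only [F, Finset.mem_filter, Finset.mem_univ, true_and, not_le] at this
        omega
    have hsum : ∑ a, min ((w - B.val).count a) t + B.card = t + 1 + r₀ := by
      rw [← hr₀, ← Finset.sum_congr rfl fun a _ => hcount a, Finset.sum_add_distrib]
      simp
    obtain ⟨D, hD, hDcard⟩ := ih (r₀ + 1 - B.card) (w - B.val) (by omega)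
    refine ⟨B + D, fun x hx => ?_, ?_⟩
    · obtain ⟨b, hb, y, hy, rfl⟩ := Finset.mem_add.1 hx
      obtain ⟨S, hS, hSc, rfl⟩ := hD y hy
      refine ⟨b ::ₘ S, ?_, by simp [hSc], by simp⟩
      have h1 : ({b} : Multiset (ZMod p)) ≤ B.val := Multiset.singleton_le.2 hb
      calc b ::ₘ S = {b} + S := rfl
        _ ≤ B.val + (w - B.val) := add_le_add h1 hS
        _ = w := add_tsub_cancel_of_le hBle
    · have hDne : D.Nonempty := by
        rw [← Finset.card_pos]
        have := hp.out.pos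
        omega
      have := ZMod.cauchy_davenport hp.out (Finset.card_pos.1 hB1) hDne
      omega

theorem HasShortZeroSum.of_sum_min {t : ℕ} (ht : 1 ≤ t) {w : Multiset (ZMod p)}
    (h : t + (p - 1) ≤ ∑ a, min (w.count a) t) : HasShortZeroSum w t := by
  obtain ⟨D, hD, hcard⟩ := exists_many_sums_of_card_eq t (p - 1) ht w h
  have hp0 := hp.out.pos
  have hDu : D = Finset.univ := by
    rw [← Finset.card_eq_iff_eq_univ, ZMod.card]
    have := Finset.card_le_univ D
    rw [ZMod.card] at this
    omega
  obtain ⟨S, hS, hSt, hS0⟩ := hD 0 (hDu ▸ Finset.mem_univ _)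
  exact ⟨S, hS, by rintro rfl; simp at hSt; omega, hSt.le, hS0⟩

theorem HasShortZeroSum.of_map_mul {a : ZMod p} (ha : a ≠ 0) {t : ℕ} {w : Multiset (ZMod p)}
    (h : HasShortZeroSum (w.map (a * ·)) t) : HasShortZeroSum w t := by
  obtain ⟨S, hS, hS0, hSt, hsum⟩ := h
  refine ⟨S.map (a⁻¹ * ·), ?_, by simpa, by simpa, ?_⟩
  · have := Multiset.map_le_map (f := (a⁻¹ * ·)) hS
    simpa [Multiset.map_map, ha] using this
  · rw [Multiset.sum_map_mul_left]; simp [hsum]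

theorem Multiset.exists_le_sum_mem_Icc {m : ℕ} (U : Multiset ℕ) (hU : ∀ b ∈ U, b ≤ m)
    (hsum : m + 1 ≤ U.sum) : ∃ J ≤ U, m + 1 ≤ J.sum ∧ J.sum ≤ 2 * m := by
  induction U using Multiset.induction_on with
  | empty => simp at hsum
  | cons b U ih =>
    by_cases h : m + 1 ≤ U.sum
    · obtain ⟨J, hJ, h1⟩ := ih (fun x hx => hU x (Multiset.mem_cons_of_mem hx)) h
      exact ⟨J, hJ.trans (Multiset.le_cons_self _ _), h1⟩
    · refine ⟨_, le_rfl, hsum, ?_⟩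
      have := hU b (Multiset.mem_cons_self _ _)
      rw [Multiset.sum_cons]
      omega

theorem ZMod.cast_sum_val (U : Multiset (ZMod p)) :
    (((U.map ZMod.val).sum : ℕ) : ZMod p) = U.sum := by
  rw [Nat.cast_multiset_sum, Multiset.map_map]
  simp

/-- If `1` occurs often enough, then elements with large enough total value complete to a short
zero-sum. -/
theorem HasShortZeroSum.of_count_one {w : Multiset (ZMod p)} {m : ℕ} (hpm : p = 2 * m + 1)
    (h1 : m ≤ w.count 1) (U : Multiset (ZMod p)) (hUw : U ≤ w)
    (hU2 : ∀ b ∈ U, 2 ≤ b.val) (hsum : m + 1 ≤ (U.map ZMod.val).sum) :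
    HasShortZeroSum w (3 * p / 4) := by
  have hne1 : ∀ b : ZMod p, 2 ≤ b.val → b ≠ 1 := by
    rintro b hb rfl
    have : Fact (1 < p) := ⟨hp.out.one_lt⟩
    rw [ZMod.val_one] at hb
    omega
  have key : ∀ J ≤ U, m + 1 ≤ (J.map ZMod.val).sum → (J.map ZMod.val).sum ≤ 2 * m →
      4 * (J.card + (p - (J.map ZMod.val).sum)) ≤ 3 * p → HasShortZeroSum w (3 * p / 4) := by
    intro J hJ hlow hup hcard
    refine ⟨J + Multiset.replicate (p - (J.map ZMod.val).sum) 1, ?_, ?_, ?_, ?_⟩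
    · rw [Multiset.le_iff_count]
      intro a
      rw [Multiset.count_add, Multiset.count_replicate]
      split_ifs with ha
      · subst ha
        rw [Multiset.count_eq_zero_of_notMem fun h => hne1 _ (hU2 _ (Multiset.mem_of_le hJ h)) rfl]
        omega
      · rw [add_zero]
        exact Multiset.count_le_of_le a (hJ.trans hUw)
    · intro h
      rw [add_eq_zero] at h
      rw [h.1] at hlow
      simp at hlow
    · rw [Multiset.card_add, Multiset.card_replicate]
      omega
    · rw [Multiset.sum_add, Multiset.sum_replicate, nsmul_one, ← ZMod.cast_sum_val, ← Nat.cast_add,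
        Nat.add_sub_cancel' (by omega)]
      simp
  by_cases hbig : ∃ b ∈ U, m + 1 ≤ b.val
  · obtain ⟨b, hb, hbm⟩ := hbig
    have := ZMod.val_lt b
    refine key {b} (Multiset.singleton_le.2 hb) (by simpa) (by simp; omega) ?_
    simp only [Multiset.card_singleton, Multiset.map_singleton, Multiset.sum_singleton]
    have := hU2 b hb
    omega
  · push Not at hbig
    obtain ⟨J', hJ', hlow, hup⟩ := (U.map ZMod.val).exists_le_sum_mem_Icc (m := m) (by
      intro b hb
      obtain ⟨c, hc, rfl⟩ := Multiset.mem_map.1 hb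
      have := hbig c hc
      omega) hsum
    obtain ⟨J, hJ, rfl⟩ := Multiset.exists_map_eq_of_le_map hJ'
    refine key J hJ hlow hup ?_
    have hc : J.card * 2 ≤ (J.map ZMod.val).sum := by
      have := Multiset.card_nsmul_le_sum (s := J.map ZMod.val) (a := 2) (by
        intro x hx
        obtain ⟨c, hc, rfl⟩ := Multiset.mem_map.1 hx
        exact hU2 c (Multiset.mem_of_le hJ hc))
      simpa using this
    omega

theorem count_map_mul {a : ZMod p} (ha : a ≠ 0) (w : Multiset (ZMod p)) (b : ZMod p) :
    (w.map (a * ·)).count (a * b) = w.count b :=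
  Multiset.count_map_eq_count' _ _ (mul_right_injective₀ ha) _

theorem HasShortZeroSum.of_two_heavy {w : Multiset (ZMod p)} {m : ℕ} (hpm : p = 2 * m + 1)
    (hm : 1 ≤ m) {a c : ZMod p} (hac : c ≠ a) (ha0 : a ≠ 0) (ha : m ≤ w.count a)
    (hc : p ≤ w.count c) : HasShortZeroSum w (3 * p / 4) := by
  have hp0 := hp.out.pos
  rcases eq_or_ne c 0 with rfl | hc0
  · exact .of_zero_mem (Multiset.count_pos.1 (by omega)) (by omega)
  refine .of_map_mul (inv_ne_zero ha0) (.of_count_one hpm ?_ (Multiset.replicate p (a⁻¹ * c))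
    ?_ ?_ ?_)
  · rw [← inv_mul_cancel₀ ha0, count_map_mul (inv_ne_zero ha0)]; exact ha
  · rw [← Multiset.le_count_iff_replicate_le, count_map_mul (inv_ne_zero ha0)]; exact hc
  all_goals
    have h2 : 2 ≤ (a⁻¹ * c).val := by
      have h0 : (a⁻¹ * c).val ≠ 0 := by
        rw [Ne, ZMod.val_eq_zero]; exact mul_ne_zero (inv_ne_zero ha0) hc0
      have h1 : (a⁻¹ * c).val ≠ 1 := by
        intro h
        have : Fact (1 < p) := ⟨hp.out.one_lt⟩
        rw [ZMod.val_eq_one hp.out.one_lt] at h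
        rw [inv_mul_eq_one₀ ha0] at h
        exact hac h.symm
      omega
  · intro b hb
    rw [Multiset.eq_of_mem_replicate hb]; exact h2
  · rw [Multiset.map_replicate, Multiset.sum_replicate, smul_eq_mul]
    nlinarith

theorem shortZeroSum_or_heavy {w : Multiset (ZMod p)} {m : ℕ} (hpm : p = 2 * m + 1)
    (hm : 1 ≤ m) (hw : p + 3 * p / 4 ≤ w.card) :
    HasShortZeroSum w (3 * p / 4) ∨ ∃ a, a ≠ 0 ∧ p + m ≤ w.count a := by
  classical
  set t := 3 * p / 4 with ht
  have hcardsum : ∑ a, w.count a = w.card :=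
    Multiset.sum_count_eq_card fun a _ => Finset.mem_univ a
  by_cases hsum : t + (p - 1) ≤ ∑ a, min (w.count a) t
  · exact .inl (.of_sum_min (by omega) hsum)
  by_cases h0 : (0 : ZMod p) ∈ w
  · exact .inl (.of_zero_mem h0 (by omega))
  obtain ⟨a, ha⟩ : ∃ a, t < w.count a := by
    by_contra! hcon
    rw [Finset.sum_congr rfl fun a _ => min_eq_left (hcon a), hcardsum] at hsum
    omega
  have ha0 : a ≠ 0 := by
    rintro rfl
    exact h0 (Multiset.count_pos.1 (by omega))
  have hi := inv_ne_zero ha0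
  set w' := w.map (a⁻¹ * ·) with hw'
  have hcount : w'.count 1 = w.count a := by
    rw [← inv_mul_cancel₀ ha0, hw', count_map_mul hi]
  let U := w'.filter (· ≠ 1)
  have hUcard : w'.count 1 + U.card = w.card := by
    have := Multiset.filter_add_not (· = 1) w'
    have h2 := congrArg Multiset.card this
    rw [Multiset.card_add] at h2
    rw [show w.card = w'.card by simp [hw'], ← h2, Multiset.count_eq_card_filter_eq]
    congr 2
    exact Multiset.filter_congr fun x _ => eq_comm
  have hU2 : ∀ b ∈ U, 2 ≤ b.val := by
    intro b hb
    obtain ⟨hb1, hb2⟩ := Multiset.mem_filter.1 hb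
    have h0 : b.val ≠ 0 := by
      rw [Ne, ZMod.val_eq_zero]
      rintro rfl
      obtain ⟨x, hx, hx0⟩ := Multiset.mem_map.1 hb1
      rcases mul_eq_zero.1 hx0 with h | h
      · exact hi h
      · exact h0 (h ▸ hx)
    have h1 : b.val ≠ 1 := by
      rw [Ne, ZMod.val_eq_one hp.out.one_lt]; exact hb2
    omega
  by_cases hbig : m + 1 ≤ (U.map ZMod.val).sum
  · refine .inl (.of_map_mul hi (.of_count_one hpm ?_ U (Multiset.filter_le _ _) hU2 hbig))
    rw [← hw', hcount]; omega
  · refine .inr ⟨a, ha0, ?_⟩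
    have hc : U.card * 2 ≤ (U.map ZMod.val).sum := by
      have := Multiset.card_nsmul_le_sum (s := U.map ZMod.val) (a := 2) (by
        intro x hx
        obtain ⟨c, hc, rfl⟩ := Multiset.mem_map.1 hx
        exact hU2 c hc)
      simpa using this
    omega

theorem HasShortZeroSum.of_many_heavy {w : Multiset (ZMod p)} {s t : ℕ} (ht : 1 ≤ t)
    (hst : p - 1 ≤ s * t) (F : Finset (ZMod p)) (hF : F.card = s + 1)
    (h : ∀ a ∈ F, t ≤ w.count a) : HasShortZeroSum w t := by
  refine .of_sum_min ht ?_
  calc t + (p - 1) ≤ (s + 1) * t := by linarith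
    _ = ∑ a ∈ F, t := by rw [Finset.sum_const, hF, smul_eq_mul]
    _ ≤ ∑ a ∈ F, min (w.count a) t := Finset.sum_le_sum fun a ha => by
        have := h a ha; omega
    _ ≤ _ := Finset.sum_le_sum_of_subset (Finset.subset_univ F)

theorem shortZeroSum_or_very_heavy {w : Multiset (ZMod p)} {s t e : ℕ} (ht : 1 ≤ t)
    (hst : p - 1 ≤ s * t) (he : s * (s * p) + s * t + p ≤ e * p + t) (hw : e * p + t ≤ w.card) :
    HasShortZeroSum w t ∨ ∃ a, a ≠ 0 ∧ s * p + t ≤ w.count a := by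
  classical
  by_cases h0 : (0 : ZMod p) ∈ w
  · exact .inl (.of_zero_mem h0 ht)
  by_cases hz : HasShortZeroSum w t
  · exact .inl hz
  refine .inr ?_
  by_contra! hcon
  have hlow : ∑ a, min (w.count a) t < t + (p - 1) := by
    by_contra! h
    exact hz (.of_sum_min ht h)
  let H : Finset (ZMod p) := Finset.univ.filter fun a => t ≤ w.count a
  have hHs : H.card ≤ s := by
    by_contra! h
    obtain ⟨F, hFH, hF⟩ := Finset.exists_subset_card_eq (show s + 1 ≤ H.card by omega)
    exact hz (.of_many_heavy ht hst F hF fun a ha => (Finset.mem_filter.1 (hFH ha)).2)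
  have hcardsum : ∑ a, w.count a = w.card :=
    Multiset.sum_count_eq_card fun a _ => Finset.mem_univ a
  have hp0 := hp.out.pos
  have hbound : ∑ a, w.count a ≤ ∑ a, min (w.count a) t + ∑ a ∈ H, s * p := by
    have : ∑ a ∈ H, s * p = ∑ a, if a ∈ H then s * p else 0 := by simp
    rw [this, ← Finset.sum_add_distrib]
    refine Finset.sum_le_sum fun a _ => ?_
    by_cases ha : a ∈ H
    · rw [if_pos ha]
      have ha0 : a ≠ 0 := by
        rintro rfl
        have := (Finset.mem_filter.1 ha).2
        exact h0 (Multiset.count_pos.1 (by omega))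
      have := hcon a ha0
      have := (Finset.mem_filter.1 ha).2
      omega
    · rw [if_neg ha]
      simp only [H, Finset.mem_filter, Finset.mem_univ, true_and, not_le] at ha
      omega
  rw [Finset.sum_const, smul_eq_mul] at hbound
  have hle : H.card * (s * p) ≤ s * (s * p) := Nat.mul_le_mul_right _ hHs
  have hs : 1 ≤ s ∨ p - 1 = 0 := by
    rcases Nat.eq_zero_or_pos s with rfl | h
    · right; omega
    · exact .inl h
  have h2 := hp.out.two_le
  have hst2 : t ≤ s * t := Nat.le_mul_of_pos_left t (by omega)
  omega

end ZeroSum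

section InjSum

variable {K A : Type} [Group K] [DecidableEq K] [CommRing A] [Algebra ℂ A]

/-- The sum of the products `∏ φ (hᵢ) lᵢ` over all tuples of distinct elements `hᵢ` of `B`. -/
def injSum (φ : K →* (A →ₐ[ℂ] A)) : List A → Finset K → A
  | [], _ => 1
  | Y :: l, B => ∑ h ∈ B, φ h Y * injSum φ l (B.erase h)

theorem map_injSum (φ : K →* (A →ₐ[ℂ] A)) (g : K) (l : List A) (B : Finset K) :
    φ g (injSum φ l B) = injSum φ l (B.map (mulLeftEmbedding g)) := by
  induction l generalizing B with
  | nil => simp [injSum]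
  | cons Y l ih =>
    simp only [injSum, map_sum, Finset.sum_map, map_mul]
    refine Finset.sum_congr rfl fun h _ => ?_
    rw [ih, Finset.map_erase, mulLeftEmbedding_apply, map_mul, AlgHom.mul_apply]

theorem injSum_eq_add (φ : K →* (A →ₐ[ℂ] A)) (l : List A) (B : Finset K) (hB : 1 ∈ B) :
    injSum φ l B = injSum φ l (B.erase 1) +
      ∑ j : Fin l.length, l[j] * injSum φ (l.eraseIdx j) (B.erase 1) := by
  induction l generalizing B with
  | nil => simp [injSum]
  | cons Y l ih =>
    simp only [injSum, List.length_cons, Fin.sum_univ_succ]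
    rw [← Finset.add_sum_erase B _ hB]
    have h1 : ∀ h ∈ B.erase 1, φ h Y * injSum φ l (B.erase h) =
        φ h Y * injSum φ l ((B.erase 1).erase h) +
        ∑ j : Fin l.length, l[j] * (φ h Y * injSum φ (l.eraseIdx j) ((B.erase 1).erase h)) := by
      intro h hh
      rw [ih (B.erase h) (Finset.mem_erase.2 ⟨(Finset.ne_of_mem_erase hh).symm, hB⟩),
        Finset.erase_right_comm, mul_add, Finset.mul_sum]
      congr 1
      exact Finset.sum_congr rfl fun j _ => by ring
    rw [Finset.sum_congr rfl h1, Finset.sum_add_distrib, Finset.sum_comm]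
    simp only [map_one, AlgHom.one_apply, Fin.val_zero, List.eraseIdx_zero, List.tail_cons,
      Fin.val_succ, List.eraseIdx_cons_succ, injSum, Finset.mul_sum, Fin.getElem_fin,
      List.getElem_cons_zero, List.getElem_cons_succ]
    ring

theorem injSum_mul_mem (φ : K →* (A →ₐ[ℂ] A)) (J : Ideal A) (l : List A) (B : Finset K) (R : A)
    (h : ∀ hs : List K, hs.Nodup → (∀ k ∈ hs, k ∈ B) → hs.length = l.length →
      (List.zipWith (fun k Y => φ k Y) hs l).prod * R ∈ J) :
    injSum φ l B * R ∈ J := by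
  induction l generalizing B R with
  | nil => simpa [injSum] using h [] (by simp) (by simp) rfl
  | cons Y l ih =>
    rw [injSum, Finset.sum_mul]
    refine J.sum_mem fun k hk => ?_
    rw [mul_comm (φ k Y), mul_assoc]
    refine ih _ _ fun hs hnd hsB hlen => ?_
    have := h (k :: hs) (List.nodup_cons.2 ⟨fun hm => by simpa using hsB k hm, hnd⟩)
      (by
        rintro x hx
        rcases List.mem_cons.1 hx with rfl | hx
        · exact hk
        · exact Finset.mem_of_mem_erase (hsB x hx)) (by simp [hlen])
    rw [List.zipWith_cons_cons, List.prod_cons] at this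
    rwa [← mul_assoc, mul_comm _ (φ k Y)]

end InjSum

/-- Weight spaces in a `ℂ`-algebra, permuted by a group `K` through multipliers in `ZMod p`,
together with an ideal containing all `K`-invariants of weight zero. -/
structure WeightAction (p : ℕ) (K A : Type) [Group K] [CommRing A] [Algebra ℂ A] where
  act : K →* (A →ₐ[ℂ] A)
  wt : ZMod p → AddSubgroup A
  mul_mem : ∀ {i j x y}, x ∈ wt i → y ∈ wt j → x * y ∈ wt (i + j)
  twist : K → ZMod p
  twist_injective : Function.Injective twist
  twist_one : twist 1 = 1
  act_mem : ∀ {j x} (k : K), x ∈ wt j → act k x ∈ wt (twist k * j)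
  ideal : Ideal A
  mem_ideal : ∀ {x}, x ∈ wt 0 → (∀ k, act k x = x) → x ∈ ideal

theorem Multiset.exists_list_sum_of_card {α : Type*} (p s : ℕ) (U : Multiset α)
    (hU : U.card = s * p) :
    ∃ L : List (Multiset α), L.length = s ∧ (∀ X ∈ L, X.card = p) ∧ L.sum = U := by
  classical
  induction s generalizing U with
  | zero => exact ⟨[], rfl, by simp,
      by simpa using (Multiset.card_eq_zero.1 (by simpa using hU)).symm⟩
  | succ s ih =>
    obtain ⟨X, hX, hXc⟩ : ∃ X ≤ U, X.card = p := by
      obtain ⟨l, rfl⟩ := Quot.exists_rep U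
      refine ⟨(l.take p : Multiset α), Multiset.coe_le.2 (List.take_sublist _ _).subperm, ?_⟩
      have : l.length = (s + 1) * p := hU
      rw [Multiset.coe_card, List.length_take, this]
      exact min_eq_left (Nat.le_mul_of_pos_left _ (by omega))
    obtain ⟨L, hL, hLc, hLs⟩ := ih (U - X) (by
      rw [Multiset.card_sub hX, hU, hXc, add_mul, one_mul, Nat.add_sub_cancel])
    refine ⟨X :: L, by simp [hL], by simpa [hXc] using hLc, ?_⟩
    rw [List.sum_cons, hLs, add_tsub_cancel_of_le hX]

namespace WeightAction

variable {p : ℕ} {K A : Type} [Group K] [CommRing A] [Algebra ℂ A]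
  (W : WeightAction p K A)

theorem injSum_mem_wt [DecidableEq K] (l : List A) (hne : l ≠ []) (hl : ∀ Y ∈ l, Y ∈ W.wt 0)
    (B : Finset K) : injSum W.act l B ∈ W.wt 0 := by
  induction l generalizing B with
  | nil => exact absurd rfl hne
  | cons Y l ih =>
    rw [injSum]
    refine AddSubgroup.sum_mem _ fun h _ => ?_
    have h1 : W.act h Y ∈ W.wt 0 := by
      simpa using W.act_mem h (hl Y List.mem_cons_self)
    rcases eq_or_ne l [] with rfl | hne'
    · simpa [injSum] using h1
    · simpa using W.mul_mem h1 (ih hne' (fun y hy => hl y (List.mem_cons_of_mem _ hy)) _)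

theorem injSum_univ_mem [Fintype K] [DecidableEq K] (l : List A) (hne : l ≠ [])
    (hl : ∀ Y ∈ l, Y ∈ W.wt 0) :
    injSum W.act l Finset.univ ∈ W.ideal := by
  refine W.mem_ideal (W.injSum_mem_wt l hne hl _) fun k => ?_
  rw [map_injSum]
  congr 1
  ext x
  simp

theorem injSum_erase_sub_mem [Fintype K] [DecidableEq K] (l : List A) (hl : ∀ Y ∈ l, Y ∈ W.wt 0) :
    injSum W.act l (Finset.univ.erase 1) - (-1) ^ l.length * (l.length.factorial : A) * l.prod
      ∈ W.ideal := by
  induction hn : l.length generalizing l with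
  | zero => rw [List.length_eq_zero_iff] at hn; simp [hn, injSum]
  | succ n ih =>
    have hne : l ≠ [] := by rintro rfl; simp at hn
    have h1 := W.injSum_univ_mem l hne hl
    rw [injSum_eq_add _ _ _ (Finset.mem_univ 1)] at h1
    have h2 : ∑ j : Fin l.length, (l[j] * injSum W.act (l.eraseIdx j) (Finset.univ.erase 1) -
        (-1) ^ n * (n.factorial : A) * l.prod) ∈ W.ideal := by
      refine W.ideal.sum_mem fun j _ => ?_
      have h3 := W.ideal.mul_mem_left l[j] (ih (l.eraseIdx j)
        (fun Y hY => hl Y (List.mem_of_mem_eraseIdx hY))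
        (by rw [List.length_eraseIdx_of_lt j.2, hn]; rfl))
      convert h3 using 1
      rw [← List.mul_prod_eraseIdx (l := l) (i := j) j.2 (fun _ _ => Commute.all _ _)]
      simp only [Fin.getElem_fin]
      ring
    rw [Finset.sum_sub_distrib, Finset.sum_const, Finset.card_univ, Fintype.card_fin] at h2
    convert W.ideal.sub_mem h1 h2 using 1
    rw [Nat.factorial_succ, nsmul_eq_mul, show (l.length : A) = n + 1 by simp [hn]]
    push_cast
    ring

theorem prod_mul_mem [Fintype K] [DecidableEq K] (l : List A) (hl : ∀ Y ∈ l, Y ∈ W.wt 0) (R : A)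
    (h : injSum W.act l (Finset.univ.erase 1) * R ∈ W.ideal) : l.prod * R ∈ W.ideal := by
  have h1 := W.ideal.sub_mem h (W.ideal.mul_mem_right R (W.injSum_erase_sub_mem l hl))
  have h2 := W.ideal.mul_mem_left
    (algebraMap ℂ A ((-1) ^ l.length * (l.length.factorial : ℂ)⁻¹)) h1
  convert h2 using 1
  have h3 : algebraMap ℂ A ((-1) ^ l.length * (l.length.factorial : ℂ)⁻¹) *
      ((-1) ^ l.length * (l.length.factorial : A)) = 1 := by
    rw [show ((-1) ^ l.length * (l.length.factorial : A)) =
      algebraMap ℂ A ((-1) ^ l.length * (l.length.factorial : ℂ)) by simp, ← map_mul,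
      mul_mul_mul_comm, ← mul_pow, inv_mul_cancel₀ (by exact_mod_cast Nat.factorial_ne_zero _)]
    simp
  linear_combination -(l.prod * R) * h3

/-- A multiset of weight vectors, each recorded with its weight. -/
def Good (T : Multiset (ZMod p × A)) : Prop := ∀ x ∈ T, x.2 ∈ W.wt x.1

variable {W}

theorem Good.add {T U : Multiset (ZMod p × A)} (hT : W.Good T) (hU : W.Good U) :
    W.Good (T + U) := fun x hx => (Multiset.mem_add.1 hx).elim (hT x) (hU x)

theorem Good.of_le {T U : Multiset (ZMod p × A)} (hT : W.Good T) (h : U ≤ T) : W.Good U :=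
  fun x hx => hT x (Multiset.mem_of_le h hx)

theorem Good.prod_mem {T : Multiset (ZMod p × A)} (hT : W.Good T) (hne : T ≠ 0) :
    (T.map Prod.snd).prod ∈ W.wt (T.map Prod.fst).sum := by
  induction T using Multiset.induction_on with
  | empty => exact absurd rfl hne
  | cons x T ih =>
    rw [Multiset.map_cons, Multiset.map_cons, Multiset.prod_cons, Multiset.sum_cons]
    rcases eq_or_ne T 0 with rfl | h0
    · simpa using hT x (by simp)
    · exact W.mul_mem (hT x (by simp)) (ih (hT.of_le (Multiset.le_cons_self _ _)) h0)

variable (W) in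
/-- The action of `K` on weight vectors recorded with their weight. -/
def translate (k : K) (x : ZMod p × A) : ZMod p × A := (W.twist k * x.1, W.act k x.2)

theorem Good.translate {T : Multiset (ZMod p × A)} (hT : W.Good T) (k : K) :
    W.Good (T.map (W.translate k)) := by
  intro x hx
  obtain ⟨y, hy, rfl⟩ := Multiset.mem_map.1 hx
  exact W.act_mem k (hT y hy)

theorem prod_translate (T : Multiset (ZMod p × A)) (k : K) :
    ((T.map (W.translate k)).map Prod.snd).prod = W.act k (T.map Prod.snd).prod := by
  rw [map_multiset_prod, Multiset.map_map, Multiset.map_map]; rfl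

/-- Products of `s` blocks of `p` vectors of the same weight can be rewritten with these blocks
carrying `s` new distinct weights. -/
theorem mul_mem_of_heavy [Finite K] [Fact p.Prime] {T : Multiset (ZMod p × A)} (hT : W.Good T)
    {a : ZMod p}
    (ha0 : a ≠ 0) (s : ℕ) (ha : s * p ≤ (T.map Prod.fst).count a) (R : A)
    (h : ∀ T' : Multiset (ZMod p × A), W.Good T' → T'.card = T.card →
      (T.map Prod.fst).count a ≤ (T'.map Prod.fst).count a + s * p →
      (∃ F : Finset (ZMod p), F.card = s ∧ a ∉ F ∧ ∀ c ∈ F, p ≤ (T'.map Prod.fst).count c) →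
      (T'.map Prod.snd).prod * R ∈ W.ideal) :
    (T.map Prod.snd).prod * R ∈ W.ideal := by
  classical
  have := Fintype.ofFinite K
  obtain ⟨U, hU, hUa⟩ := Multiset.exists_map_eq_of_le_map
    (Multiset.le_count_iff_replicate_le.1 ha)
  obtain ⟨V, rfl⟩ := Multiset.le_iff_exists_add.1 hU
  have hUc : U.card = s * p := by simpa using congrArg Multiset.card hUa
  obtain ⟨L, hLs, hLc, rfl⟩ := U.exists_list_sum_of_card p s hUc
  have hp0 : 0 < p := (Fact.out : p.Prime).pos
  have hLle : ∀ X ∈ L, X ≤ L.sum := fun X hX => List.le_sum_of_mem hX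
  have hLa : ∀ X ∈ L, X.map Prod.fst = Multiset.replicate p a := by
    intro X hX
    rw [Multiset.eq_replicate]
    refine ⟨by simpa using hLc X hX, fun b hb => ?_⟩
    have := Multiset.mem_of_le (Multiset.map_le_map (hLle X hX)) hb
    rw [hUa] at this
    exact Multiset.eq_of_mem_replicate this
  have hV : W.Good V := hT.of_le (Multiset.le_add_left _ _)
  have hL : ∀ X ∈ L, W.Good X := fun X hX =>
    hT.of_le ((hLle X hX).trans (Multiset.le_add_right _ _))
  have hsum : ∀ M : List (Multiset (ZMod p × A)), ((M.sum).map Prod.snd).prod =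
      (M.map fun X => (X.map Prod.snd).prod).prod := by
    intro M
    induction M with
    | nil => simp
    | cons X M ih => simp [ih]
  rw [Multiset.map_add, Multiset.prod_add, hsum, mul_assoc]
  refine W.prod_mul_mem _ ?_ _ (injSum_mul_mem _ _ _ _ _ fun hs hnd h1 hlen => ?_)
  · intro Y hY
    obtain ⟨X, hX, rfl⟩ := List.mem_map.1 hY
    have := (hL X hX).prod_mem (by rintro rfl; have := hLc 0 hX; simp at this; omega)
    rw [hLa X hX] at this
    simpa using this
  rw [List.length_map, hLs] at hlen
  let M := List.zipWith (fun k (X : Multiset (ZMod p × A)) => X.map (W.translate k)) hs L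
  have hMprod : (List.zipWith (fun k Y => W.act k Y) hs
      (L.map fun X => (X.map Prod.snd).prod)).prod = (M.sum.map Prod.snd).prod := by
    rw [hsum, List.zipWith_map_right, List.map_zipWith]
    simp only [prod_translate]
  have hM : ∀ Z ∈ M, ∃ k ∈ hs, ∃ X ∈ L, Z = X.map (W.translate k) := by
    intro Z hZ
    obtain ⟨i, hi, rfl⟩ := List.mem_iff_getElem.1 hZ
    simp only [M, List.length_zipWith] at hi
    exact ⟨hs[i]'(by omega), List.getElem_mem _, L[i]'(by omega), List.getElem_mem _,
      by simp [M]⟩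
  have hMgood : W.Good M.sum := by
    intro x hx
    obtain ⟨Z, hZ, hxZ⟩ : ∃ Z ∈ M, x ∈ Z := by
      have h1 : ∀ M : List (Multiset (ZMod p × A)), x ∈ M.sum → ∃ Z ∈ M, x ∈ Z := by
        intro M
        induction M with
        | nil => simp
        | cons Z M ih =>
          rw [List.sum_cons, Multiset.mem_add]
          rintro (h | h)
          · exact ⟨Z, by simp, h⟩
          · obtain ⟨Y, hY, hxY⟩ := ih h
            exact ⟨Y, by simp [hY], hxY⟩
      exact h1 M hx
    obtain ⟨k, -, X, hX, rfl⟩ := hM Z hZ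
    exact (hL X hX).translate k x hxZ
  have hMcard : M.sum.card = s * p := by
    have h1 : ∀ M : List (Multiset (ZMod p × A)), (∀ Z ∈ M, Z.card = p) →
        M.sum.card = M.length * p := by
      intro M hM
      induction M with
      | nil => simp
      | cons Z M ih =>
        rw [List.sum_cons, Multiset.card_add, hM Z (by simp),
          ih fun Z hZ => hM Z (List.mem_cons_of_mem _ hZ), List.length_cons]
        ring
    rw [h1 M]
    · simp [M, hlen, hLs]
    · intro Z hZ
      obtain ⟨k, -, X, hX, rfl⟩ := hM Z hZ
      rw [Multiset.card_map, hLc X hX]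
  rw [hMprod, ← mul_assoc, ← Multiset.prod_add, ← Multiset.map_add]
  refine h _ (hMgood.add hV) (by simp [hMcard, hUc]) ?_
      ⟨hs.toFinset.image (W.twist · * a), ?_, ?_, ?_⟩
  · simp only [Multiset.map_add, Multiset.count_add, hUa, Multiset.count_replicate_self]
    omega
  · rw [Finset.card_image_of_injective, List.toFinset_card_of_nodup hnd, hlen]
    exact (mul_left_injective₀ ha0).comp W.twist_injective
  · intro hmem
    obtain ⟨k, hk, hka⟩ := Finset.mem_image.1 hmem
    have : W.twist k = 1 := by simpa [ha0] using hka
    rw [← W.twist_one] at this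
    have := W.twist_injective this
    subst this
    simpa using h1 1 (List.mem_toFinset.1 hk)
  · intro c hc
    obtain ⟨k, hk, rfl⟩ := Finset.mem_image.1 hc
    obtain ⟨i, hi, rfl⟩ := List.mem_iff_getElem.1 (List.mem_toFinset.1 hk)
    have hiL : i < L.length := by omega
    have hZ : L[i].map (W.translate hs[i]) ∈ M :=
      List.mem_iff_getElem.2 ⟨i, by simp [M]; omega, by simp [M]⟩
    have h2 := Multiset.map_le_map (f := Prod.fst)
      ((List.le_sum_of_mem hZ).trans (Multiset.le_add_right _ V))
    have h3 : (L[i].map (W.translate hs[i])).map Prod.fst =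
        Multiset.replicate p (W.twist hs[i] * a) := by
      rw [Multiset.map_map, ← Multiset.map_replicate (fun x => W.twist hs[i] * x),
        ← hLa L[i] (List.getElem_mem _), Multiset.map_map]
      rfl
    rw [h3] at h2
    exact Multiset.le_count_iff_replicate_le.2 h2

variable (W) in
/-- Modulo the ideal, every product of `X` weight vectors can be rewritten so as to contain a
short zero-sum. -/
def Extracts (X t : ℕ) : Prop :=
  ∀ T : Multiset (ZMod p × A), W.Good T → X ≤ T.card → ∀ R : A,
    (∀ T' : Multiset (ZMod p × A), W.Good T' → T'.card = T.card →
      HasShortZeroSum (T'.map Prod.fst) t → (T'.map Prod.snd).prod * R ∈ W.ideal) →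
    (T.map Prod.snd).prod * R ∈ W.ideal

theorem extracts_three_quarters [Finite K] [Fact p.Prime] {m : ℕ} (hpm : p = 2 * m + 1)
    (hm : 1 ≤ m) :
    W.Extracts (p + 3 * p / 4) (3 * p / 4) := by
  intro T hT hX R h
  rcases shortZeroSum_or_heavy (w := T.map Prod.fst) hpm hm (by simpa using hX) with
    h1 | ⟨a, ha0, ha⟩
  · exact h T hT rfl h1
  refine mul_mem_of_heavy hT ha0 1 (by omega) R fun T' hT' hc hcount ⟨F, hF, haF, hFc⟩ =>
    h T' hT' hc ?_
  obtain ⟨c, rfl⟩ := Finset.card_eq_one.1 hF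
  exact .of_two_heavy hpm hm (a := a) (c := c) (by rintro rfl; simp at haF) ha0 (by omega)
    (hFc c (by simp))

theorem extracts_of_le_mul [Finite K] [Fact p.Prime] {s t e : ℕ} (ht : 1 ≤ t) (htp : t ≤ p)
    (hst : p - 1 ≤ s * t) (he : s * (s * p) + s * t + p ≤ e * p + t) :
    W.Extracts (e * p + t) t := by
  intro T hT hX R h
  rcases shortZeroSum_or_very_heavy (w := T.map Prod.fst) ht hst he (by simpa using hX) with
    h1 | ⟨a, ha0, ha⟩
  · exact h T hT rfl h1
  classical
  refine mul_mem_of_heavy hT ha0 s (by omega) R fun T' hT' hc hcount ⟨F, hF, haF, hFc⟩ =>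
    h T' hT' hc (.of_many_heavy ht hst (insert a F) (by rw [Finset.card_insert_of_notMem haF, hF])
      fun c hcF => ?_)
  rcases Finset.mem_insert.1 hcF with rfl | hcF
  · omega
  · exact htp.trans (hFc c hcF)

theorem exists_zero_sum_of_le_card [Fact p.Prime] {w : Multiset (ZMod p)} (hw : p ≤ w.card) :
    HasShortZeroSum w p := by
  obtain ⟨w', hw', hc⟩ : ∃ w' ≤ w, w'.card = p := by
    obtain ⟨l, rfl⟩ := Quot.exists_rep w
    refine ⟨(l.take p : Multiset _), Multiset.coe_le.2 (List.take_sublist _ _).subperm, ?_⟩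
    rw [Multiset.coe_card, List.length_take]
    exact min_eq_left hw
  have hp0 : 0 < p := (Fact.out : p.Prime).pos
  obtain ⟨S', hS', hne, hsum⟩ := exists_sum_eq_zero_of_lt_card (k := 1)
    (w'.map fun x _ => x) (by simp; omega)
  obtain ⟨S, hS, rfl⟩ := Multiset.exists_map_eq_of_le_map hS'
  refine ⟨S, hS.trans hw', by rintro rfl; simp at hne, ?_, ?_⟩
  · exact (Multiset.card_le_card hS).trans hc.le
  · have h1 := congrArg (Pi.evalAddMonoidHom (fun _ : Fin 1 => ZMod p) 0) hsum
    rw [map_multiset_sum, Multiset.map_map] at h1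
    simpa using h1

theorem mul_prod_mem_of_extracts [Fact p.Prime] {X t : ℕ} (hW : W.Extracts X t) (n m : ℕ)
    (ih : ∀ (T : Multiset (ZMod p × A)) (Z : Multiset A), W.Good T → (∀ z ∈ Z, z ∈ W.wt 0) →
      n ≤ T.card → m + 1 ≤ Z.card → (T.map Prod.snd).prod * Z.prod ∈ W.ideal)
    (T : Multiset (ZMod p × A)) (Z : Multiset A) (hT : W.Good T) (hZ : ∀ z ∈ Z, z ∈ W.wt 0)
    (hX : X ≤ T.card) (hn : n + t ≤ T.card) (hm : m ≤ Z.card) :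
    (T.map Prod.snd).prod * Z.prod ∈ W.ideal := by
  refine hW T hT hX _ fun T' hT' hc ⟨S', hS', hne, hSt, hsum⟩ => ?_
  obtain ⟨S, hS, rfl⟩ := Multiset.exists_map_eq_of_le_map hS'
  obtain ⟨V, rfl⟩ := Multiset.le_iff_exists_add.1 hS
  have h0 := (hT'.of_le hS).prod_mem (by rintro rfl; simp at hne)
  rw [hsum] at h0
  rw [Multiset.map_add, Multiset.prod_add, mul_comm (S.map _).prod, mul_assoc, ← Multiset.prod_cons]
  rw [Multiset.card_add] at hc
  rw [Multiset.card_map] at hSt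
  refine ih V _ (hT'.of_le (Multiset.le_add_left _ _)) ?_ (by omega) (by simpa)
  intro z hz
  rcases Multiset.mem_cons.1 hz with rfl | hz
  exacts [h0, hZ z hz]

theorem mul_prod_mem_of_card [Finite K] [Fact p.Prime] (e : ℕ) (T : Multiset (ZMod p × A))
    (Z : Multiset A)
    (hT : W.Good T) (hZ : ∀ z ∈ Z, z ∈ W.wt 0) (he : e * p ≤ T.card)
    (hd : Nat.card K ≤ Z.card + e) : (T.map Prod.snd).prod * Z.prod ∈ W.ideal := by
  classical
  have := Fintype.ofFinite K
  induction e generalizing T Z with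
  | zero =>
    refine W.ideal.mul_mem_left _ ?_
    obtain ⟨l, rfl⟩ := Quot.exists_rep Z
    change (l : Multiset A).prod ∈ _
    rw [Multiset.prod_coe, ← mul_one l.prod]
    refine W.prod_mul_mem l hZ 1 (injSum_mul_mem _ _ _ _ _ fun hs hnd h1 hlen => ?_)
    exfalso
    have := Finset.card_le_card (show hs.toFinset ⊆ Finset.univ.erase 1 from fun x hx =>
      h1 x (List.mem_toFinset.1 hx))
    rw [List.toFinset_card_of_nodup hnd, Finset.card_erase_of_mem (Finset.mem_univ _),
      Finset.card_univ, ← Nat.card_eq_fintype_card, hlen] at this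
    have h3 : Nat.card K ≤ l.length := hd
    have : 0 < Nat.card K := Nat.card_pos
    omega
  | succ e ih =>
    refine mul_prod_mem_of_extracts (X := p) (t := p) (W := W)
      (fun T hT hX R h => h T hT rfl (exists_zero_sum_of_le_card (by simpa using hX)))
      (e * p) (Nat.card K - e - 1) (fun T Z hT hZ h1 h2 => ih T Z hT hZ h1 (by omega)) T Z hT hZ
      ?_ ?_ (by omega)
    · rw [add_mul] at he; omega
    · rw [add_mul] at he; omega

theorem prod_mem_of_extracts [Finite K] [Fact p.Prime] {e t : ℕ} (hW : W.Extracts (e * p + t) t)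
    (T : Multiset (ZMod p × A)) (hT : W.Good T)
    (hc : e * p + (Nat.card K - e) * t ≤ T.card) : (T.map Prod.snd).prod ∈ W.ideal := by
  have key : ∀ (n : ℕ) (T : Multiset (ZMod p × A)) (Z : Multiset A), W.Good T →
      (∀ z ∈ Z, z ∈ W.wt 0) → e * p + n * t ≤ T.card → Nat.card K ≤ Z.card + n + e →
      (T.map Prod.snd).prod * Z.prod ∈ W.ideal := by
    intro n
    induction n with
    | zero =>
      intro T Z hT hZ h1 h2
      exact mul_prod_mem_of_card e T Z hT hZ (by omega) (by omega)
    | succ n ih =>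
      intro T Z hT hZ h1 h2
      rw [add_mul] at h1
      exact mul_prod_mem_of_extracts hW (e * p + n * t) (Nat.card K - e - n - 1)
        (fun T Z hT hZ h1 h2 => ih T Z hT hZ h1 (by omega)) T Z hT hZ (by omega) (by omega)
        (by omega)
  simpa using key (Nat.card K - e) T 0 hT (by simp) hc (by simp; omega)

end WeightAction

section Frobenius

variable {G : Type} [Group G]

theorem ZMod.addMonoidHom_apply_eq_mul {p : ℕ} [NeZero p] (f : ZMod p →+ ZMod p) (x : ZMod p) :
    f x = f 1 * x := by
  have := map_nsmul f x.val 1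
  rwa [nsmul_eq_mul, nsmul_eq_mul, ZMod.natCast_val, ZMod.cast_id, mul_one, mul_comm] at this

/-- The additive form of conjugation by `k⁻¹` on a normal subgroup identified with `ZMod p`. -/
def conjAddHom {p : ℕ} {N : Subgroup G} [hN : N.Normal] (e : N ≃* Multiplicative (ZMod p)) (k : G) :
    ZMod p →+ ZMod p :=
  MonoidHom.toAdditive ((e.toMonoidHom.comp (MulAut.conjNormal k⁻¹ : N ≃* N).toMonoidHom).comp
    e.symm.toMonoidHom)

theorem conjAddHom_apply {p : ℕ} {N : Subgroup G} [hN : N.Normal]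
    (e : N ≃* Multiplicative (ZMod p)) (k : G) (n : N) :
    conjAddHom e k (e n).toAdd = (e (MulAut.conjNormal k⁻¹ n)).toAdd := by
  change (e (MulAut.conjNormal k⁻¹ (e.symm (e n)))).toAdd = _
  rw [e.symm_apply_apply]

/-- The character of `N ≅ ZMod p` with index `j`. -/
noncomputable def cyclicChar {p : ℕ} [NeZero p] {N : Subgroup G}
    (e : N ≃* Multiplicative (ZMod p)) (j : ZMod p) : N →* ℂ where
  toFun n := ZMod.stdAddChar (j * (e n).toAdd)
  map_one' := by simp
  map_mul' u v := by simp [mul_add, AddChar.map_add_eq_mul]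

theorem sum_cyclicChar {p : ℕ} [Fact p.Prime] {N : Subgroup G} [Fintype N]
    [DecidableEq N] (e : N ≃* Multiplicative (ZMod p)) (n : N) :
    ∑ j, cyclicChar e j n = if n = 1 then (Fintype.card N : ℂ) else 0 := by
  have h := AddChar.sum_mulShift (e n).toAdd (ZMod.isPrimitive_stdAddChar p)
  have hc : Fintype.card N = p := by
    rw [Fintype.card_congr e.toEquiv, Fintype.card_multiplicative, ZMod.card]
  rw [ZMod.card] at h
  rw [hc]
  refine h.trans ?_
  simp

variable {A : Type} [CommRing A] [Algebra ℂ A]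

/-- The weight spaces of a normal subgroup `N ≅ ZMod p` inside a stable ideal, under the action
of a complement `K` acting faithfully on `N`. -/
noncomputable def frobeniusWeightAction {p : ℕ} [Fact p.Prime] {N K : Subgroup G} [hN : N.Normal]
    (e : N ≃* Multiplicative (ZMod p)) (hC : Subgroup.centralizer (N : Set G) ≤ N)
    (hNK : N.IsComplement' K) (φ : G →* (A →ₐ[ℂ] A)) (I : Ideal A)
    (hI : ∀ g, ∀ a ∈ I, φ g a ∈ I) : WeightAction p K A where
  act := φ.comp K.subtype
  wt j :=
    { carrier := {x | x ∈ I ∧ ∀ n : N, φ n x = cyclicChar e j n • x}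
      zero_mem' := ⟨I.zero_mem, by simp⟩
      add_mem' := fun ha hb => ⟨I.add_mem ha.1 hb.1, fun n => by
        rw [map_add, ha.2, hb.2, smul_add]⟩
      neg_mem' := fun ha => ⟨I.neg_mem ha.1, fun n => by rw [map_neg, ha.2, smul_neg]⟩ }
  mul_mem := by
    rintro i j x y ⟨hx, hx'⟩ ⟨hy, hy'⟩
    refine ⟨I.mul_mem_left _ hy, fun n => ?_⟩
    rw [map_mul, hx', hy', smul_mul_smul_comm]
    simp [cyclicChar, add_mul, AddChar.map_add_eq_mul]
  twist k := conjAddHom e k 1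
  twist_injective := by
    intro k k' h
    have h1 : ∀ n : N, MulAut.conjNormal (k : G)⁻¹ n = MulAut.conjNormal (k' : G)⁻¹ n := by
      intro n
      apply e.injective
      apply Multiplicative.toAdd.injective
      rw [← conjAddHom_apply, ← conjAddHom_apply, ZMod.addMonoidHom_apply_eq_mul,
        ZMod.addMonoidHom_apply_eq_mul (conjAddHom e (k' : G))]
      exact congrArg (· * _) h
    have h2 : (k' : G) * (k : G)⁻¹ ∈ N := hC (by
      rw [Subgroup.mem_centralizer_iff]
      intro n hn
      have h3 := congrArg Subtype.val (h1 ⟨n, hn⟩)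
      rw [MulAut.conjNormal_apply, MulAut.conjNormal_apply] at h3
      simp only [inv_inv] at h3
      have : (k' : G) * (k : G)⁻¹ * n = (k' : G) * ((k : G)⁻¹ * n * k) * (k : G)⁻¹ := by group
      rw [this, h3]
      group)
    have h4 : (k' : G) * (k : G)⁻¹ ∈ N ⊓ K := ⟨h2, K.mul_mem k'.2 (K.inv_mem k.2)⟩
    rw [hNK.disjoint.eq_bot, Subgroup.mem_bot, mul_inv_eq_one] at h4
    exact Subtype.ext h4.symm
  twist_one := by
    change (e (MulAut.conjNormal (1 : G)⁻¹ (e.symm (Multiplicative.ofAdd 1)))).toAdd = 1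
    simp
  act_mem := by
    rintro j x k ⟨hx, hx'⟩
    refine ⟨hI _ _ hx, fun n => ?_⟩
    have h1 : φ n (φ k x) = φ k (φ (MulAut.conjNormal (k : G)⁻¹ n : N) x) := by
      rw [← AlgHom.mul_apply, ← AlgHom.mul_apply, ← map_mul, ← map_mul, MulAut.conjNormal_apply]
      congr 2
      group
    have h2 : cyclicChar e (conjAddHom e k 1 * j) n =
        cyclicChar e j (MulAut.conjNormal (k : G)⁻¹ n) := by
      change ZMod.stdAddChar _ = ZMod.stdAddChar _
      rw [← conjAddHom_apply, ZMod.addMonoidHom_apply_eq_mul (conjAddHom e (k : G)) (e n).toAdd]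
      congr 1
      ring
    change φ n (φ k x) = _
    rw [h1, hx', map_smul, h2]
    rfl
  ideal := Ideal.span {a | a ∈ I ∧ ∀ g, φ g a = a}
  mem_ideal := by
    rintro x ⟨hx, hx'⟩ hk
    refine Ideal.subset_span ⟨hx, fun g => ?_⟩
    obtain ⟨⟨n, k⟩, rfl⟩ := hNK.2 g
    have h1 := hx' n
    have h2 := hk k
    simp only [cyclicChar, MonoidHom.coe_mk, OneHom.coe_mk, zero_mul, AddChar.map_zero_eq_one,
      one_smul] at h1
    change φ k x = x at h2
    change φ ((n : G) * k) x = x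
    rw [map_mul, AlgHom.mul_apply, h2, h1]

theorem noetherBound_of_extracts {p : ℕ} [Fact p.Prime] [Finite G] {N K : Subgroup G}
    [hN : N.Normal] (hNp : Nat.card N = p) (hC : Subgroup.centralizer (N : Set G) ≤ N)
    (hNK : N.IsComplement' K) {e t : ℕ}
    (hW : ∀ (A : Type) [CommRing A] [Algebra ℂ A] (W : WeightAction p K A),
      W.Extracts (e * p + t) t) :
    NoetherBound G (e * p + (Nat.card K - e) * t) := by
  classical
  intro A _ _ φ I hI
  have := Fintype.ofFinite N
  have hcyc : IsCyclic N := isCyclic_of_prime_card hNp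
  let f : N ≃* Multiplicative (ZMod p) := (zmodCyclicMulEquiv hcyc).symm.trans
    (by rw [hNp])
  let W := frobeniusWeightAction f hC hNK φ I hI
  refine (Ideal.pow_right_mono (Ideal.le_span_eigenvectors (cyclicChar f) (sum_cyclicChar f)
    (φ.comp N.subtype) I fun v => hI v) _).trans
    (Ideal.span_pow_le_of_multiset_prod fun T hT hmem => ?_)
  have hw : ∀ x : A, ∃ w, x ∈ T → x ∈ W.wt w := by
    intro x
    by_cases hx : x ∈ T
    · obtain ⟨h1, w, hw⟩ := hmem x hx
      exact ⟨w, fun _ => ⟨h1, hw⟩⟩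
    · exact ⟨0, fun h => absurd h hx⟩
  choose w hw using hw
  have := WeightAction.prod_mem_of_extracts (hW A W) (T.map fun x => (w x, x)) (by
    intro x hx
    obtain ⟨y, hy, rfl⟩ := Multiset.mem_map.1 hx
    exact hw y hy) (by rw [Multiset.card_map, hT])
  have h1 : T.prod ∈ W.ideal := by simpa [Multiset.map_map] using this
  exact h1

end Frobenius

section Numerics

theorem le_rpow_of_pow_le {x : ℝ} {d : ℕ} (h : x ^ 10 ≤ (d : ℝ) ^ 9) :
    x ≤ (d : ℝ) ^ (0.9 : ℝ) := by
  refine le_of_pow_le_pow_left₀ (n := 10) (by norm_num) (by positivity) ?_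
  rw [← Real.rpow_natCast ((d : ℝ) ^ (0.9 : ℝ)), ← Real.rpow_mul (by positivity)]
  refine h.trans_eq ?_
  rw [← Real.rpow_natCast]
  norm_num

theorem small_index_bound {d : ℕ} (h2 : 2 ≤ d) (hd : d ≤ 13) :
    (1 + 3 * d : ℝ) / 4 ≤ (d : ℝ) ^ (0.9 : ℝ) := by
  apply le_rpow_of_pow_le
  rw [div_pow, div_le_iff₀ (by norm_num)]
  have : (1 + 3 * d) ^ 10 ≤ d ^ 9 * 4 ^ 10 := by interval_cases d <;> norm_num
  exact_mod_cast this

theorem medium_index_bound {d : ℕ} (h2 : 14 ≤ d) (hd : d < 110) :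
    (d + 6 : ℝ) / 2 ≤ (d : ℝ) ^ (0.9 : ℝ) := by
  apply le_rpow_of_pow_le
  rw [div_pow, div_le_iff₀ (by norm_num)]
  have : (d + 6) ^ 10 ≤ d ^ 9 * 2 ^ 10 := by interval_cases d <;> norm_num
  exact_mod_cast this

theorem large_index_bound {d : ℕ} (hd : 110 ≤ d) :
    ∃ s : ℕ, 1 ≤ s ∧ s ≤ d ∧ (s ^ 2 + 4 + d / s : ℝ) ≤ (d : ℝ) ^ (0.9 : ℝ) := by
  set u : ℝ := (d : ℝ) ^ (0.1 : ℝ) with hu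
  have hd' : (110 : ℝ) ≤ d := by exact_mod_cast hd
  have hu0 : 0 ≤ u := by positivity
  have hu10 : u ^ 10 = d := by
    rw [hu, ← Real.rpow_natCast, ← Real.rpow_mul (by positivity)]; norm_num
  have hu9 : (d : ℝ) ^ (0.9 : ℝ) = u ^ 9 := by
    rw [hu, ← Real.rpow_natCast, ← Real.rpow_mul (by positivity)]; norm_num
  have hu1 : 1.6 ≤ u := by
    refine le_of_pow_le_pow_left₀ (n := 10) (by norm_num) hu0 ?_
    rw [hu10]; exact le_trans (by norm_num) hd'
  have hu7 : (26 : ℝ) ≤ u ^ 7 := le_trans (by norm_num) (pow_le_pow_left₀ (by norm_num) hu1 7)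
  have hu8 : 26 * u ^ 2 ≤ u ^ 9 := by
    have : u ^ 9 = u ^ 7 * u ^ 2 := by ring
    rw [this]; exact mul_le_mul_of_nonneg_right hu7 (by positivity)
  have hs1 := Nat.le_ceil (2 * u)
  have hs2 := Nat.ceil_lt_add_one (show 0 ≤ 2 * u by positivity)
  set s := ⌈2 * u⌉₊ with hs
  have hs0 : (0 : ℝ) < s := by linarith
  refine ⟨s, by exact_mod_cast hs0, ?_, ?_⟩
  · have : (s : ℝ) ≤ d := by
      have : u ^ 9 * 1 ≤ u ^ 9 * u := mul_le_mul_of_nonneg_left (by linarith) (by positivity)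
      have h10 : u ^ 9 * u = d := by rw [← hu10]; ring
      nlinarith
    exact_mod_cast this
  · rw [hu9]
    have h1 : (d : ℝ) / s ≤ u ^ 9 / 2 := by
      rw [div_le_iff₀ hs0, ← hu10]
      have : u ^ 9 / 2 * (2 * u) ≤ u ^ 9 / 2 * s := mul_le_mul_of_nonneg_left hs1 (by positivity)
      linarith [show u ^ 9 / 2 * (2 * u) = u ^ 10 by ring]
    have h2 : (s : ℝ) ^ 2 ≤ (2 * u + 1) ^ 2 := pow_le_pow_left₀ hs0.le hs2.le 2
    nlinarith

end Numerics

theorem Subgroup.ker_conjNormal {G : Type} [Group G] (N : Subgroup G) [N.Normal] :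
    (MulAut.conjNormal : G →* MulAut N).ker = Subgroup.centralizer (N : Set G) := by
  ext g
  rw [MonoidHom.mem_ker, Subgroup.mem_centralizer_iff, MulEquiv.ext_iff]
  simp only [Subtype.forall, Subtype.ext_iff, MulAut.conjNormal_apply, MulAut.one_apply,
    SetLike.mem_coe]
  refine forall₂_congr fun n _ => ?_
  rw [mul_inv_eq_iff_eq_mul, eq_comm]

theorem noetherNumber_le_of_frobenius {G : Type} [Group G] [Finite G] (N : Subgroup G) [N.Normal]
    {p : ℕ} [hp : Fact p.Prime] (hN : Nat.card N = p)
    (hC : Subgroup.centralizer (N : Set G) = N) :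
    (noetherNumber G : ℝ) ≤ p * (N.index : ℝ) ^ (0.9 : ℝ) := by
  have hp1 := hp.out.one_lt
  have hcyc : IsCyclic N := isCyclic_of_prime_card hN
  have hker := N.ker_conjNormal
  have hdvd : N.index ∣ p - 1 := by
    have h1 := Subgroup.card_subgroup_dvd_card (MulAut.conjNormal : G →* MulAut N).range
    rw [← Subgroup.index_ker, hker, hC, IsCyclic.card_mulAut, hN, Nat.totient_prime hp.out] at h1
    exact h1
  have hd0 : N.index ≠ 0 := Subgroup.index_ne_zero_of_finite
  have hle := Nat.le_of_dvd (by omega) hdvd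
  have hcop : (Nat.card N).Coprime N.index := by
    rw [hN, hp.out.coprime_iff_not_dvd]
    intro h
    have := Nat.le_of_dvd (by omega) h
    omega
  obtain ⟨K, hNK⟩ := Subgroup.exists_right_complement'_of_coprime hcop
  have hKd : Nat.card K = N.index := hNK.symm.index_eq_card.symm
  have hpd : p * N.index = Nat.card G := hN ▸ N.card_mul_index
  set d := N.index with hd
  rcases Nat.lt_or_ge d 2 with h1 | h2
  · have : d = 1 := by omega
    rw [this] at hpd ⊢
    have := noetherNumber_le_card G
    simpa using (by exact_mod_cast (by omega : noetherNumber G ≤ p) : (noetherNumber G : ℝ) ≤ p)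
  obtain ⟨m, hpm⟩ : ∃ m, p = 2 * m + 1 := by
    rcases hp.out.eq_two_or_odd' with h | h
    · omega
    · exact h
  have hm : 1 ≤ m := by omega
  have hp0 : (0 : ℝ) < p := by exact_mod_cast (by omega : 0 < p)
  have hfin : ∀ (e t : ℕ) (x : ℝ), (∀ (A : Type) [CommRing A] [Algebra ℂ A]
      (W : WeightAction p K A), W.Extracts (e * p + t) t) →
          ((e * p + (d - e) * t : ℕ) : ℝ) ≤ p * x →
      x ≤ (d : ℝ) ^ (0.9 : ℝ) → (noetherNumber G : ℝ) ≤ p * (d : ℝ) ^ (0.9 : ℝ) := by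
    intro e t x hW h1 h2
    have h3 := (noetherBound_of_extracts hN hC.le hNK hW).noetherNumber_le
    rw [hKd] at h3
    calc (noetherNumber G : ℝ) ≤ ((e * p + (d - e) * t : ℕ) : ℝ) := by exact_mod_cast h3
      _ ≤ p * x := h1
      _ ≤ _ := mul_le_mul_of_nonneg_left h2 hp0.le
  rcases Nat.lt_or_ge d 14 with h13 | h14
  · refine hfin 1 (3 * p / 4) _ (fun A _ _ W => ?_) ?_ (small_index_bound h2 (by omega))
    · rw [one_mul]; exact WeightAction.extracts_three_quarters hpm hm
    · have h4 : ((3 * p / 4 : ℕ) : ℝ) ≤ 3 * p / 4 := by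
        have := Nat.cast_div_le (α := ℝ) (m := 3 * p) (n := 4)
        push_cast at this
        exact this
      push_cast [Nat.cast_sub (show 1 ≤ d by omega)]
      have : (1 : ℝ) ≤ d := by exact_mod_cast (by omega : 1 ≤ d)
      nlinarith [mul_le_mul_of_nonneg_left h4 (show (0 : ℝ) ≤ d - 1 by linarith)]
  rcases Nat.lt_or_ge d 110 with h109 | h110
  · refine hfin 6 m _ (fun A _ _ W => ?_) ?_ (medium_index_bound h14 h109)
    · exact WeightAction.extracts_of_le_mul (s := 2) hm (by omega) (by omega) (by omega)
    · have h5 : (p : ℝ) = 2 * m + 1 := by exact_mod_cast hpm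
      push_cast [Nat.cast_sub (show 6 ≤ d by omega)]
      have : (14 : ℝ) ≤ d := by exact_mod_cast h14
      nlinarith
  · obtain ⟨s, hs1, hsd, hs⟩ := large_index_bound h110
    have hst := Nat.div_add_mod (p - 1 + (s - 1)) s
    have hmod := Nat.mod_lt (p - 1 + (s - 1)) (show 0 < s by omega)
    generalize (p - 1 + (s - 1)) / s = t at hst
    have ht1 : 1 ≤ t := by
      by_contra! h
      have : t = 0 := by omega
      rw [this, mul_zero] at hst
      omega
    have htst : t ≤ s * t := Nat.le_mul_of_pos_left t (by omega)
    have hts : s * t + 2 ≤ p + s := by omega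
    have htp : t ≤ p := by
      by_contra! h
      have h1 : s * (p + 1) ≤ s * t := Nat.mul_le_mul_left s h
      have h2 : 1 * p ≤ s * p := Nat.mul_le_mul_right p hs1
      rw [mul_add] at h1
      omega
    refine hfin (s ^ 2 + 3) t _ (fun A _ _ W => ?_) ?_ hs
    · exact WeightAction.extracts_of_le_mul (s := s) ht1 htp (by omega) (by
        have : (s ^ 2 + 3) * p = s * (s * p) + 3 * p := by ring
        omega)
    · have hs0 : (0 : ℝ) < s := by exact_mod_cast hs1
      have h6 : ((d - (s ^ 2 + 3) : ℕ) : ℝ) ≤ d := by exact_mod_cast Nat.sub_le _ _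
      have h7 : (t : ℝ) ≤ p / s + 1 := by
        have : (s : ℝ) * t ≤ p + s := by exact_mod_cast (by omega : s * t ≤ p + s)
        rw [← sub_nonneg] at this ⊢
        have h8 : (p / s + 1 - t : ℝ) = (p + s - s * t) / s := by field_simp
        rw [h8]; positivity
      have h9 : (d : ℝ) ≤ p := by exact_mod_cast (by omega : d ≤ p)
      push_cast
      calc ((s : ℝ) ^ 2 + 3) * p + ((d - (s ^ 2 + 3) : ℕ) : ℝ) * t
          ≤ ((s : ℝ) ^ 2 + 3) * p + d * (p / s + 1) := by gcongr
        _ ≤ (p : ℝ) * ((s : ℝ) ^ 2 + 4 + d / s) := by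
          have : (d : ℝ) * (p / s + 1) = p * (d / s) + d := by ring
          rw [this]; linarith

section SubnormalFactor

/-- `S` is a quotient of a subnormal subgroup of `G`. -/
def IsSubnormalFactor (S G : Type) [Group S] [Group G] : Prop :=
  ∃ L : Subgroup G, L.IsSubnormal ∧ ∃ f : L →* S, Function.Surjective f

variable {S G G' : Type} [Group S] [Group G] [Group G']

theorem IsSubnormalFactor.of_surjective (h : IsSubnormalFactor S G') (f : G →* G')
    (hf : Function.Surjective f) : IsSubnormalFactor S G := by
  obtain ⟨L, hL, g, hg⟩ := h
  exact ⟨L.comap f, hL.comap f, g.comp (f.subgroupComap L),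
    hg.comp (f.subgroupComap_surjective_of_surjective L hf)⟩

theorem IsSubnormalFactor.of_subgroup {N : Subgroup G} (hN : N.IsSubnormal)
    (h : IsSubnormalFactor S N) : IsSubnormalFactor S G := by
  obtain ⟨L, hL, g, hg⟩ := h
  let e := (L.equivMapOfInjective N.subtype N.subtype_injective).symm
  exact ⟨L.map N.subtype, hL.trans' hN, g.comp e.toMonoidHom, hg.comp e.surjective⟩

theorem IsSubnormalFactor.refl : IsSubnormalFactor G G :=
  ⟨⊤, .top, (Subgroup.topEquiv (G := G)).toMonoidHom, (Subgroup.topEquiv (G := G)).surjective⟩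

/-- `A` is a maximal proper normal subgroup of `B`. -/
def IsCompositionStep (A B : Subgroup G) : Prop :=
  A ≤ B ∧ (A.subgroupOf B).Normal ∧ A ≠ B ∧
    ∀ L : Subgroup G, A ≤ L → L ≤ B → (L.subgroupOf B).Normal → L = A ∨ L = B

theorem exists_compositionSteps_of_normal [Finite G] (A B : Subgroup G) (hAB : A ≤ B)
    (hn : (A.subgroupOf B).Normal) : Relation.ReflTransGen IsCompositionStep A B := by
  induction B using WellFoundedLT.induction with
  | ind B ih =>
    rcases eq_or_ne A B with rfl | hne
    · exact .refl
    obtain ⟨M, hM⟩ := Set.Finite.exists_maximal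
      (s := {M : Subgroup G | A ≤ M ∧ M < B ∧ (M.subgroupOf B).Normal}) (Set.toFinite _)
      ⟨A, le_rfl, lt_of_le_of_ne hAB hne, hn⟩
    obtain ⟨h1, h2, h3⟩ := hM.prop
    have hAM : (A.subgroupOf M).Normal := by
      rw [Subgroup.normal_subgroupOf_iff_le_normalizer h1]
      rw [Subgroup.normal_subgroupOf_iff_le_normalizer hAB] at hn
      exact h2.le.trans hn
    refine (ih M h2 h1 hAM).tail ⟨h2.le, h3, h2.ne, fun L hML hLB hL => ?_⟩
    by_contra! hcon
    exact hcon.1 (le_antisymm (hM.le_of_ge ⟨h1.trans hML, lt_of_le_of_ne hLB hcon.2, hL⟩ hML) hML)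

theorem Subgroup.IsSubnormal.exists_compositionSteps [Finite G] {L : Subgroup G}
    (hL : L.IsSubnormal) : Relation.ReflTransGen IsCompositionStep L ⊤ := by
  induction hL with
  | top => exact .refl
  | step H K h_le _ hN ih => exact (exists_compositionSteps_of_normal H K h_le hN).trans ih

theorem exists_chain_snoc {R : Subgroup G → Subgroup G → Prop} {n : ℕ}
    (H : Fin (n + 1) → Subgroup G) (hR : ∀ i : Fin n, R (H i.castSucc) (H i.succ)) {B : Subgroup G}
    (hB : R (H (Fin.last n)) B) :
    ∃ H' : Fin (n + 1 + 1) → Subgroup G, H' 0 = H 0 ∧ H' (Fin.last (n + 1)) = B ∧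
      (∀ i : Fin (n + 1), R (H' i.castSucc) (H' i.succ)) ∧
      (∀ i : Fin n, H' i.castSucc.castSucc = H i.castSucc ∧ H' i.castSucc.succ = H i.succ) ∧
      H' (Fin.last n).castSucc = H (Fin.last n) := by
  have h1 : ∀ i : Fin (n + 1), (Fin.snoc H B : Fin (n + 1 + 1) → Subgroup G) i.castSucc = H i :=
    fun i => Fin.snoc_castSucc (α := fun _ => Subgroup G) B H i
  have h2 : (Fin.snoc H B : Fin (n + 1 + 1) → Subgroup G) (Fin.last (n + 1)) = B :=
    Fin.snoc_last (α := fun _ => Subgroup G) B H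
  refine ⟨Fin.snoc H B, ?_, h2, fun i => ?_, fun i => ⟨h1 _, ?_⟩, h1 _⟩
  · rw [← Fin.castSucc_zero, h1]
  · induction i using Fin.lastCases with
    | last => rw [h1, Fin.succ_last, h2]; exact hB
    | cast i => rw [h1, Fin.succ_castSucc, h1]; exact hR i
  · rw [Fin.succ_castSucc, h1]

theorem IsSubnormalFactor.isCompositionFactor [Finite G] [IsSimpleGroup S]
    (h : IsSubnormalFactor S G) : IsCompositionFactor S G := by
  obtain ⟨L, hL, f, hf⟩ := h
  let P : Subgroup G → Subgroup G → Prop := fun A B =>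
    ∃ φ : B →* S, Function.Surjective φ ∧ φ.ker = A.subgroupOf B
  have h0 : ∀ A : Subgroup G, Relation.ReflTransGen IsCompositionStep ⊥ A →
      ∃ (n : ℕ) (H : Fin (n + 1) → Subgroup G), H 0 = ⊥ ∧ H (Fin.last n) = A ∧
        ∀ i : Fin n, IsCompositionStep (H i.castSucc) (H i.succ) := by
    intro A hA
    induction hA with
    | refl => exact ⟨0, fun _ => ⊥, rfl, rfl, fun i => i.elim0⟩
    | tail _ hBC ih =>
      obtain ⟨n, H, hH0, hHl, hH⟩ := ih
      obtain ⟨H', h1, h2, h3, -⟩ := exists_chain_snoc H hH (hHl ▸ hBC)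
      exact ⟨n + 1, H', h1.trans hH0, h2, h3⟩
  have hstep : IsCompositionStep (f.ker.map L.subtype) L := by
    have hle : f.ker.map L.subtype ≤ L := Subgroup.map_subtype_le _
    have hsub : (f.ker.map L.subtype).subgroupOf L = f.ker :=
      Subgroup.comap_map_eq_self_of_injective L.subtype_injective _
    refine ⟨hle, by rw [hsub]; infer_instance, fun heq => ?_, fun M hM hML hMn => ?_⟩
    · rw [heq, Subgroup.subgroupOf_self] at hsub
      obtain ⟨x, hx⟩ := exists_ne (1 : S)
      obtain ⟨y, rfl⟩ := hf x
      exact hx (hsub ▸ Subgroup.mem_top y : y ∈ f.ker)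
    · have hkM : f.ker ≤ M.subgroupOf L := by
        rw [← hsub]; exact Subgroup.comap_mono hM
      rcases (hMn.map f hf).eq_bot_or_eq_top with h | h
      · left
        refine le_antisymm ?_ hM
        rw [Subgroup.map_eq_bot_iff] at h
        rw [← Subgroup.map_subgroupOf_eq_of_le hML]
        exact Subgroup.map_mono h
      · right
        refine le_antisymm hML ?_
        rw [← Subgroup.subgroupOf_eq_top, eq_top_iff,
          ← Subgroup.comap_map_eq_self hkM, h, Subgroup.comap_top]
  have hmark : P (f.ker.map L.subtype) L :=
    ⟨f, hf, (Subgroup.comap_map_eq_self_of_injective L.subtype_injective _).symm⟩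
  have h1 : ∀ A : Subgroup G, Relation.ReflTransGen IsCompositionStep L A →
      ∃ (n : ℕ) (H : Fin (n + 1) → Subgroup G), H 0 = ⊥ ∧ H (Fin.last n) = A ∧
        (∀ i : Fin n, IsCompositionStep (H i.castSucc) (H i.succ)) ∧
        ∃ i : Fin n, P (H i.castSucc) (H i.succ) := by
    intro A hA
    induction hA with
    | refl =>
      obtain ⟨n, H, hH0, hHl, hH⟩ := h0 _ (exists_compositionSteps_of_normal ⊥
        (f.ker.map L.subtype) bot_le (by rw [Subgroup.bot_subgroupOf]; infer_instance))
      obtain ⟨H', h1, h2, h3, -, h4⟩ := exists_chain_snoc H hH (hHl ▸ hstep)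
      refine ⟨n + 1, H', h1.trans hH0, h2, h3, Fin.last n, ?_⟩
      rw [h4, Fin.succ_last, h2, hHl]
      exact hmark
    | tail _ hBC ih =>
      obtain ⟨n, H, hH0, hHl, hH, i, hi⟩ := ih
      obtain ⟨H', h1, h2, h3, h4, -⟩ := exists_chain_snoc H hH (hHl ▸ hBC)
      refine ⟨n + 1, H', h1.trans hH0, h2, h3, i.castSucc, ?_⟩
      rw [(h4 i).1, (h4 i).2]
      exact hi
  obtain ⟨n, H, a, b, c, i, φ, d⟩ := h1 ⊤ hL.exists_compositionSteps
  exact ⟨n, H, a, b, c, i, φ, d⟩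

/-- The Noether numbers of the almost simple groups with socle a factor of `G` are bounded by
`2 ^ (-ε) * |H| ^ (1 - ε)`. -/
def AlmostSimpleBound (ε : ℝ) (G : Type) [Group G] : Prop :=
  ∀ (H : Type) [Group H] [Finite H] (S : Subgroup H),
    S.Normal → IsSimpleGroup S → (¬ ∀ a b : S, a * b = b * a) →
    Subgroup.centralizer (S : Set H) = ⊥ → IsSubnormalFactor S G →
    (noetherNumber H : ℝ) ≤ (2 : ℝ) ^ (-ε) * (Nat.card H : ℝ) ^ (1 - ε)

theorem AlmostSimpleBound.of_surjective {ε : ℝ} (h : AlmostSimpleBound ε G) (f : G →* G')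
    (hf : Function.Surjective f) : AlmostSimpleBound ε G' :=
  fun H _ _ S h1 h2 h3 h4 h5 => h H S h1 h2 h3 h4 (h5.of_surjective f hf)

theorem AlmostSimpleBound.of_normal {ε : ℝ} (h : AlmostSimpleBound ε G) (N : Subgroup G)
    [hN : N.Normal] : AlmostSimpleBound ε N :=
  fun H _ _ S h1 h2 h3 h4 h5 => h H S h1 h2 h3 h4 (h5.of_subgroup hN.isSubnormal)

end SubnormalFactor

section Tools

theorem pow_five_le_pow {q k : ℕ} (hq : 2 ≤ q) (hk : 2 ≤ k) :
    (k * (q - 1) + 1) ^ 5 ≤ (q ^ k) ^ 4 := by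
  obtain ⟨t, rfl⟩ := Nat.exists_eq_add_of_le hq
  have ht : 2 + t - 1 = t + 1 := by omega
  rw [ht]
  induction k, hk using Nat.le_induction with
  | base => ring_nf; nlinarith [Nat.zero_le t, Nat.zero_le (t ^ 2), Nat.zero_le (t ^ 3),
      Nat.zero_le (t ^ 4), Nat.zero_le (t ^ 5), Nat.zero_le (t ^ 6), Nat.zero_le (t ^ 7),
      Nat.zero_le (t ^ 8)]
  | succ k hk ih =>
    have h1 : 2 * ((k + 1) * (t + 1) + 1) ≤ 3 * (k * (t + 1) + 1) := by nlinarith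
    have h2 := Nat.pow_le_pow_left h1 5
    rw [mul_pow, mul_pow] at h2
    have h3 : 16 ≤ (2 + t) ^ 4 := by
      calc 16 = 2 ^ 4 := by norm_num
        _ ≤ _ := Nat.pow_le_pow_left (by omega) 4
    calc ((k + 1) * (t + 1) + 1) ^ 5 ≤ (k * (t + 1) + 1) ^ 5 * 16 := by omega
      _ ≤ ((2 + t) ^ k) ^ 4 * (2 + t) ^ 4 := Nat.mul_le_mul ih h3
      _ = ((2 + t) ^ (k + 1)) ^ 4 := by ring

theorem elementary_bound_le_rpow {q k : ℕ} (hq : 2 ≤ q) (hk : 2 ≤ k) {ε : ℝ} (hε : ε ≤ 0.1) :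
    ((k * (q - 1) + 1 : ℕ) : ℝ) ≤ ((q ^ k : ℕ) : ℝ) ^ (1 - 2 * ε) := by
  have h : (((k * (q - 1) + 1) ^ 5 : ℕ) : ℝ) ≤ (((q ^ k) ^ 4 : ℕ) : ℝ) :=
    Nat.cast_le.2 (pow_five_le_pow hq hk)
  have h1 : (1 : ℝ) ≤ ((q ^ k : ℕ) : ℝ) := by exact_mod_cast Nat.one_le_pow _ _ (by omega)
  generalize k * (q - 1) + 1 = a at *
  generalize q ^ k = b at *
  have h2 : (a : ℝ) ≤ (b : ℝ) ^ (0.8 : ℝ) := by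
    refine le_of_pow_le_pow_left₀ (n := 5) (by norm_num) (by positivity) ?_
    rw [← Real.rpow_mul_natCast (by positivity)]
    push_cast at h
    calc (a : ℝ) ^ 5 ≤ b ^ 4 := h
      _ = (b : ℝ) ^ ((4 : ℕ) : ℝ) := (Real.rpow_natCast _ _).symm
      _ = _ := by norm_num
  exact h2.trans (Real.rpow_le_rpow_of_exponent_le h1 (by linarith))

theorem Module.End.orderOf_le_card {K W : Type*} [Field K] [AddCommGroup W] [Module K W]
    [Finite K] [Module.Finite K W] (f : Module.End K W) : orderOf f ≤ Nat.card W := by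
  classical
  have hW : Nat.card W = Nat.card (Fin (Module.finrank K W) → K) :=
    Nat.card_congr (Module.finBasis K W).equivFun.toEquiv
  rw [hW]
  rcases Nat.eq_zero_or_pos (Module.finrank K W) with h0 | h0
  · have : Subsingleton W := Module.finrank_zero_iff.1 h0
    have : f = 1 := Subsingleton.elim _ _
    rw [this, orderOf_one]
    exact Nat.card_pos
  let c : Fin (orderOf f) → Fin (Module.finrank K W) → K :=
    fun i j => (Polynomial.X ^ (i : ℕ) %ₘ LinearMap.charpoly f).coeff j
  have hc : Function.Injective c := by
    intro i j hij
    have hdeg : ∀ n : ℕ, (Polynomial.X ^ n %ₘ LinearMap.charpoly f).natDegree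
        < Module.finrank K W := fun n => by
      rw [← LinearMap.charpoly_natDegree f]
      refine Polynomial.natDegree_modByMonic_lt _ (LinearMap.charpoly_monic f) fun h => ?_
      have := LinearMap.charpoly_natDegree f
      rw [h, Polynomial.natDegree_one] at this
      omega
    have hp : Polynomial.X ^ (i : ℕ) %ₘ LinearMap.charpoly f
        = Polynomial.X ^ (j : ℕ) %ₘ LinearMap.charpoly f := by
      ext n
      by_cases hn : n < Module.finrank K W
      · exact congrFun hij ⟨n, hn⟩
      · rw [Polynomial.coeff_eq_zero_of_natDegree_lt ((hdeg i).trans_le (not_lt.1 hn)),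
          Polynomial.coeff_eq_zero_of_natDegree_lt ((hdeg j).trans_le (not_lt.1 hn))]
    have hf : f ^ (i : ℕ) = f ^ (j : ℕ) := by
      rw [LinearMap.pow_eq_aeval_mod_charpoly f i, LinearMap.pow_eq_aeval_mod_charpoly f j, hp]
    exact Fin.ext (pow_injOn_Iio_orderOf i.2 j.2 hf)
  simpa using Nat.card_le_card_of_injective c hc

theorem orderOf_mulAut_le_of_elementary {V : Type} [Group V] [Finite V] {q : ℕ} [Fact q.Prime]
    (hcomm : ∀ a b : V, a * b = b * a) (hexp : ∀ a : V, a ^ q = 1) (σ : MulAut V) :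
    orderOf σ ≤ Nat.card V := by
  obtain ⟨k, -, ⟨e⟩⟩ := exists_mulEquiv_pi_zmod hcomm hexp
  let Φ : MulAut V →* Module.End (ZMod q) (Fin k → ZMod q) :=
    { toFun := fun τ => AddMonoidHom.toZModLinearMap q
        { toFun := fun x => (e (τ (e.symm (Multiplicative.ofAdd x)))).toAdd
          map_zero' := by simp
          map_add' := fun x y => by simp }
      map_one' := LinearMap.ext fun x => by simp
      map_mul' := fun a b => LinearMap.ext fun x => by simp }
  have hΦ : Function.Injective Φ := by
    intro a b hab
    ext x
    have := LinearMap.congr_fun hab (e x).toAdd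
    simpa [Φ] using this
  rw [← orderOf_injective Φ hΦ σ, Nat.card_congr e.toEquiv]
  exact Module.End.orderOf_le_card _

theorem card_le_of_isCyclic_mulAut_of_elementary {V : Type} [Group V] [Finite V] {q : ℕ}
    [Fact q.Prime] (hcomm : ∀ a b : V, a * b = b * a) (hexp : ∀ a : V, a ^ q = 1)
    (J : Subgroup (MulAut V)) [IsCyclic J] : Nat.card J ≤ Nat.card V := by
  obtain ⟨g, hg⟩ := IsCyclic.exists_ofOrder_eq_natCard (α := J)
  rw [← hg, ← Subgroup.orderOf_coe]
  exact orderOf_mulAut_le_of_elementary hcomm hexp _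

theorem MonoidHom.isCyclic_range_of_ker_le {A X Y : Type*} [Group A] [Group X] [Group Y]
    [IsCyclic Y] (f : A →* X) (g : A →* Y) (h : g.ker ≤ f.ker) : IsCyclic f.range := by
  obtain ⟨⟨_, a, rfl⟩, hy⟩ := IsCyclic.exists_generator (α := g.range)
  refine ⟨⟨⟨f a, a, rfl⟩, ?_⟩⟩
  rintro ⟨_, b, rfl⟩
  obtain ⟨n, hn⟩ := Subgroup.mem_zpowers_iff.1 (hy ⟨g b, b, rfl⟩)
  refine Subgroup.mem_zpowers_iff.2 ⟨n, Subtype.ext ?_⟩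
  have h1 : g a ^ n = g b := by simpa using congrArg Subtype.val hn
  have h2 : (a ^ n)⁻¹ * b ∈ f.ker := h (by rw [MonoidHom.mem_ker]; simp [h1])
  rw [MonoidHom.mem_ker, map_mul, map_inv, map_zpow, inv_mul_eq_one] at h2
  simpa using h2

theorem MonoidHom.card_ker_mul_card_range {A X : Type*} [Group A] [Group X] (f : A →* X) :
    Nat.card f.ker * Nat.card f.range = Nat.card A := by
  rw [← Subgroup.index_ker, Subgroup.card_mul_index]

variable {G : Type*} [Group G]

theorem Subgroup.characteristic_of_forall_mem {H : Subgroup G}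
    (h : ∀ φ : G ≃* G, ∀ x ∈ H, φ x ∈ H) : H.Characteristic :=
  Subgroup.characteristic_iff_le_comap.2 fun φ x hx => h φ x hx

theorem Subgroup.Characteristic.apply_mem {H : Subgroup G} (h : H.Characteristic) (φ : G ≃* G)
    {x : G} (hx : x ∈ H) : φ x ∈ H :=
  Subgroup.characteristic_iff_le_comap.1 h φ hx

/-- The homomorphism `a ↦ a ^ n` on an abelian subgroup. -/
def Subgroup.powHom (A : Subgroup G) (hA : ∀ a ∈ A, ∀ b ∈ A, a * b = b * a) (n : ℕ) : A →* G where
  toFun a := (a : G) ^ n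
  map_one' := one_pow n
  map_mul' a b := Commute.mul_pow (hA a a.2 b b.2) n

/-- The elements of an abelian subgroup whose `n`-th power is trivial. -/
def Subgroup.torsion (A : Subgroup G) (hA : ∀ a ∈ A, ∀ b ∈ A, a * b = b * a) (n : ℕ) :
    Subgroup G :=
  (A.powHom hA n).ker.map A.subtype

theorem Subgroup.mem_torsion {A : Subgroup G} {hA : ∀ a ∈ A, ∀ b ∈ A, a * b = b * a} {n : ℕ}
    {x : G} : x ∈ A.torsion hA n ↔ x ∈ A ∧ x ^ n = 1 := by
  simp only [Subgroup.torsion, Subgroup.mem_map, MonoidHom.mem_ker, Subgroup.powHom]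
  constructor
  · rintro ⟨a, ha, rfl⟩
    exact ⟨a.2, ha⟩
  · rintro ⟨h1, h2⟩
    exact ⟨⟨x, h1⟩, h2, rfl⟩

theorem Subgroup.mem_range_powHom {A : Subgroup G} {hA : ∀ a ∈ A, ∀ b ∈ A, a * b = b * a} {n : ℕ}
    {x : G} : x ∈ (A.powHom hA n).range ↔ ∃ a ∈ A, a ^ n = x := by
  constructor
  · rintro ⟨a, rfl⟩
    exact ⟨a, a.2, rfl⟩
  · rintro ⟨a, ha, rfl⟩
    exact ⟨⟨a, ha⟩, rfl⟩

theorem Subgroup.Characteristic.torsion {A : Subgroup G} (h : A.Characteristic)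
    (hA : ∀ a ∈ A, ∀ b ∈ A, a * b = b * a) (n : ℕ) : (A.torsion hA n).Characteristic :=
  Subgroup.characteristic_of_forall_mem fun φ x hx => by
    rw [Subgroup.mem_torsion] at hx ⊢
    exact ⟨h.apply_mem φ hx.1, by rw [← map_pow, hx.2, map_one]⟩

theorem Subgroup.Characteristic.range_powHom {A : Subgroup G} (h : A.Characteristic)
    (hA : ∀ a ∈ A, ∀ b ∈ A, a * b = b * a) (n : ℕ) : (A.powHom hA n).range.Characteristic :=
  Subgroup.characteristic_of_forall_mem fun φ x hx => by
    rw [Subgroup.mem_range_powHom] at hx ⊢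
    obtain ⟨a, ha, rfl⟩ := hx
    exact ⟨φ a, h.apply_mem φ ha, by rw [map_pow]⟩

theorem Subgroup.card_torsion_mul (A : Subgroup G)
    (hA : ∀ a ∈ A, ∀ b ∈ A, a * b = b * a) (n : ℕ) :
    Nat.card (A.torsion hA n) * Nat.card (A.powHom hA n).range = Nat.card A := by
  rw [← MonoidHom.card_ker_mul_card_range (A.powHom hA n), Subgroup.torsion,
    Subgroup.card_map_of_injective A.subtype_injective]

theorem isCyclic_of_forall_prime [Finite G] (hcomm : ∀ a b : G, a * b = b * a)
    (h : ∀ q : ℕ, q.Prime → Nat.card {x : G // x ^ q = 1} ≤ q) : IsCyclic G := by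
  classical
  have key : ∀ n : ℕ, 0 < n → Nat.card {x : G // x ^ n = 1} ≤ n := by
    intro n
    induction n using induction_on_primes with
    | zero => simp
    | one =>
      intro _
      have : Subsingleton {x : G // x ^ 1 = 1} :=
        ⟨fun a b => Subtype.ext (by rw [← pow_one a.1, ← pow_one b.1, a.2, b.2])⟩
      exact Finite.card_le_one_iff_subsingleton.2 this
    | prime_mul q n hq ih =>
      intro hqn
      have hn : 0 < n := Nat.pos_of_mul_pos_left hqn
      let H : Subgroup G := (⊤ : Subgroup G).torsion (fun a _ b _ => hcomm a b) (q * n)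
      have hH : ∀ a ∈ H, ∀ b ∈ H, a * b = b * a := fun a _ b _ => hcomm a b
      have e1 : Nat.card {x : G // x ^ (q * n) = 1} = Nat.card H :=
        Nat.card_congr (Equiv.subtypeEquivRight fun x => by
          rw [Subgroup.mem_torsion]; simp)
      rw [e1, ← H.card_torsion_mul hH n, mul_comm q]
      refine Nat.mul_le_mul ?_ ?_
      · refine le_trans ?_ (ih hn)
        refine Nat.card_le_card_of_injective
          (fun x : H.torsion hH n => (⟨x.1, (Subgroup.mem_torsion.1 x.2).2⟩ :
            {x : G // x ^ n = 1})) fun a b hab => ?_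
        exact Subtype.ext (by simpa using hab)
      · refine le_trans ?_ (h q hq)
        refine Nat.card_le_card_of_injective
          (fun x : (H.powHom hH n).range => (⟨x.1, ?_⟩ :
            {x : G // x ^ q = 1})) fun a b hab => ?_
        · obtain ⟨a, ha, h1⟩ := Subgroup.mem_range_powHom.1 x.2
          rw [← h1, ← pow_mul, mul_comm]
          exact (Subgroup.mem_torsion.1 ha).2
        · exact Subtype.ext (by simpa using hab)
  cases nonempty_fintype G
  refine isCyclic_of_card_pow_eq_one_le fun n hn => ?_
  refine le_trans (le_of_eq ?_) (key n hn)
  rw [Nat.card_eq_fintype_card, Fintype.card_subtype]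

theorem Subgroup.card_comap_mk (V : Subgroup G) [V.Normal] (D : Subgroup (G ⧸ V)) :
    Nat.card (D.comap (QuotientGroup.mk' V)) = Nat.card V * Nat.card D := by
  have h := MonoidHom.card_ker_mul_card_range ((QuotientGroup.mk' V).subgroupComap D)
  rw [MonoidHom.range_eq_top.2 (MonoidHom.subgroupComap_surjective_of_surjective _ _
    (QuotientGroup.mk'_surjective V)), Subgroup.card_top] at h
  rw [← h]
  refine congrArg (· * Nat.card D) (Eq.symm ?_)
  refine Nat.card_congr ⟨fun x => ⟨⟨x, ?_⟩, ?_⟩,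
    fun x => ⟨x.1.1, (QuotientGroup.eq_one_iff _).1 (Subtype.ext_iff.1 x.2)⟩,
    fun x => rfl, fun x => rfl⟩
  · rw [Subgroup.mem_comap, QuotientGroup.mk'_apply, (QuotientGroup.eq_one_iff _).2 x.2]
    exact D.one_mem
  · exact Subtype.ext ((QuotientGroup.eq_one_iff _).2 x.2)

theorem MonoidHom.comm_of_isCyclic_of_ker_le_center {X : Type*} [Group X] [IsCyclic X]
    (f : G →* X) (hf : f.ker ≤ Subgroup.center G) (a b : G) : a * b = b * a :=
  (f.isMulCommutative_of_isCyclic_of_ker_le_center hf).is_comm.comm a b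

end Tools

section ElementaryCharacteristic

/-- The bound of the main theorem holds for some characteristic cyclic subgroup of `G`. -/
def CyclicBound (ε : ℝ) (G : Type) [Group G] : Prop :=
  ∃ C : Subgroup G, C.Characteristic ∧ IsCyclic C ∧
    (noetherNumber G : ℝ) ≤ (Nat.card C : ℝ) ^ ε * (Nat.card G : ℝ) ^ (1 - ε)

variable {G : Type} [Group G] [Finite G] {ε : ℝ}

theorem noetherNumber_le_rpow_of_elementary {V : Type} [Group V] [Finite V] {q k : ℕ}
    (hq : q.Prime) (hcomm : ∀ a b : V, a * b = b * a) (hexp : ∀ a : V, a ^ q = 1)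
    (hk : Nat.card V = q ^ k) (hk2 : 2 ≤ k) (hε : ε ≤ 0.1) :
    (noetherNumber V : ℝ) ≤ (Nat.card V : ℝ) ^ (1 - 2 * ε) := by
  rw [hk]
  exact (Nat.cast_le.2 (noetherNumber_le_of_elementary hq hcomm hexp hk)).trans
    (elementary_bound_le_rpow hq.two_le hk2 hε)

theorem cyclicBound_of_elementary {q k : ℕ} (hq : q.Prime) (hε0 : 0 < ε) (hε1 : ε ≤ 0.1)
    (V : Subgroup G) (hV : V.Characteristic) (hcomm : ∀ a ∈ V, ∀ b ∈ V, a * b = b * a)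
    (hexp : ∀ a ∈ V, a ^ q = 1) (hk : Nat.card V = q ^ k) (hk2 : 2 ≤ k)
    (hmax : ∀ W : Subgroup G, W.Characteristic → (∀ a ∈ W, ∀ b ∈ W, a * b = b * a) →
      (∀ a ∈ W, a ^ q = 1) → Nat.card W ≤ Nat.card V)
    (ih : CyclicBound ε (G ⧸ V)) : CyclicBound ε G := by
  have := Fact.mk hq
  obtain ⟨D', hD'c, hD', hγ⟩ := ih
  have hcomm' : ∀ a b : V, a * b = b * a := fun a b => Subtype.ext (hcomm a a.2 b b.2)
  have hexp' : ∀ a : V, a ^ q = 1 := fun a => Subtype.ext (hexp a a.2)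
  let D := D'.comap (QuotientGroup.mk' V)
  have hDchar : D.Characteristic := Subgroup.Characteristic.comap_quotient_mk (H := V) hD'c
  have hcardD : Nat.card D = Nat.card V * Nat.card D' := V.card_comap_mk D'
  let g : D →* D' := (QuotientGroup.mk' V).subgroupComap D'
  have hgker : ∀ x : D, x ∈ g.ker ↔ (x : G) ∈ V := fun x => by
    rw [MonoidHom.mem_ker, ← QuotientGroup.eq_one_iff]
    exact Subtype.ext_iff
  have hVC : V ≤ Subgroup.centralizer (V : Set G) := fun x hx =>
    Subgroup.mem_centralizer_iff.2 fun y hy => hcomm y hy x hx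
  let r : D →* MulAut V := (MulAut.conjNormal : G →* MulAut V).comp D.subtype
  have hrker : ∀ x : D, x ∈ r.ker ↔ (x : G) ∈ Subgroup.centralizer (V : Set G) := fun x => by
    rw [← Subgroup.ker_conjNormal V]; rfl
  have hr : IsCyclic r.range := r.isCyclic_range_of_ker_le g fun x hx =>
    (hrker x).2 (hVC ((hgker x).1 hx))
  have hrcard := card_le_of_isCyclic_mulAut_of_elementary hcomm' hexp' r.range
  let A := D ⊓ Subgroup.centralizer (V : Set G)
  have hAchar : A.Characteristic := inferInstance
  have hAD : Nat.card A * Nat.card r.range = Nat.card D := by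
    rw [← MonoidHom.card_ker_mul_card_range r]
    congr 1
    rw [← Subgroup.card_map_of_injective D.subtype_injective]
    congr 2
    ext x
    simp only [A, Subgroup.mem_inf, Subgroup.mem_map, hrker]
    exact ⟨fun h => ⟨⟨x, h.1⟩, h.2, rfl⟩, by rintro ⟨y, hy, rfl⟩; exact ⟨y.2, hy⟩⟩
  let gA : A →* D' := g.comp (Subgroup.inclusion inf_le_left)
  have hgA : ∀ x : A, x ∈ gA.ker ↔ (x : G) ∈ V := fun x => hgker _
  have hA : ∀ a ∈ A, ∀ b ∈ A, a * b = b * a := fun a ha b hb =>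
    Subtype.ext_iff.1 (gA.comm_of_isCyclic_of_ker_le_center (fun x hx =>
      Subgroup.mem_center_iff.2 fun y => Subtype.ext
        ((Subgroup.mem_centralizer_iff.1 y.2.2 x ((hgA x).1 hx)).symm)) ⟨a, ha⟩ ⟨b, hb⟩)
  have hVA : V ≤ A := le_inf (fun x hx => by
    change (QuotientGroup.mk' V) x ∈ D'
    rw [QuotientGroup.mk'_apply, (QuotientGroup.eq_one_iff _).2 hx]
    exact D'.one_mem) hVC
  have hT := hmax (A.torsion hA q) (hAchar.torsion hA q)
    (fun a ha b hb => hA a (Subgroup.mem_torsion.1 ha).1 b (Subgroup.mem_torsion.1 hb).1)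
    (fun a ha => (Subgroup.mem_torsion.1 ha).2)
  have hcyc : IsCyclic (A.powHom hA q).range :=
    MonoidHom.isCyclic_range_of_ker_le _ gA fun x hx => hexp _ ((hgA x).1 hx)
  have hle : Nat.card D' ≤ Nat.card V * Nat.card (A.powHom hA q).range := by
    have h1 := A.card_torsion_mul hA q
    have hpos : 0 < Nat.card V := Nat.card_pos
    refine Nat.le_of_mul_le_mul_left ?_ hpos
    calc Nat.card V * Nat.card D' = Nat.card A * Nat.card r.range := by rw [hAD, hcardD]
      _ ≤ (Nat.card V * Nat.card (A.powHom hA q).range) * Nat.card V := by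
        rw [← h1]; gcongr
      _ = _ := by ring
  refine ⟨_, hAchar.range_powHom hA q, hcyc, ?_⟩
  have h1 : (noetherNumber G : ℝ) ≤ noetherNumber V * noetherNumber (G ⧸ V) := by
    exact_mod_cast noetherNumber_le_mul_quotient V
  have h2 := noetherNumber_le_rpow_of_elementary hq hcomm' hexp' hk hk2 hε1
  have hle' : (Nat.card D' : ℝ) ≤ Nat.card V * Nat.card (A.powHom hA q).range := by
    exact_mod_cast hle
  have hG : (Nat.card G : ℝ) = Nat.card (G ⧸ V) * Nat.card V := by
    exact_mod_cast V.card_eq_card_quotient_mul_card_subgroup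
  have hv : (0 : ℝ) < Nat.card V := by exact_mod_cast Nat.card_pos
  rw [hG]
  generalize (Nat.card (A.powHom hA q).range : ℝ) = a at *
  have ha : 0 ≤ a := by
    by_contra! h
    have : (0 : ℝ) ≤ Nat.card D' := Nat.cast_nonneg _
    nlinarith
  calc (noetherNumber G : ℝ) ≤ noetherNumber V * noetherNumber (G ⧸ V) := h1
    _ ≤ (Nat.card V : ℝ) ^ (1 - 2 * ε) *
        (((Nat.card V : ℝ) * a) ^ ε * (Nat.card (G ⧸ V) : ℝ) ^ (1 - ε)) := by
      refine mul_le_mul h2 (hγ.trans ?_) (by positivity) (by positivity)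
      gcongr
    _ = a ^ ε * (((Nat.card V : ℝ) ^ (1 - 2 * ε) * (Nat.card V : ℝ) ^ ε) *
        (Nat.card (G ⧸ V) : ℝ) ^ (1 - ε)) := by
      rw [Real.mul_rpow hv.le ha]; ring
    _ = _ := by
      rw [← Real.rpow_add hv, Real.mul_rpow (by positivity) hv.le]
      rw [show 1 - 2 * ε + ε = 1 - ε by ring]; ring

/-- Every characteristic elementary abelian subgroup of `G` is cyclic. -/
def CharacteristicElementaryCyclic (G : Type) [Group G] : Prop :=
  ∀ q : ℕ, q.Prime → ∀ V : Subgroup G, V.Characteristic → (∀ a ∈ V, ∀ b ∈ V, a * b = b * a) →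
    (∀ a ∈ V, a ^ q = 1) → Nat.card V ≤ q

theorem CharacteristicElementaryCyclic.isCyclic (h : CharacteristicElementaryCyclic G)
    {A : Subgroup G} (hAc : A.Characteristic) (hA : ∀ a ∈ A, ∀ b ∈ A, a * b = b * a) :
    IsCyclic A := by
  refine isCyclic_of_forall_prime (fun a b => Subtype.ext (hA a a.2 b b.2)) fun q hq => ?_
  refine le_trans ?_ (h q hq _ (hAc.torsion hA q)
    (fun a ha b hb => hA a (Subgroup.mem_torsion.1 ha).1 b (Subgroup.mem_torsion.1 hb).1)
    (fun a ha => (Subgroup.mem_torsion.1 ha).2))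
  refine Nat.card_le_card_of_injective
    (fun x : {x : A // x ^ q = 1} => (⟨x.1, Subgroup.mem_torsion.2 ⟨x.1.2, Subtype.ext_iff.1 x.2⟩⟩ :
      A.torsion hA q)) fun a b hab => ?_
  exact Subtype.ext (Subtype.ext (by simpa using hab))

theorem cyclicBound_of_not_characteristicElementaryCyclic (hε0 : 0 < ε) (hε1 : ε ≤ 0.1)
    (h : ¬ CharacteristicElementaryCyclic G)
    (ih : ∀ V : Subgroup G, ∀ _ : V.Characteristic, V ≠ ⊥ → CyclicBound ε (G ⧸ V)) :
    CyclicBound ε G := by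
  unfold CharacteristicElementaryCyclic at h
  push Not at h
  obtain ⟨q, hq, V₀, hV₀c, hV₀, hV₀e, hlt⟩ := h
  have := Fact.mk hq
  obtain ⟨V, ⟨hVc, hV, hVe⟩, hmax⟩ := Set.exists_max_image
    {V : Subgroup G | V.Characteristic ∧ (∀ a ∈ V, ∀ b ∈ V, a * b = b * a) ∧ ∀ a ∈ V, a ^ q = 1}
    (fun V => Nat.card V) (Set.toFinite _) ⟨V₀, hV₀c, hV₀, hV₀e⟩
  have hlt' : q < Nat.card V := hlt.trans_le (hmax V₀ ⟨hV₀c, hV₀, hV₀e⟩)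
  obtain ⟨k, hk, -⟩ := exists_mulEquiv_pi_zmod (V := V) (q := q)
    (fun a b => Subtype.ext (hV a a.2 b b.2)) (fun a => Subtype.ext (hVe a a.2))
  refine cyclicBound_of_elementary hq hε0 hε1 V hVc hV hVe hk ?_
    (fun W h1 h2 h3 => hmax W ⟨h1, h2, h3⟩) (ih V hVc ?_)
  · by_contra! hk2
    rw [hk] at hlt'
    have := Nat.pow_le_pow_right hq.pos (show k ≤ 1 by omega)
    rw [pow_one] at this
    omega
  · rintro rfl
    rw [Subgroup.card_bot] at hlt'
    have := hq.pos
    omega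

end ElementaryCharacteristic

section NonabelianMinimal

theorem Equiv.Perm.orderOf_le_two_pow {α : Type*} [Finite α] (σ : Equiv.Perm α) :
    orderOf σ ≤ 2 ^ Nat.card α := by
  classical
  cases nonempty_fintype α
  have key : ∀ s : Multiset ℕ, s.prod ≤ 2 ^ s.sum := fun s => by
    induction s using Multiset.induction with
    | empty => simp
    | cons a s ih =>
      rw [Multiset.prod_cons, Multiset.sum_cons, pow_add]
      exact Nat.mul_le_mul Nat.lt_two_pow_self.le ih
  have hpos : 0 < σ.cycleType.prod := by
    refine Nat.pos_of_ne_zero fun h => ?_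
    have := Equiv.Perm.two_le_of_mem_cycleType (Multiset.prod_eq_zero_iff.1 h)
    omega
  rw [← Equiv.Perm.lcm_cycleType]
  refine (Nat.le_of_dvd hpos (Multiset.lcm_dvd.2 fun a ha => Multiset.dvd_prod ha)).trans
    ((key _).trans (Nat.pow_le_pow_right (by norm_num) ?_))
  rw [Equiv.Perm.sum_cycleType, Nat.card_eq_fintype_card]
  exact Finset.card_le_univ _

theorem MulAut.conj_injective_of_simple {S : Type*} [Group S] [IsSimpleGroup S]
    (hS : ¬ ∀ a b : S, a * b = b * a) :
    Function.Injective (MulAut.conj : S →* MulAut S) := by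
  rw [← MonoidHom.ker_eq_bot_iff]
  refine ((inferInstance : (MulAut.conj : S →* MulAut S).ker.Normal).eq_bot_or_eq_top).resolve_right
    fun h => hS fun a b => ?_
  have : a ∈ (MulAut.conj : S →* MulAut S).ker := h ▸ Subgroup.mem_top a
  have h1 := DFunLike.congr_fun (MonoidHom.mem_ker.1 this) b
  simpa [mul_inv_eq_iff_eq_mul] using h1

theorem AlmostSimpleBound.noetherNumber_le {ε : ℝ} {G : Type} [Group G]
    (h : AlmostSimpleBound ε G) {S : Type} [Group S] [Finite S] [IsSimpleGroup S]
    (hS : ¬ ∀ a b : S, a * b = b * a) (hSG : IsSubnormalFactor S G) (R : Subgroup (MulAut S))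
    (hR : (MulAut.conj : S →* MulAut S).range ≤ R) :
    (noetherNumber R : ℝ) ≤ (2 : ℝ) ^ (-ε) * (Nat.card R : ℝ) ^ (1 - ε) := by
  have hinj := MulAut.conj_injective_of_simple hS
  have hconj : ∀ (τ : MulAut S) (s : S), τ * MulAut.conj s * τ⁻¹ = MulAut.conj (τ s) :=
    fun τ s => by ext x; simp
  let I := (MulAut.conj : S →* MulAut S).range
  have hIn : I.Normal := ⟨by
    rintro _ ⟨s, rfl⟩ τ
    exact ⟨τ s, (hconj τ s).symm⟩⟩
  let e : S ≃* I.subgroupOf R :=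
    (MonoidHom.ofInjective hinj).trans (Subgroup.subgroupOfEquivOfLe hR).symm
  have : Nontrivial (I.subgroupOf R) := e.injective.nontrivial
  refine h R (I.subgroupOf R) inferInstance
    (IsSimpleGroup.isSimpleGroup_of_surjective e.toMonoidHom e.surjective)
        (fun hc => hS fun a b => ?_)
    ?_ ?_
  · have := hc (e a) (e b)
    rwa [← map_mul, ← map_mul, e.injective.eq_iff] at this
  · rw [eq_bot_iff]
    intro τ hτ
    rw [Subgroup.mem_bot]
    refine Subtype.ext (MulEquiv.ext fun s => hinj ?_)
    have h1 := Subgroup.mem_centralizer_iff.1 hτ ⟨MulAut.conj s, hR ⟨s, rfl⟩⟩ ⟨s, rfl⟩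
    have h2 : MulAut.conj s * (τ : MulAut S) = τ * MulAut.conj s := Subtype.ext_iff.1 h1
    rw [← hconj, ← h2, mul_inv_cancel_right]
    rfl
  · obtain ⟨L, hL, f, hf⟩ := hSG
    exact ⟨L, hL, e.toMonoidHom.comp f, e.surjective.comp hf⟩

theorem noetherNumber_mul_le_of_simple_family {ε : ℝ} {G₀ G Q : Type} [Group G₀] [Group G]
    [Finite G]
    [Group Q] [Finite Q] (h : AlmostSimpleBound ε G₀) (π : G →* Q) (𝒯 : Finset (Subgroup Q))
    (hsimple : ∀ S ∈ 𝒯, IsSimpleGroup S ∧ (¬ ∀ a b : S, a * b = b * a) ∧ IsSubnormalFactor S G₀)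
    (hcomm : ∀ S ∈ 𝒯, ∀ T ∈ 𝒯, S ≠ T → S ≤ Subgroup.centralizer (T : Set Q))
    (X : Subgroup G) (hX : ∀ S ∈ 𝒯, S ≤ X.map π ∧ X.map π ≤ Subgroup.normalizer (S : Set Q)) :
    (noetherNumber X : ℝ) *
        (Nat.card ↥(X ⊓ ⨅ S ∈ 𝒯, (Subgroup.centralizer (S : Set Q)).comap π) : ℝ) ^ (1 - ε) ≤
      ((2 : ℝ) ^ (-ε)) ^ 𝒯.card * (Nat.card X : ℝ) ^ (1 - ε) *
        noetherNumber ↥(X ⊓ ⨅ S ∈ 𝒯, (Subgroup.centralizer (S : Set Q)).comap π) := by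
  classical
  induction 𝒯 using Finset.induction_on generalizing X with
  | empty =>
    have : X ⊓ (⨅ S ∈ (∅ : Finset (Subgroup Q)),
        (Subgroup.centralizer (S : Set Q)).comap π) = X := by
      simp
    rw [this]
    simp [mul_comm]
  | insert S 𝒯 hS ih =>
    obtain ⟨h1, h2, h3⟩ := hsimple S (Finset.mem_insert_self _ _)
    obtain ⟨hSX, hXS⟩ := hX S (Finset.mem_insert_self _ _)
    let X₁ := X ⊓ (Subgroup.centralizer (S : Set Q)).comap π
    have hX₁ : X ⊓ ⨅ T ∈ insert S 𝒯, (Subgroup.centralizer (T : Set Q)).comap π =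
        X₁ ⊓ ⨅ T ∈ 𝒯, (Subgroup.centralizer (T : Set Q)).comap π := by
      rw [Finset.iInf_insert, inf_assoc]
    rw [hX₁]
    let a : X →* Subgroup.normalizer (S : Set Q) :=
        (π.comp X.subtype).codRestrict _ fun x => hXS ⟨x, x.2, rfl⟩
    let f : X →* MulAut S := S.normalizerMonoidHom.comp a
    have hker : Nat.card f.ker = Nat.card X₁ ∧ noetherNumber f.ker = noetherNumber X₁ := by
      have hk : ∀ x : X, x ∈ f.ker ↔ (x : G) ∈ X₁ := fun x => by
        change a x ∈ S.normalizerMonoidHom.ker ↔ _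
        rw [Subgroup.normalizerMonoidHom_ker]
        exact ⟨fun h => ⟨x.2, h⟩, fun h => h.2⟩
      have hm : f.ker.map X.subtype = X₁ := by
        ext x
        constructor
        · rintro ⟨y, hy, rfl⟩
          exact (hk y).1 hy
        · intro hx
          exact ⟨⟨x, hx.1⟩, (hk _).2 hx, rfl⟩
      let e := f.ker.equivMapOfInjective X.subtype X.subtype_injective
      rw [← hm]
      exact ⟨Nat.card_congr e.toEquiv, noetherNumber_congr e⟩
    have hR := h.noetherNumber_le h2 h3 f.range (by
      rintro _ ⟨s, rfl⟩
      obtain ⟨x, hx, hxs⟩ := hSX s.2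
      refine ⟨⟨x, hx⟩, ?_⟩
      refine MulEquiv.ext fun t => Subtype.ext ?_
      change π x * t * (π x)⁻¹ = s * t * (s : Q)⁻¹
      exact congrArg (fun u => u * (t : Q) * u⁻¹) hxs)
    have hmul := noetherNumber_le_mul f.rangeRestrict f.rangeRestrict_surjective
    rw [MonoidHom.ker_rangeRestrict, hker.2] at hmul
    have hcard := f.card_ker_mul_card_range
    rw [hker.1] at hcard
    have ih' := ih (fun T hT => hsimple T (Finset.mem_insert_of_mem hT))
      (fun T hT U hU => hcomm T (Finset.mem_insert_of_mem hT) U (Finset.mem_insert_of_mem hU)) X₁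
      (fun T hT => ⟨fun t ht => by
        obtain ⟨x, hx, rfl⟩ := (hX T (Finset.mem_insert_of_mem hT)).1 ht
        exact ⟨x, ⟨hx, hcomm T (Finset.mem_insert_of_mem hT) S (Finset.mem_insert_self _ _)
          (fun heq => hS (heq ▸ hT)) ht⟩, rfl⟩,
        (Subgroup.map_mono inf_le_left).trans (hX T (Finset.mem_insert_of_mem hT)).2⟩)
    rw [Finset.card_insert_of_notMem hS, pow_succ]
    have hmul' : (noetherNumber X : ℝ) ≤ noetherNumber X₁ * noetherNumber f.range := by
      exact_mod_cast hmul
    have hcard' : (Nat.card X : ℝ) = Nat.card X₁ * Nat.card f.range := by exact_mod_cast hcard.symm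
    rw [hcard', Real.mul_rpow (by positivity) (by positivity)]
    have hy : 0 ≤ (Nat.card ↥(X₁ ⊓ ⨅ T ∈ 𝒯, (Subgroup.centralizer (T : Set Q)).comap π) : ℝ)
      ^ (1 - ε) := by positivity
    generalize (Nat.card ↥(X₁ ⊓ ⨅ T ∈ 𝒯, (Subgroup.centralizer (T : Set Q)).comap π) : ℝ)
      ^ (1 - ε) = y at *
    calc (noetherNumber X : ℝ) * y ≤ noetherNumber X₁ * noetherNumber f.range * y := by gcongr
      _ = (noetherNumber X₁ * y) * noetherNumber f.range := by ring
      _ ≤ _ := mul_le_mul ih' hR (by positivity) (by positivity)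
      _ = _ := by ring

end NonabelianMinimal

section NonabelianCharacteristic

theorem Subgroup.mem_normalizer_of_mem_centralizer_of_le {Q : Type*} [Group Q] {N S : Subgroup Q}
    (hNS : N ≤ S) : Subgroup.centralizer (S : Set Q) ≤ Subgroup.normalizer (N : Set Q) :=
  (Subgroup.centralizer_le hNS).trans fun x hx => Subgroup.mem_normalizer_iff.2 fun n => by
    have h : ∀ m ∈ N, x * m * x⁻¹ = m := fun m hm => by
      rw [← Subgroup.mem_centralizer_iff.1 hx m hm, mul_inv_cancel_right]
    constructor
    · intro hn
      rw [h n hn]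
      exact hn
    · intro hn
      have h1 := h _ hn
      have : x * n * x⁻¹ = n := by
        have h2 := congrArg (fun u => x⁻¹ * u * x) h1
        simpa [mul_assoc] using h2
      rwa [this] at hn

/-- Let `Φ` be a group of automorphisms of `Q` containing the inner ones. A minimal `Φ`-invariant
subgroup which is not abelian is generated by a `Φ`-invariant family of pairwise commuting
nonabelian simple subgroups. -/
theorem exists_simple_family {Q : Type} [Group Q] [Finite Q] (Φ : Subgroup (MulAut Q))
    (hΦ : ∀ x : Q, MulAut.conj x ∈ Φ) (M : Subgroup Q)
    (hM : ∀ φ ∈ Φ, M.map φ.toMonoidHom ≤ M)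
    (hmin : ∀ L : Subgroup Q, (∀ φ ∈ Φ, L.map φ.toMonoidHom ≤ L) → L ≤ M → L ≠ ⊥ → L = M)
    (hna : ¬ ∀ a ∈ M, ∀ b ∈ M, a * b = b * a) :
    ∃ 𝒮 : Set (Subgroup Q), sSup 𝒮 = M ∧
      (∀ S ∈ 𝒮, IsSimpleGroup S ∧ (¬ ∀ a b : S, a * b = b * a) ∧ IsSubnormalFactor S Q) ∧
      (∀ S ∈ 𝒮, ∀ T ∈ 𝒮, S ≠ T → S ≤ Subgroup.centralizer (T : Set Q)) ∧
      (∀ S ∈ 𝒮, M ≤ Subgroup.normalizer (S : Set Q)) ∧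
      ∀ φ ∈ Φ, ∀ S ∈ 𝒮, S.map φ.toMonoidHom ∈ 𝒮 := by
  let P : Subgroup Q → Prop := fun S => S ≤ M ∧ S ≠ ⊥ ∧ M ≤ Subgroup.normalizer (S : Set Q)
  let 𝒮 : Set (Subgroup Q) := {S | Minimal P S}
  have hMne : M ≠ ⊥ := by
    rintro rfl
    exact hna fun a ha b hb => by rw [Subgroup.mem_bot.1 ha, Subgroup.mem_bot.1 hb]
  have hback : ∀ (φ : MulAut Q) (S : Subgroup Q),
      (S.map φ.toMonoidHom).map (φ⁻¹ : MulAut Q).toMonoidHom = S := fun φ S => by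
    rw [Subgroup.map_map]
    convert Subgroup.map_id S
    ext x
    exact φ.symm_apply_apply x
  have hMn : M.Normal := ⟨fun m hm x => hM _ (hΦ x) ⟨m, hm, rfl⟩⟩
  have hPmap : ∀ φ ∈ Φ, ∀ S : Subgroup Q, P S → P (S.map φ.toMonoidHom) := by
    rintro φ hφ S ⟨h1, h2, h3⟩
    have hMφ : M ≤ M.map φ.toMonoidHom := by
      have h4 := Subgroup.map_mono (f := φ.toMonoidHom) (hM φ⁻¹ (Φ.inv_mem hφ))
      have h5 := hback φ⁻¹ M
      rw [inv_inv] at h5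
      rwa [h5] at h4
    exact ⟨(Subgroup.map_mono h1).trans (hM φ hφ),
      fun h => h2 ((Subgroup.map_eq_bot_iff_of_injective _ φ.injective).1 h),
      hMφ.trans ((Subgroup.map_mono h3).trans (Subgroup.le_normalizer_map _))⟩
  have hmap : ∀ φ ∈ Φ, ∀ S ∈ 𝒮, S.map φ.toMonoidHom ∈ 𝒮 := by
    refine fun φ hφ S hS => ⟨hPmap φ hφ S hS.1, fun T hT hTS => ?_⟩
    have h1 : T.map (φ⁻¹ : MulAut Q).toMonoidHom ≤ S := by
      rw [← hback φ S]
      exact Subgroup.map_mono hTS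
    have h2 := Subgroup.map_mono (f := φ.toMonoidHom) (hS.2 (hPmap φ⁻¹ (Φ.inv_mem hφ) T hT) h1)
    have h3 := hback φ⁻¹ T
    rw [inv_inv] at h3
    rwa [h3] at h2
  have hcomm : ∀ S ∈ 𝒮, ∀ T ∈ 𝒮, S ≠ T → S ≤ Subgroup.centralizer (T : Set Q) := by
    intro S hS T hT hne
    have hinf : S ⊓ T = ⊥ := by
      by_contra hbot
      have hP : P (S ⊓ T) := ⟨inf_le_left.trans hS.1.1, hbot,
        fun x hx => Subgroup.mem_normalizer_iff.2 fun n =>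
          and_congr (Subgroup.mem_normalizer_iff.1 (hS.1.2.2 hx) n)
            (Subgroup.mem_normalizer_iff.1 (hT.1.2.2 hx) n)⟩
      exact hne (le_antisymm ((hS.2 hP inf_le_left).trans inf_le_right)
        ((hT.2 hP inf_le_right).trans inf_le_left))
    intro s hs
    refine Subgroup.mem_centralizer_iff.2 fun t ht => ?_
    have h1 : t * s * t⁻¹ * s⁻¹ ∈ S ⊓ T := by
      refine ⟨S.mul_mem ((Subgroup.mem_normalizer_iff.1 (hS.1.2.2 (hT.1.1 ht)) s).1 hs)
        (S.inv_mem hs), ?_⟩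
      rw [mul_assoc, mul_assoc]
      refine T.mul_mem ht ?_
      rw [← mul_assoc]
      exact (Subgroup.mem_normalizer_iff.1 (hT.1.2.2 (hS.1.1 hs)) _).1 (T.inv_mem ht)
    rw [hinf, Subgroup.mem_bot] at h1
    rwa [mul_inv_eq_one, mul_inv_eq_iff_eq_mul] at h1
  obtain ⟨S₀, hS₀⟩ := Set.Finite.exists_minimal (s := {S | P S}) (Set.toFinite _)
    ⟨M, le_rfl, hMne, Subgroup.le_normalizer⟩
  have hS₀ : S₀ ∈ 𝒮 := hS₀
  have hsup : sSup 𝒮 = M := by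
    refine hmin _ (fun φ hφ => ?_) (sSup_le fun S hS => hS.1.1) ?_
    · rw [sSup_eq_iSup, Subgroup.map_iSup]
      refine iSup_le fun S => ?_
      rw [Subgroup.map_iSup]
      exact iSup_le fun hS => le_iSup₂_of_le (S.map φ.toMonoidHom) (hmap φ hφ S hS) le_rfl
    · intro h
      exact hS₀.1.2.1 (le_bot_iff.1 (h ▸ le_sSup hS₀))
  refine ⟨𝒮, hsup, fun S hS => ⟨?_, ?_, ?_⟩, hcomm, fun S hS => hS.1.2.2, hmap⟩
  · have : Nontrivial S := (Subgroup.nontrivial_iff_ne_bot S).2 hS.1.2.1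
    refine ⟨fun N hN => ?_⟩
    rw [or_iff_not_imp_left]
    intro hNbot
    have hNS : N.map S.subtype ≤ S := Subgroup.map_subtype_le N
    have hP : P (N.map S.subtype) := by
      refine ⟨hNS.trans hS.1.1, fun h => hNbot
        ((Subgroup.map_eq_bot_iff_of_injective _ S.subtype_injective).1 h), ?_⟩
      rw [← hsup]
      refine sSup_le fun T hT => ?_
      rcases eq_or_ne T S with rfl | hne
      · rw [← Subgroup.normal_subgroupOf_iff_le_normalizer hNS]
        rwa [Subgroup.subgroupOf, Subgroup.comap_map_eq_self_of_injective T.subtype_injective]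
      · exact (hcomm T hT S hS hne).trans (Subgroup.mem_normalizer_of_mem_centralizer_of_le hNS)
    rw [eq_top_iff]
    intro x _
    obtain ⟨y, hy, hyx⟩ := hS.2 hP hNS x.2
    rwa [← Subtype.ext hyx]
  · intro hab
    have hle : M ≤ Subgroup.centralizer (S : Set Q) := by
      rw [← hsup]
      refine sSup_le fun T hT => ?_
      rcases eq_or_ne T S with rfl | hne
      · exact fun x hx => Subgroup.mem_centralizer_iff.2 fun y hy =>
          Subtype.ext_iff.1 (hab ⟨y, hy⟩ ⟨x, hx⟩)
      · exact hcomm T hT S hS hne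
    have h1 : M ⊓ Subgroup.centralizer (M : Set Q) = M := by
      refine hmin _ (fun φ hφ => ?_) inf_le_left fun h => hS.1.2.1 (le_bot_iff.1 (h ▸ le_inf hS.1.1
        (Subgroup.le_centralizer_iff.1 hle)))
      rintro _ ⟨x, hx, rfl⟩
      refine ⟨hM φ hφ ⟨x, hx.1, rfl⟩, Subgroup.mem_centralizer_iff.2 fun m hm => ?_⟩
      have h2 := Subgroup.mem_centralizer_iff.1 hx.2 _ (hM _ (Φ.inv_mem hφ) ⟨m, hm, rfl⟩)
      have h3 := congrArg φ h2
      have h4 : φ ((φ⁻¹ : MulAut Q) m) = m := φ.apply_symm_apply m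
      rw [map_mul, map_mul] at h3
      change φ ((φ⁻¹ : MulAut Q) m) * φ x = φ x * φ ((φ⁻¹ : MulAut Q) m) at h3
      rwa [h4] at h3
    exact hna fun a ha b hb =>
      (Subgroup.mem_centralizer_iff.1 ((h1.symm ▸ hb : b ∈ M ⊓ _)).2 a ha)
  · have hS' : (S.subgroupOf M).Normal :=
      (Subgroup.normal_subgroupOf_iff_le_normalizer hS.1.1).2 hS.1.2.2
    exact ⟨S, .step S M hS.1.1 hMn.isSubnormal hS', MonoidHom.id S, Function.surjective_id⟩

theorem Subgroup.Characteristic.map_subtype {G : Type*} [Group G] {N : Subgroup G}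
    (hN : N.Characteristic) {K : Subgroup N} (hK : K.Characteristic) :
    (K.map N.subtype).Characteristic :=
  Subgroup.characteristic_of_characteristic_of_characteristic

variable {G : Type} [Group G] {ε : ℝ}

theorem CyclicBound.exists_of_subgroup {N : Subgroup G} (hN : N.Characteristic)
    (h : CyclicBound ε N) : ∃ C : Subgroup G, C.Characteristic ∧ IsCyclic C ∧ C ≤ N ∧
      (noetherNumber N : ℝ) ≤ (Nat.card C : ℝ) ^ ε * (Nat.card N : ℝ) ^ (1 - ε) := by
  obtain ⟨C, hC, hcyc, hle⟩ := h
  refine ⟨C.map N.subtype, hN.map_subtype hC, ?_, Subgroup.map_subtype_le _, ?_⟩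
  · exact isCyclic_of_surjective (C.equivMapOfInjective _ N.subtype_injective)
      (C.equivMapOfInjective _ N.subtype_injective).surjective
  · rwa [Subgroup.card_map_of_injective N.subtype_injective]

theorem cyclicBound_of_nonabelian [Finite G] (hε0 : 0 < ε) (C : Subgroup G) (hC : C.Characteristic)
    (N : Subgroup G) (hN : N.Characteristic) (hCN : C ≤ N)
    (hmin : ∀ L : Subgroup G, L.Characteristic → C ≤ L → L ≤ N → L ≠ C → L = N)
    (hna : ¬ ∀ a ∈ N, ∀ b ∈ N, a * b * a⁻¹ * b⁻¹ ∈ C) (h : AlmostSimpleBound ε G)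
    (ih : ∀ (G' : Type) [Group G'] [Finite G'], Nat.card G' < Nat.card G →
      AlmostSimpleBound ε G' → CyclicBound ε G') : CyclicBound ε G := by
  let π := QuotientGroup.mk' C
  have hπ : ∀ x, π x = 1 ↔ x ∈ C := QuotientGroup.eq_one_iff
  let M := N.map π
  have hMN : M.comap π = N :=
    Subgroup.comap_map_eq_self ((QuotientGroup.ker_mk' C).trans_le hCN)
  replace hna : ¬ ∀ a ∈ M, ∀ b ∈ M, a * b = b * a := fun hab => hna fun a ha b hb => by
    rw [← hπ, map_mul, map_mul, map_mul, hab _ ⟨a, ha, rfl⟩ _ ⟨b, hb, rfl⟩, map_inv, map_inv,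
      mul_inv_cancel_right, mul_inv_cancel]
  let Φ : Subgroup (MulAut (G ⧸ C)) :=
    { carrier := {ψ | ∃ φ : MulAut G, ∀ x, ψ (π x) = π (φ x)}
      one_mem' := ⟨1, fun x => rfl⟩
      mul_mem' := by
        rintro ψ ψ' ⟨φ, h1⟩ ⟨φ', h2⟩
        exact ⟨φ * φ', fun x => by rw [MulAut.mul_apply, h2, h1, MulAut.mul_apply]⟩
      inv_mem' := by
        rintro ψ ⟨φ, h1⟩
        refine ⟨φ⁻¹, fun x => ψ.injective ?_⟩
        rw [h1]
        exact (ψ.apply_symm_apply _).trans (congrArg π (φ.apply_symm_apply x).symm) }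
  have hΦ : ∀ y, MulAut.conj y ∈ Φ := fun y => by
    obtain ⟨g, rfl⟩ := QuotientGroup.mk'_surjective C y
    exact ⟨MulAut.conj g, fun x => rfl⟩
  have hM : ∀ ψ ∈ Φ, M.map ψ.toMonoidHom ≤ M := by
    rintro ψ ⟨φ, hφ⟩ _ ⟨_, ⟨x, hx, rfl⟩, rfl⟩
    exact ⟨φ x, hN.apply_mem φ hx, (hφ x).symm⟩
  obtain ⟨𝒮, hsup, hsimple, hcomm, hnorm, hmap⟩ := exists_simple_family Φ hΦ M hM
    (fun L hL hLM hL0 => by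
      have h1 : L.comap π = N := hmin _ (Subgroup.characteristic_of_forall_mem fun φ x hx =>
          hL (QuotientGroup.congr C C φ (Subgroup.characteristic_iff_map_eq.1 hC φ))
            ⟨φ, fun x => rfl⟩ ⟨π x, hx, rfl⟩)
        (fun x hx => by
          rw [Subgroup.mem_comap, (hπ x).2 hx]
          exact L.one_mem)
        ((Subgroup.comap_mono hLM).trans hMN.le) fun h1 => hL0 (by
          rw [eq_bot_iff]
          intro y hy
          obtain ⟨x, rfl⟩ := QuotientGroup.mk'_surjective C y
          exact Subgroup.mem_bot.2 ((hπ x).2 (h1 ▸ hy : x ∈ C)))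
      rw [← Subgroup.map_comap_eq_self_of_surjective (QuotientGroup.mk'_surjective C) L]
      exact congrArg (Subgroup.map π) h1) hna
  let Y := (Subgroup.centralizer (M : Set (G ⧸ C))).comap π
  have hYchar : Y.Characteristic := Subgroup.characteristic_of_forall_mem fun φ x hx =>
    Subgroup.mem_centralizer_iff.2 fun m hm => by
      obtain ⟨n, hn, rfl⟩ := hm
      have h1 := Subgroup.mem_centralizer_iff.1 hx (π (φ.symm n))
        ⟨_, hN.apply_mem φ.symm hn, rfl⟩
      rw [← map_mul, ← map_mul, ← inv_mul_eq_one, ← map_inv, ← map_mul, hπ] at h1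
      have h2 := hC.apply_mem φ h1
      rw [← map_mul, ← map_mul, ← inv_mul_eq_one, ← map_inv, ← map_mul, hπ]
      simpa using h2
  let _ : MulAction G 𝒮 :=
    { smul := fun g S => ⟨S.1.map (MulAut.conj (π g)).toMonoidHom, hmap _ (hΦ _) S.1 S.2⟩
      one_smul := fun S => Subtype.ext (by
        change S.1.map (MulAut.conj (π 1)).toMonoidHom = S.1
        rw [map_one, map_one]
        exact Subgroup.map_id _)
      mul_smul := fun g g' S => Subtype.ext (by
        change S.1.map (MulAut.conj (π (g * g'))).toMonoidHom =
          (S.1.map (MulAut.conj (π g')).toMonoidHom).map (MulAut.conj (π g)).toMonoidHom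
        rw [Subgroup.map_map, map_mul, map_mul]
        rfl) }
  let f : G →* Equiv.Perm 𝒮 := MulAction.toPermHom G 𝒮
  have hK : ∀ x : G, x ∈ f.ker ↔ ∀ S ∈ 𝒮, π x ∈ Subgroup.normalizer (S : Set (G ⧸ C)) := by
    intro x
    rw [MonoidHom.mem_ker, Equiv.ext_iff]
    constructor
    · intro hx S hS
      have h1 : S.map (MulAut.conj (π x)).toMonoidHom = S := congrArg Subtype.val (hx ⟨S, hS⟩)
      exact Subgroup.mem_normalizer_iff_map_conj_eq.2 h1
    · intro hx S
      exact Subtype.ext (Subgroup.mem_normalizer_iff_map_conj_eq.1 (hx S S.2))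
  have hMK : M.comap π ≤ f.ker := fun x hx => (hK x).2 fun S hS => hnorm S hS hx
  have hYK : Y ≤ f.ker := fun x hx => (hK x).2 fun S hS =>
    Subgroup.mem_normalizer_of_mem_centralizer_of_le (hsup ▸ le_sSup hS : S ≤ M) hx
  classical
  have hfin : 𝒮.Finite := Set.toFinite _
  have hYinf : f.ker ⊓ ⨅ S ∈ hfin.toFinset,
      (Subgroup.centralizer (S : Set (G ⧸ C))).comap π = Y := by
    refine le_antisymm (fun x hx => ?_) (le_inf hYK (le_iInf₂ fun S hS =>
      Subgroup.comap_mono (Subgroup.centralizer_le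
          (hsup ▸ le_sSup (hfin.mem_toFinset.1 hS) : S ≤ M))))
    have h1 : M ≤ Subgroup.centralizer ({π x} : Set (G ⧸ C)) := by
      rw [← hsup]
      refine sSup_le fun S hS s hs => Subgroup.mem_centralizer_singleton_iff.2 ?_
      have h2 : π x ∈ Subgroup.centralizer (S : Set (G ⧸ C)) :=
        iInf₂_le (f := fun S (_ : S ∈ hfin.toFinset) =>
          (Subgroup.centralizer (S : Set (G ⧸ C))).comap π) S (hfin.mem_toFinset.2 hS) hx.2
      exact Subgroup.mem_centralizer_iff.1 h2 s hs
    exact Subgroup.mem_centralizer_iff.2 fun m hm =>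
      Subgroup.mem_centralizer_singleton_iff.1 (h1 hm)
  have hfam := noetherNumber_mul_le_of_simple_family (h.of_surjective π
    (QuotientGroup.mk'_surjective C)) π hfin.toFinset
    (fun S hS => hsimple S (hfin.mem_toFinset.1 hS))
    (fun S hS T hT => hcomm S (hfin.mem_toFinset.1 hS) T (hfin.mem_toFinset.1 hT)) f.ker
    (fun S hS => by
      rw [hfin.mem_toFinset] at hS
      constructor
      · intro s hs
        obtain ⟨x, rfl⟩ := QuotientGroup.mk'_surjective C s
        exact ⟨x, hMK ((hsup ▸ le_sSup hS : S ≤ M) hs), rfl⟩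
      · rintro _ ⟨x, hx, rfl⟩
        exact (hK x).1 hx S hS)
  rw [hYinf] at hfam
  have hcardf := f.card_ker_mul_card_range
  have hYlt : Nat.card Y < Nat.card G := by
    refine lt_of_le_of_ne (Subgroup.card_le_card_group Y) fun heq => hna fun a ha b _ => ?_
    obtain ⟨x, rfl⟩ := QuotientGroup.mk'_surjective C b
    have : x ∈ Y := (Subgroup.card_eq_iff_eq_top Y).1 heq ▸ Subgroup.mem_top x
    exact Subgroup.mem_centralizer_iff.1 this a ha
  have hRlt : Nat.card f.range < Nat.card G := by
    have hker : 1 < Nat.card f.ker := by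
      rw [Subgroup.one_lt_card_iff_ne_bot]
      intro hbot
      rw [hbot, le_bot_iff] at hMK
      refine hna fun a ha b hb => ?_
      obtain ⟨x, rfl⟩ := QuotientGroup.mk'_surjective C a
      have hx : x ∈ M.comap π := ha
      rw [hMK, Subgroup.mem_bot] at hx
      rw [hx, map_one, one_mul, mul_one]
    have : 0 < Nat.card f.range := Nat.card_pos
    nlinarith
  obtain ⟨J, -, hJ, hRle⟩ := ih f.range hRlt (h.of_surjective f.rangeRestrict
    f.rangeRestrict_surjective)
  obtain ⟨D, hD, hDcyc, -, hYle⟩ := (ih Y hYlt (h.of_normal Y)).exists_of_subgroup hYchar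
  refine ⟨D, hD, hDcyc, ?_⟩
  have hJle : Nat.card J ≤ 2 ^ hfin.toFinset.card := by
    obtain ⟨g, hg⟩ := IsCyclic.exists_ofOrder_eq_natCard (α := J)
    rw [← hg, ← Subgroup.orderOf_coe, ← Subgroup.orderOf_coe, ← Set.ncard_eq_toFinset_card 𝒮 hfin]
    exact Equiv.Perm.orderOf_le_two_pow _
  have hmul := noetherNumber_le_mul f.rangeRestrict f.rangeRestrict_surjective
  rw [MonoidHom.ker_rangeRestrict] at hmul
  have hmul' : (noetherNumber G : ℝ) ≤ noetherNumber f.ker * noetherNumber f.range := by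
    exact_mod_cast hmul
  have hcard' : (Nat.card G : ℝ) = Nat.card f.ker * Nat.card f.range := by
      exact_mod_cast hcardf.symm
  have hJle' : (Nat.card J : ℝ) ^ ε ≤ ((2 : ℝ) ^ ε) ^ hfin.toFinset.card := by
    rw [← Real.rpow_natCast, ← Real.rpow_mul (by norm_num), mul_comm, Real.rpow_mul (by norm_num),
      Real.rpow_natCast]
    exact Real.rpow_le_rpow (by positivity) (by exact_mod_cast hJle) hε0.le
  have hY0 : (0 : ℝ) < (Nat.card Y : ℝ) ^ (1 - ε) :=
    Real.rpow_pos_of_pos (by exact_mod_cast Nat.card_pos) _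
  have hker : (noetherNumber f.ker : ℝ) ≤ ((2 : ℝ) ^ (-ε)) ^ hfin.toFinset.card *
      (Nat.card f.ker : ℝ) ^ (1 - ε) * (Nat.card D : ℝ) ^ ε := by
    refine le_of_mul_le_mul_right (hfam.trans ?_) hY0
    rw [mul_assoc (((2 : ℝ) ^ (-ε)) ^ hfin.toFinset.card * (Nat.card f.ker : ℝ) ^ (1 - ε))]
    exact mul_le_mul_of_nonneg_left hYle (by positivity)
  have htwo : ((2 : ℝ) ^ (-ε)) ^ hfin.toFinset.card * ((2 : ℝ) ^ ε) ^ hfin.toFinset.card = 1 := by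
    rw [← mul_pow, ← Real.rpow_add (by norm_num), neg_add_cancel, Real.rpow_zero, one_pow]
  rw [hcard', Real.mul_rpow (by positivity) (by positivity)]
  calc (noetherNumber G : ℝ) ≤ noetherNumber f.ker * noetherNumber f.range := hmul'
    _ ≤ (((2 : ℝ) ^ (-ε)) ^ hfin.toFinset.card *
      (Nat.card f.ker : ℝ) ^ (1 - ε) * (Nat.card D : ℝ) ^ ε) *
      (((2 : ℝ) ^ ε) ^ hfin.toFinset.card * (Nat.card f.range : ℝ) ^ (1 - ε)) := by
        refine mul_le_mul hker (hRle.trans ?_) (by positivity) (by positivity)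
        gcongr
    _ = (((2 : ℝ) ^ (-ε)) ^ hfin.toFinset.card * ((2 : ℝ) ^ ε) ^ hfin.toFinset.card) *
      ((Nat.card D : ℝ) ^ ε *
        ((Nat.card f.ker : ℝ) ^ (1 - ε) * (Nat.card f.range : ℝ) ^ (1 - ε))) := by ring
    _ = _ := by rw [htwo, one_mul]

end NonabelianCharacteristic

section ClassTwo

open scoped commutatorElement

theorem IsCyclic.mem_zpowers_of_pow_eq_one {Z : Type*} [Group Z] [Finite Z] [IsCyclic Z] {c z : Z}
    (h : z ^ orderOf c = 1) : z ∈ Subgroup.zpowers c := by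
  classical
  cases nonempty_fintype Z
  have hle := IsCyclic.card_pow_eq_one_le (α := Z) (orderOf_pos c)
  have hsub : Finset.univ.filter (fun x => x ∈ Subgroup.zpowers c) ⊆
      Finset.univ.filter (fun x : Z => x ^ orderOf c = 1) := fun x hx => by
    rw [Finset.mem_filter] at hx ⊢
    exact ⟨hx.1, orderOf_dvd_iff_pow_eq_one.1 (orderOf_dvd_of_mem_zpowers hx.2)⟩
  have hcard : (Finset.univ.filter (fun x => x ∈ Subgroup.zpowers c)).card = orderOf c := by
    rw [← Nat.card_zpowers, ← Fintype.card_subtype, Nat.card_eq_fintype_card]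
  have heq := Finset.eq_of_subset_of_card_le hsub (hle.trans hcard.ge)
  have : z ∈ Finset.univ.filter (fun x : Z => x ^ orderOf c = 1) :=
    Finset.mem_filter.2 ⟨Finset.mem_univ _, h⟩
  rw [← heq, Finset.mem_filter] at this
  exact this.2

theorem Subgroup.mem_zpowers_of_isCyclic {G : Type*} [Group G] {Z : Subgroup G} [Finite Z]
    [IsCyclic Z] {c z : G} (hc : c ∈ Z) (hz : z ∈ Z) (h : z ^ orderOf c = 1) :
    z ∈ Subgroup.zpowers c := by
  have h1 : (⟨z, hz⟩ : Z) ∈ Subgroup.zpowers (⟨c, hc⟩ : Z) := by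
    refine IsCyclic.mem_zpowers_of_pow_eq_one (Subtype.ext ?_)
    rw [Subgroup.orderOf_mk]
    exact h
  obtain ⟨n, hn⟩ := Subgroup.mem_zpowers_iff.1 h1
  exact Subgroup.mem_zpowers_iff.2 ⟨n, by simpa using congrArg Subtype.val hn⟩

variable {G : Type} [Group G] [Finite G] {ε : ℝ}

theorem cyclicBound_of_classTwo (hε0 : 0 < ε) (hε1 : ε ≤ 0.1) {q : ℕ} (hq : q.Prime)
    (E : Subgroup G) (hE : E.Characteristic) (hna : ¬ ∀ a ∈ E, ∀ b ∈ E, a * b = b * a)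
    (hcen : ∀ a ∈ E, ∀ b ∈ E, a * b * a⁻¹ * b⁻¹ ∈ Subgroup.centralizer (E : Set G))
    (hpow : ∀ a ∈ E, a ^ q ∈ Subgroup.centralizer (E : Set G))
    (hpow2 : ∀ a ∈ E, (a ^ q) ^ q = 1)
    (hZ : IsCyclic ↥(E ⊓ Subgroup.centralizer (E : Set G)))
    (h : AlmostSimpleBound ε G)
    (ih : ∀ (G' : Type) [Group G'] [Finite G'], Nat.card G' < Nat.card G →
      AlmostSimpleBound ε G' → CyclicBound ε G') : CyclicBound ε G := by
  have := Fact.mk hq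
  let Y := Subgroup.centralizer (E : Set G)
  let Z := E ⊓ Y
  have hZE : Z ≤ E := inf_le_left
  have hYc : ∀ y ∈ Y, ∀ e ∈ E, y * e = e * y := fun y hy e he =>
    (Subgroup.mem_centralizer_iff.1 hy e he).symm
  let π := QuotientGroup.mk' Z
  have hπ : ∀ x, π x = 1 ↔ x ∈ Z := QuotientGroup.eq_one_iff
  let V := E.map π
  have hVE : V.comap π = E := Subgroup.comap_map_eq_self ((QuotientGroup.ker_mk' Z).trans_le hZE)
  have hVn : V.Normal := Subgroup.Normal.map inferInstance π (QuotientGroup.mk'_surjective Z)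
  have hVcard : Nat.card E = Nat.card Z * Nat.card V := by rw [← Subgroup.card_comap_mk, hVE]
  have hcomZ : ∀ a ∈ E, ∀ b ∈ E, a * b * a⁻¹ * b⁻¹ ∈ Z := fun a ha b hb =>
    ⟨E.mul_mem (E.mul_mem (E.mul_mem ha hb) (E.inv_mem ha)) (E.inv_mem hb), hcen a ha b hb⟩
  have hVcomm : ∀ a b : V, a * b = b * a := by
    rintro ⟨_, a, ha, rfl⟩ ⟨_, b, hb, rfl⟩
    refine Subtype.ext ?_
    have h1 := (hπ _).2 (hcomZ a ha b hb)
    rw [map_mul, map_mul, map_mul, map_inv, map_inv, mul_inv_eq_one, mul_inv_eq_iff_eq_mul] at h1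
    exact h1
  have hVexp : ∀ a : V, a ^ q = 1 := by
    rintro ⟨_, a, ha, rfl⟩
    refine Subtype.ext ?_
    change π a ^ q = 1
    rw [← map_pow]
    exact (hπ _).2 ⟨E.pow_mem ha q, hpow a ha⟩
  have hVcyc : ¬ IsCyclic V := fun hc => hna fun a ha b hb => by
    let f : E →* V := π.subgroupMap E
    refine Subtype.ext_iff.1 (f.comm_of_isCyclic_of_ker_le_center (fun x hx =>
      Subgroup.mem_center_iff.2 fun y => Subtype.ext ?_) ⟨a, ha⟩ ⟨b, hb⟩)
    have h1 : (x : G) ∈ Z := (hπ _).1 (Subtype.ext_iff.1 hx)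
    exact (hYc x h1.2 y y.2).symm
  have hVlt : q < Nat.card V := by
    obtain ⟨k, hk, -⟩ := exists_mulEquiv_pi_zmod hVcomm hVexp
    rw [hk]
    rcases k with _ | _ | k
    · rw [pow_zero] at hk
      have := Finite.card_le_one_iff_subsingleton.1 hk.le
      exact absurd (isCyclic_of_subsingleton (α := V)) hVcyc
    · rw [zero_add, pow_one] at hk
      exact absurd (isCyclic_of_prime_card hk) hVcyc
    · calc q = q ^ 1 := (pow_one q).symm
        _ < _ := Nat.pow_lt_pow_right hq.one_lt (by omega)
  let f₁ : G →* MulAut V := (MulAut.conjNormal : G ⧸ Z →* MulAut V).comp π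
  let W := f₁.ker
  have hW : ∀ g : G, g ∈ W ↔ ∀ e ∈ E, g * e * g⁻¹ * e⁻¹ ∈ Z := by
    intro g
    rw [MonoidHom.mem_ker, MulEquiv.ext_iff]
    constructor
    · intro hg e he
      have h1 : π g * π e * (π g)⁻¹ = π e := Subtype.ext_iff.1 (hg ⟨π e, e, he, rfl⟩)
      rw [← hπ, map_mul, map_mul, map_mul, map_inv, map_inv, h1, mul_inv_cancel]
    · rintro hg ⟨_, e, he, rfl⟩
      refine Subtype.ext ?_
      have h1 := (hπ _).2 (hg e he)
      rw [map_mul, map_mul, map_mul, map_inv, map_inv, mul_inv_eq_one] at h1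
      exact h1
  have hEW : E ≤ W := fun g hg => (hW g).2 (hcomZ g hg)
  have hYW : Y ≤ W := fun g hg => (hW g).2 fun e he => by
    rw [hYc g hg e he, mul_inv_cancel_right, mul_inv_cancel]
    exact Z.one_mem
  have hfixq : ∀ g ∈ W, ∀ z ∈ Z, z ^ q = 1 → g * z * g⁻¹ = z := by
    intro g hg
    push Not at hna
    obtain ⟨a, ha, b, hb, hab⟩ := hna
    have hc1 : a * b * a⁻¹ * b⁻¹ ≠ 1 := by
      rwa [Ne, mul_inv_eq_one, mul_inv_eq_iff_eq_mul]
    have hcq : (a * b * a⁻¹ * b⁻¹) ^ q = 1 := by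
      have h1 : Commute (a * b * a⁻¹ * b⁻¹) b := hYc _ (hcen a ha b hb) b hb
      have h2 : a * b * a⁻¹ = (a * b * a⁻¹ * b⁻¹) * b := by group
      have h3 := h1.mul_pow q
      rw [← h2, conj_pow, ← hYc (b ^ q) (hpow b hb) a ha, mul_inv_cancel_right] at h3
      exact right_eq_mul.1 h3
    have hcg : g * (a * b * a⁻¹ * b⁻¹) * g⁻¹ = a * b * a⁻¹ * b⁻¹ := by
      have key : ∀ z ∈ Z, ∀ z' ∈ Z, z * a * (z' * b) * (z * a)⁻¹ * (z' * b)⁻¹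
          = a * b * a⁻¹ * b⁻¹ := fun z hz z' hz' => by
        have e1 : z * a * (z' * b) = z' * (z * (a * b)) := by
          rw [mul_assoc, ← mul_assoc a z' b, ← hYc z' hz'.2 a ha, mul_assoc z' a b,
            ← mul_assoc z, ← hYc z' hz'.2 z hz.1, mul_assoc]
        have e2 : z' * b * (z * a) = z' * (z * (b * a)) := by
          rw [mul_assoc, ← mul_assoc b z a, ← hYc z hz.2 b hb, mul_assoc z b a]
        calc _ = (z * a * (z' * b)) * (z' * b * (z * a))⁻¹ := by group
          _ = (z' * z) * (a * b * a⁻¹ * b⁻¹) * (z' * z)⁻¹ := by rw [e1, e2]; group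
          _ = _ := by
            rw [hYc (z' * z) (Y.mul_mem hz'.2 hz.2) _ (hcomZ a ha b hb).1, mul_inv_cancel_right]
      have h1 := key _ ((hW g).1 hg a ha) _ ((hW g).1 hg b hb)
      rw [inv_mul_cancel_right, inv_mul_cancel_right] at h1
      refine Eq.trans ?_ h1
      group
    have hord : orderOf (a * b * a⁻¹ * b⁻¹) = q := orderOf_eq_prime hcq hc1
    have hcZ := hcomZ a ha b hb
    generalize a * b * a⁻¹ * b⁻¹ = c at *
    intro z hz hzq
    obtain ⟨n, rfl⟩ := Subgroup.mem_zpowers_iff.1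
      (Subgroup.mem_zpowers_of_isCyclic hcZ hz (by rwa [hord]))
    rw [← conj_zpow, hcg]
  have hlam : ∀ g ∈ W, ∀ e ∈ E, (g * e * g⁻¹ * e⁻¹) ^ q = 1 := by
    intro g hg e he
    have h1 : Commute (g * e * g⁻¹ * e⁻¹) e := hYc _ ((hW g).1 hg e he).2 e he
    have h3 := h1.mul_pow q
    rw [inv_mul_cancel_right, conj_pow,
      hfixq g hg (e ^ q) ⟨E.pow_mem he q, hpow e he⟩ (hpow2 e he)] at h3
    exact right_eq_mul.1 h3
  let f₂ : W →* MulAut E := (MulAut.conjNormal : G →* MulAut E).comp W.subtype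
  have hf₂ : ∀ (g : W) (e : E), (f₂ g e : G) = ⁅(g : G), (e : G)⁆ * e := fun g e => by
    rw [commutatorElement_def, inv_mul_cancel_right]
    rfl
  have hf₂2 : ∀ (g k : W) (e : E), ((f₂ k * f₂ g) e : G) =
      ⁅(g : G), (e : G)⁆ * ⁅(k : G), (e : G)⁆ * e := fun g k e => by
    have h1 : ((f₂ k * f₂ g) e : G) = k * (f₂ g e : G) * (k : G)⁻¹ := rfl
    have h2 : _ * ⁅(g : G), (e : G)⁆ * _ = ⁅(g : G), (e : G)⁆ :=
        hfixq k k.2 _ ((hW g).1 g.2 e e.2) (hlam g g.2 e e.2)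
    rw [h1, hf₂]
    calc (k * (⁅(g : G), (e : G)⁆ * e) * (k : G)⁻¹ : G)
        = (k * ⁅(g : G), (e : G)⁆ * (k : G)⁻¹) * (k * e * (k : G)⁻¹) := by group
      _ = _ := by rw [h2, commutatorElement_def (k : G)]; group
  have hR₂comm : ∀ a b : f₂.range, a * b = b * a := by
    rintro ⟨_, g, rfl⟩ ⟨_, k, rfl⟩
    refine Subtype.ext (MulEquiv.ext fun e => Subtype.ext ?_)
    change ((f₂ g * f₂ k) e : G) = ((f₂ k * f₂ g) e : G)
    rw [hf₂2, hf₂2, show ⁅(k : G), (e : G)⁆ * ⁅(g : G), (e : G)⁆ =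
        ⁅(g : G), (e : G)⁆ * ⁅(k : G), (e : G)⁆ from
      hYc _ ((hW k).1 k.2 e e.2).2 _ ((hW g).1 g.2 e e.2).1]
  have hf₂pow : ∀ (g : W) (e : E) (n : ℕ),
      ((f₂ g ^ n) e : G) = ⁅(g : G), (e : G)⁆ ^ n * e := fun g e n => by
    induction n with
    | zero => simp
    | succ n hn =>
      rw [pow_succ']
      have h1 : ((f₂ g * f₂ g ^ n) e : G) = g * ((f₂ g ^ n) e : G) * (g : G)⁻¹ := rfl
      have h2 : _ * ⁅(g : G), (e : G)⁆ * _ = ⁅(g : G), (e : G)⁆ :=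
          hfixq g g.2 _ ((hW g).1 g.2 e e.2) (hlam g g.2 e e.2)
      have h3 : (g * ⁅(g : G), (e : G)⁆ ^ n * (g : G)⁻¹ : G) = ⁅(g : G), (e : G)⁆ ^ n := by
        rw [← conj_pow, h2]
      rw [h1, hn]
      calc (g * (⁅(g : G), (e : G)⁆ ^ n * e) * (g : G)⁻¹ : G)
          = (g * ⁅(g : G), (e : G)⁆ ^ n * (g : G)⁻¹) * ((g : G) * (e : G) * (g : G)⁻¹) := by group
        _ = _ := by rw [h3, pow_succ, mul_assoc _ ⁅(g : G), (e : G)⁆ (e : G),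
            commutatorElement_def, inv_mul_cancel_right]
  have hR₂exp : ∀ a : f₂.range, a ^ q = 1 := by
    rintro ⟨_, g, rfl⟩
    refine Subtype.ext (MulEquiv.ext fun e => Subtype.ext ?_)
    change ((f₂ g ^ q) e : G) = e
    rw [hf₂pow, show ⁅(g : G), (e : G)⁆ ^ q = 1 from hlam g g.2 e e.2, one_mul]
  have hker₂ : f₂.ker.map W.subtype = Y := by
    ext x
    change _ ↔ x ∈ Subgroup.centralizer (E : Set G)
    rw [← Subgroup.ker_conjNormal E]
    exact ⟨by rintro ⟨y, hy, rfl⟩; exact hy, fun hx =>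
      ⟨⟨x, hYW ((Subgroup.ker_conjNormal E).le hx)⟩, hx, rfl⟩⟩
  let eY : f₂.ker ≃* Y := (f₂.ker.equivMapOfInjective W.subtype W.subtype_injective).trans
    (MulEquiv.subgroupCongr hker₂)
  have hR₂V : Nat.card V ≤ Nat.card f₂.range := by
    let f₃ : E →* MulAut E := f₂.comp (Subgroup.inclusion hEW)
    have hk : f₃.ker.map E.subtype = Z := by
      ext x
      constructor
      · rintro ⟨y, hy, rfl⟩
        refine ⟨y.2, ?_⟩
        change (y : G) ∈ Subgroup.centralizer (E : Set G)
        rw [← Subgroup.ker_conjNormal E]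
        exact hy
      · rintro ⟨hx, hxY⟩
        refine ⟨⟨x, hx⟩, ?_, rfl⟩
        change x ∈ Subgroup.centralizer (E : Set G) at hxY
        rw [← Subgroup.ker_conjNormal E] at hxY
        exact hxY
    have h1 := f₃.card_ker_mul_card_range
    rw [← Subgroup.card_map_of_injective E.subtype_injective, hk, hVcard] at h1
    rw [← Nat.eq_of_mul_eq_mul_left Nat.card_pos h1]
    refine Subgroup.card_le_of_le ?_
    rintro _ ⟨x, rfl⟩
    exact ⟨_, rfl⟩
  obtain ⟨k, hk, -⟩ := exists_mulEquiv_pi_zmod hR₂comm hR₂exp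
  have hk2 : 2 ≤ k := by
    by_contra! hk2
    have h1 := Nat.pow_le_pow_right hq.pos (show k ≤ 1 by omega)
    rw [pow_one, ← hk] at h1
    omega
  have hγ₂ := noetherNumber_le_rpow_of_elementary hq hR₂comm hR₂exp hk hk2 hε1
  have hcard₁ := f₁.card_ker_mul_card_range
  have hcard₂ := f₂.card_ker_mul_card_range
  rw [Nat.card_congr eY.toEquiv] at hcard₂
  have hEone : 1 < Nat.card E := by
    have : 0 < Nat.card Z := Nat.card_pos
    have := hq.one_lt
    rw [hVcard]
    nlinarith
  obtain ⟨J, -, hJ, hγ₁⟩ := ih f₁.range (by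
    rw [← hcard₁]
    have h1 : 1 < Nat.card f₁.ker := hEone.trans_le (Subgroup.card_le_of_le hEW)
    have h2 : 0 < Nat.card f₁.range := Nat.card_pos
    nlinarith) (h.of_surjective f₁.rangeRestrict f₁.rangeRestrict_surjective)
  have hJV : Nat.card J ≤ Nat.card V := by
    have hJ' : IsCyclic (J.map f₁.range.subtype) :=
      isCyclic_of_surjective _ (f₁.range.subtype.subgroupMap_surjective J)
    have := card_le_of_isCyclic_mulAut_of_elementary hVcomm hVexp (J.map f₁.range.subtype)
    rwa [Subgroup.card_map_of_injective f₁.range.subtype_injective] at this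
  have hYchar : Y.Characteristic := inferInstance
  obtain ⟨D, hDc, hD, -, hγD⟩ := CyclicBound.exists_of_subgroup hYchar (ih Y (by
    refine lt_of_le_of_ne (Subgroup.card_le_card_group Y) fun hc => hna fun a ha b hb => ?_
    have hY := (Subgroup.card_eq_iff_eq_top Y).1 hc
    exact hYc a (hY ▸ Subgroup.mem_top a) b hb) (h.of_normal Y))
  refine ⟨D, hDc, hD, ?_⟩
  have h1 : (noetherNumber G : ℝ) ≤ noetherNumber f₁.ker * noetherNumber f₁.range := by
    have := noetherNumber_le_mul f₁.rangeRestrict f₁.rangeRestrict_surjective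
    rw [MonoidHom.ker_rangeRestrict] at this
    exact_mod_cast this
  have h2 : (noetherNumber f₁.ker : ℝ) ≤ noetherNumber Y * noetherNumber f₂.range := by
    have := noetherNumber_le_mul f₂.rangeRestrict f₂.rangeRestrict_surjective
    rw [MonoidHom.ker_rangeRestrict, noetherNumber_congr eY] at this
    exact_mod_cast this
  have hG : (Nat.card G : ℝ) = Nat.card f₁.range * Nat.card f₂.range * Nat.card Y := by
    rw [← hcard₁, show Nat.card f₁.ker = Nat.card W from rfl, ← hcard₂]
    push_cast
    ring
  have hV0 : (0 : ℝ) < Nat.card V := by exact_mod_cast Nat.card_pos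
  have hR0 : (0 : ℝ) < Nat.card f₂.range := by exact_mod_cast Nat.card_pos
  calc (noetherNumber G : ℝ)
      ≤ noetherNumber Y * noetherNumber f₂.range * noetherNumber f₁.range :=
        h1.trans (mul_le_mul_of_nonneg_right h2 (by positivity))
    _ ≤ ((Nat.card D : ℝ) ^ ε * (Nat.card Y : ℝ) ^ (1 - ε)) *
        (Nat.card f₂.range : ℝ) ^ (1 - 2 * ε) *
        ((Nat.card f₂.range : ℝ) ^ ε * (Nat.card f₁.range : ℝ) ^ (1 - ε)) := by
      have h3 : (Nat.card J : ℝ) ≤ Nat.card f₂.range := by exact_mod_cast hJV.trans hR₂V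
      refine mul_le_mul (mul_le_mul hγD hγ₂ (by positivity) (by positivity))
        (hγ₁.trans ?_) (by positivity) (by positivity)
      gcongr
    _ = (Nat.card D : ℝ) ^ ε * ((Nat.card f₁.range : ℝ) ^ (1 - ε) *
        ((Nat.card f₂.range : ℝ) ^ (1 - 2 * ε) * (Nat.card f₂.range : ℝ) ^ ε) *
        (Nat.card Y : ℝ) ^ (1 - ε)) := by ring
    _ = _ := by
      rw [← Real.rpow_add hR0, hG, Real.mul_rpow (by positivity) (by positivity),
        Real.mul_rpow (by positivity) (by positivity), show 1 - 2 * ε + ε = 1 - ε by ring]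

end ClassTwo

section AbelianQuotient

theorem mul_pow_of_mul_eq_mul {G : Type*} [Group G] {x y c : G} (hx : Commute c x)
    (hy : Commute c y) (h : y * x = c * (x * y)) (n : ℕ) :
    (x * y) ^ n = c ^ n.choose 2 * (x ^ n * y ^ n) := by
  have key : ∀ n : ℕ, y ^ n * x = c ^ n * (x * y ^ n) := fun n => by
    induction n with
    | zero => simp
    | succ n ih =>
      rw [pow_succ', mul_assoc, ih, ← mul_assoc, ← (hy.pow_left n).eq, mul_assoc, ← mul_assoc y,
        h, pow_succ, mul_assoc, mul_assoc, mul_assoc]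
  induction n with
  | zero => simp
  | succ n ih =>
    rw [pow_succ, ih, Nat.choose_succ_succ, Nat.choose_one_right, add_comm, pow_add]
    calc c ^ n.choose 2 * (x ^ n * y ^ n) * (x * y)
        = c ^ n.choose 2 * (x ^ n * (y ^ n * x) * y) := by group
      _ = c ^ n.choose 2 * ((x ^ n * c ^ n) * (x * y ^ n * y)) := by rw [key]; group
      _ = _ := by
        rw [((hx.pow_pow n n).symm).eq, pow_succ x, pow_succ y]
        simp only [mul_assoc]

variable {G : Type} [Group G] [Finite G] {ε : ℝ}

theorem exists_prime_forall_pow_mem {C M : Subgroup G} [C.Normal] (hC : C.Characteristic)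
    (hM : M.Characteristic) (hlt : C < M)
    (hmin : ∀ L : Subgroup G, L.Characteristic → C ≤ L → L ≤ M → L ≠ C → L = M)
    (hab : ∀ a ∈ M, ∀ b ∈ M, a * b * a⁻¹ * b⁻¹ ∈ C) :
    ∃ q : ℕ, q.Prime ∧ ∀ x ∈ M, x ^ q ∈ C := by
  obtain ⟨m, hmM, hmC⟩ := SetLike.exists_of_lt hlt
  let π := QuotientGroup.mk' C
  have hπ : ∀ x, π x = 1 ↔ x ∈ C := QuotientGroup.eq_one_iff
  have ho : orderOf (π m) ≠ 1 := fun h => hmC ((hπ m).1 (orderOf_eq_one_iff.1 h))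
  have hq := Nat.minFac_prime ho
  obtain ⟨r, hr⟩ := Nat.minFac_dvd (orderOf (π m))
  refine ⟨_, hq, ?_⟩
  generalize (orderOf (π m)).minFac = q at *
  have hcomm : ∀ a ∈ M, ∀ b ∈ M, Commute (π a) (π b) := fun a ha b hb => by
    have h1 := (hπ _).2 (hab a ha b hb)
    rw [map_mul, map_mul, map_mul, map_inv, map_inv, mul_inv_eq_one, mul_inv_eq_iff_eq_mul] at h1
    exact h1
  let L : Subgroup G :=
    { carrier := {x | x ∈ M ∧ x ^ q ∈ C}
      one_mem' := ⟨M.one_mem, by rw [one_pow]; exact C.one_mem⟩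
      mul_mem' := fun {a b} ha hb => ⟨M.mul_mem ha.1 hb.1, by
        rw [← hπ, map_pow, map_mul, (hcomm a ha.1 b hb.1).mul_pow, ← map_pow, ← map_pow,
          (hπ _).2 ha.2, (hπ _).2 hb.2, one_mul]⟩
      inv_mem' := fun {a} ha => ⟨M.inv_mem ha.1, by rw [inv_pow]; exact C.inv_mem ha.2⟩ }
  have hL : L.Characteristic := Subgroup.characteristic_of_forall_mem fun φ x hx =>
    ⟨hM.apply_mem φ hx.1, by rw [← map_pow]; exact hC.apply_mem φ hx.2⟩
  have hLM : L = M := hmin L hL (fun x hx => ⟨hlt.le hx, C.pow_mem hx q⟩)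
      (fun x hx => hx.1) fun h => by
    have h1 : m ^ r ∈ L := ⟨M.pow_mem hmM r, by
      rw [← hπ, map_pow, map_pow, ← pow_mul, mul_comm, ← hr, pow_orderOf_eq_one]⟩
    rw [h, ← hπ, map_pow] at h1
    have h2 := Nat.le_of_dvd (Nat.pos_of_ne_zero ?_) (orderOf_dvd_of_pow_eq_one h1)
    · have h3 := hq.two_le
      have h4 : 0 < orderOf (π m) := orderOf_pos _
      rw [hr] at h2 h4
      nlinarith [Nat.pos_of_mul_pos_left h4]
    · rintro rfl
      exact (orderOf_pos (π m)).ne' hr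
  exact fun x hx => (hLM.ge hx).2

theorem cyclicBound_of_abelian (hε0 : 0 < ε) (hε1 : ε ≤ 0.1)
    (hEC : CharacteristicElementaryCyclic G) (C : Subgroup G) (hC : C.Characteristic)
    (hmax : ∀ D : Subgroup G, D.Characteristic → IsCyclic D → Nat.card D ≤ Nat.card C)
    (M : Subgroup G) (hM : M.Characteristic) (hlt : C < M)
    (hMC : M ≤ Subgroup.centralizer (C : Set G))
    (hmin : ∀ L : Subgroup G, L.Characteristic → C ≤ L → L ≤ M → L ≠ C → L = M)
    (hab : ∀ a ∈ M, ∀ b ∈ M, a * b * a⁻¹ * b⁻¹ ∈ C)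
    (h : AlmostSimpleBound ε G)
    (ih : ∀ (G' : Type) [Group G'] [Finite G'], Nat.card G' < Nat.card G →
      AlmostSimpleBound ε G' → CyclicBound ε G') : CyclicBound ε G := by
  obtain ⟨q, hq, hpow⟩ := exists_prime_forall_pow_mem hC hM hlt hmin hab
  have := Fact.mk hq
  have hcz : ∀ c ∈ C, ∀ x ∈ M, Commute c x := fun c hc x hx =>
    Subgroup.mem_centralizer_iff.1 (hMC hx) c hc
  have hCc : ∀ a ∈ C, ∀ b ∈ C, a * b = b * a := fun a ha b hb => hcz a ha b (hlt.le hb)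
  have hMna : ¬ ∀ a ∈ M, ∀ b ∈ M, a * b = b * a := fun hc => hlt.ne
    (Subgroup.eq_of_le_of_card_ge hlt.le (hmax M hM (hEC.isCyclic hM hc)))
  have hcq : ∀ a ∈ M, ∀ b ∈ M, (a * b * a⁻¹ * b⁻¹) ^ q = 1 := fun a ha b hb => by
    have h1 := (hcz _ (hab a ha b hb) b hb).mul_pow q
    rw [inv_mul_cancel_right, conj_pow, ← (hcz _ (hpow b hb) a ha).eq, mul_inv_cancel_right] at h1
    exact right_eq_mul.1 h1
  let φ : M →* G := MonoidHom.mk' (fun x => (x : G) ^ q ^ 2) fun x y => by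
    have h1 := mul_pow_of_mul_eq_mul (hcz _ (hab y y.2 x x.2) x x.2)
      (hcz _ (hab y y.2 x x.2) y y.2) (by group) (q ^ 2)
    have hd : q ∣ (q ^ 2).choose 2 := hq.dvd_choose_pow two_ne_zero
      (by have := hq.two_le; nlinarith)
    rw [orderOf_dvd_iff_pow_eq_one.1 ((orderOf_dvd_of_pow_eq_one (hcq y y.2 x x.2)).trans hd),
      one_mul] at h1
    exact h1
  have hφ : ∀ x : M, φ x = (x : G) ^ q ^ 2 := fun _ => rfl
  let E := φ.ker.map M.subtype
  have hE : ∀ x, x ∈ E ↔ x ∈ M ∧ x ^ q ^ 2 = 1 := fun x =>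
    ⟨by rintro ⟨y, hy, rfl⟩; exact ⟨y.2, hy⟩, fun hx => ⟨⟨x, hx.1⟩, hx.2, rfl⟩⟩
  have hEchar : E.Characteristic := Subgroup.characteristic_of_forall_mem fun ψ x hx => by
    rw [hE] at hx ⊢
    exact ⟨hM.apply_mem ψ hx.1, by rw [← map_pow, hx.2, map_one]⟩
  have hEM : E ≤ M := fun x hx => ((hE x).1 hx).1
  have hcent : ∀ c ∈ C, c ∈ Subgroup.centralizer (E : Set G) := fun c hc =>
    Subgroup.mem_centralizer_iff.2 fun e he => (hcz c hc e (hEM he)).symm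
  have hcard : Nat.card M * q ≤ Nat.card E * Nat.card C := by
    have h1 := φ.card_ker_mul_card_range
    rw [← Subgroup.card_map_of_injective M.subtype_injective] at h1
    have h2 : φ.range ≤ (C.powHom hCc q).range := by
      rintro _ ⟨x, rfl⟩
      exact Subgroup.mem_range_powHom.2 ⟨_, hpow x x.2, by rw [hφ, sq, pow_mul]⟩
    have h3 : q ≤ Nat.card (C.torsion hCc q) := by
      push Not at hMna
      obtain ⟨a, ha, b, hb, hne⟩ := hMna
      have h4 : orderOf (a * b * a⁻¹ * b⁻¹) = q := orderOf_eq_prime (hcq a ha b hb)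
        (by rwa [Ne, mul_inv_eq_one, mul_inv_eq_iff_eq_mul])
      have h5 : a * b * a⁻¹ * b⁻¹ ∈ C.torsion hCc q :=
        Subgroup.mem_torsion.2 ⟨hab a ha b hb, hcq a ha b hb⟩
      have h6 := orderOf_dvd_natCard (⟨_, h5⟩ : C.torsion hCc q)
      rw [Subgroup.orderOf_mk, h4] at h6
      exact Nat.le_of_dvd Nat.card_pos h6
    calc Nat.card M * q = Nat.card E * (Nat.card φ.range * q) := by rw [← h1, mul_assoc]
      _ ≤ Nat.card E * (Nat.card (C.powHom hCc q).range * Nat.card (C.torsion hCc q)) := by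
        have := Subgroup.card_le_of_le h2
        gcongr
      _ = _ := by rw [mul_comm (Nat.card (C.powHom hCc q).range), C.card_torsion_mul]
  have hEna : ¬ ∀ a ∈ E, ∀ b ∈ E, a * b = b * a := fun hEc => hMna fun a ha b hb => by
    have hEcyc := hEC.isCyclic hEchar hEc
    have hEcard : Nat.card E ≤ q ^ 2 := by
      obtain ⟨e, he⟩ := IsCyclic.exists_ofOrder_eq_natCard (α := E)
      rw [← he]
      refine Nat.le_of_dvd (pow_pos hq.pos 2) (orderOf_dvd_of_pow_eq_one (Subtype.ext ?_))
      exact ((hE e).1 e.2).2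
    let π := QuotientGroup.mk' C
    have hπ : ∀ x, π x = 1 ↔ x ∈ C := QuotientGroup.eq_one_iff
    have hMcomap : (M.map π).comap π = M :=
      Subgroup.comap_map_eq_self ((QuotientGroup.ker_mk' C).trans_le hlt.le)
    have h1 : Nat.card C * Nat.card (M.map π) = Nat.card M := by
      rw [← Subgroup.card_comap_mk, hMcomap]
    have h2 : Nat.card (M.map π) ≤ q := by
      have h3 : 0 < Nat.card C := Nat.card_pos
      have h4 := Nat.mul_le_mul_right (Nat.card C) hEcard
      have h5 : Nat.card C * q * Nat.card (M.map π) ≤ Nat.card C * q * q := by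
        calc _ = Nat.card M * q := by rw [← h1]; ring
          _ ≤ q ^ 2 * Nat.card C := hcard.trans h4
          _ = _ := by ring
      exact Nat.le_of_mul_le_mul_left h5 (Nat.mul_pos h3 hq.pos)
    let f : M →* M.map π := π.subgroupMap M
    obtain ⟨m, hmM, hmC⟩ := SetLike.exists_of_lt hlt
    have hfq : (f ⟨m, hmM⟩) ^ q = 1 := Subtype.ext (by
      change π m ^ q = 1
      rw [← map_pow]
      exact (hπ _).2 (hpow m hmM))
    have hord : orderOf (f ⟨m, hmM⟩) = q := orderOf_eq_prime hfq fun h3 =>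
      hmC ((hπ m).1 (Subtype.ext_iff.1 h3))
    have hcyc : IsCyclic (M.map π) := isCyclic_of_prime_card (h2.antisymm
      (hord ▸ Nat.le_of_dvd Nat.card_pos (orderOf_dvd_natCard _)))
    refine Subtype.ext_iff.1 (f.comm_of_isCyclic_of_ker_le_center (fun x hx =>
      Subgroup.mem_center_iff.2 fun y => Subtype.ext ?_) ⟨a, ha⟩ ⟨b, hb⟩)
    exact (hcz x ((hπ x).1 (Subtype.ext_iff.1 hx)) y y.2).eq.symm
  refine cyclicBound_of_classTwo hε0 hε1 hq E hEchar hEna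
    (fun a ha b hb => hcent _ (hab a (hEM ha) b (hEM hb)))
    (fun a ha => hcent _ (hpow a (hEM ha)))
    (fun a ha => by rw [← pow_mul, ← sq]; exact ((hE a).1 ha).2)
    (hEC.isCyclic inferInstance fun a ha b hb => ?_) h ih
  exact (Subgroup.mem_centralizer_iff.1 ha.2 b hb.1).symm

end AbelianQuotient

section SquareDivisor

variable {G : Type} [Group G] [Finite G] {ε : ℝ}

theorem Subgroup.le_card_torsion (A : Subgroup G) [IsCyclic A]
    (hA : ∀ a ∈ A, ∀ b ∈ A, a * b = b * a) {n : ℕ} (hn : n ∣ Nat.card A) :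
    n ≤ Nat.card (A.torsion hA n) := by
  obtain ⟨g, hg⟩ := IsCyclic.exists_ofOrder_eq_natCard (α := A)
  obtain ⟨k, hk⟩ := hn
  have hpos : 0 < Nat.card A := Nat.card_pos
  have hk0 : k ≠ 0 := by rintro rfl; omega
  have h1 : orderOf (g ^ k) = n := by
    rw [orderOf_pow_of_dvd hk0 (by rw [hg, hk]; exact dvd_mul_left _ _), hg, hk,
      Nat.mul_div_cancel _ (Nat.pos_of_ne_zero hk0)]
  have h2 : ((g ^ k : A) : G) ∈ A.torsion hA n := Subgroup.mem_torsion.2 ⟨(g ^ k).2, by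
    rw [← Subgroup.coe_pow, ← h1, pow_orderOf_eq_one, Subgroup.coe_one]⟩
  have h3 := _root_.orderOf_dvd_natCard (⟨_, h2⟩ : A.torsion hA n)
  rw [Subgroup.orderOf_mk, Subgroup.orderOf_coe, h1] at h3
  exact Nat.le_of_dvd Nat.card_pos h3

theorem cyclicBound_of_sq_dvd (hε0 : 0 < ε)
    (hEC : CharacteristicElementaryCyclic G) (C : Subgroup G) (hC : C.Characteristic)
    (hCcyc : IsCyclic C)
    (hmax : ∀ D : Subgroup G, D.Characteristic → IsCyclic D → Nat.card D ≤ Nat.card C)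
    {p : ℕ} (hp : p.Prime) (hpC : p ^ 2 ∣ Nat.card C)
    (ih : ∀ V : Subgroup G, ∀ _ : V.Characteristic, V ≠ ⊥ → CyclicBound ε (G ⧸ V)) :
    CyclicBound ε G := by
  have := Fact.mk hp
  have hCc : ∀ a ∈ C, ∀ b ∈ C, a * b = b * a := fun a ha b hb =>
    Subtype.ext_iff.1 (IsMulCommutative.is_comm.comm (⟨a, ha⟩ : C) ⟨b, hb⟩)
  let N := C.torsion hCc p
  have hN : N.Characteristic := hC.torsion hCc p
  have hNc : ∀ a ∈ N, ∀ b ∈ N, a * b = b * a := fun a ha b hb =>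
    hCc a (Subgroup.mem_torsion.1 ha).1 b (Subgroup.mem_torsion.1 hb).1
  have hNp : ∀ a ∈ N, a ^ p = 1 := fun a ha => (Subgroup.mem_torsion.1 ha).2
  have hNcard : Nat.card N = p := (hEC p hp N hN hNc hNp).antisymm
    (C.le_card_torsion hCc ((dvd_pow_self p two_ne_zero).trans hpC))
  obtain ⟨D', hD'c, hD', hγ⟩ := ih N hN (by
    rw [Ne, ← Subgroup.card_eq_one, hNcard]
    exact hp.one_lt.ne')
  let D := D'.comap (QuotientGroup.mk' N)
  have hD : D.Characteristic := Subgroup.Characteristic.comap_quotient_mk (H := N) hD'c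
  have hDcard : Nat.card D = Nat.card N * Nat.card D' := N.card_comap_mk D'
  suffices hle : Nat.card D ≤ Nat.card C by
    refine ⟨C, hC, hCcyc, ?_⟩
    have h1 : (noetherNumber G : ℝ) ≤ p * noetherNumber (G ⧸ N) := by
      have h1 := noetherNumber_le_mul_quotient N
      have h2 := noetherNumber_le_card N
      rw [hNcard] at h2
      exact_mod_cast h1.trans (Nat.mul_le_mul_right _ h2)
    have hG : (Nat.card G : ℝ) = Nat.card (G ⧸ N) * p := by
      rw [← hNcard]
      exact_mod_cast N.card_eq_card_quotient_mul_card_subgroup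
    have hp0 : (0 : ℝ) < p := by exact_mod_cast hp.pos
    have hle' : (p : ℝ) * Nat.card D' ≤ Nat.card C := by
      rw [hDcard, hNcard] at hle
      exact_mod_cast hle
    rw [hG]
    calc (noetherNumber G : ℝ) ≤ p * noetherNumber (G ⧸ N) := h1
      _ ≤ p * ((Nat.card D' : ℝ) ^ ε * (Nat.card (G ⧸ N) : ℝ) ^ (1 - ε)) := by gcongr
      _ = (p : ℝ) ^ ε * (p : ℝ) ^ (1 - ε) *
          ((Nat.card D' : ℝ) ^ ε * (Nat.card (G ⧸ N) : ℝ) ^ (1 - ε)) := by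
        rw [← Real.rpow_add hp0, add_sub_cancel, Real.rpow_one]
      _ = ((p : ℝ) * Nat.card D') ^ ε * ((Nat.card (G ⧸ N) : ℝ) * p) ^ (1 - ε) := by
        rw [Real.mul_rpow hp0.le (by positivity), Real.mul_rpow (by positivity) hp0.le]
        ring
      _ ≤ _ := by gcongr
  let g : D →* D' := (QuotientGroup.mk' N).subgroupComap D'
  have hgker : ∀ x : D, x ∈ g.ker ↔ (x : G) ∈ N := fun x => by
    rw [MonoidHom.mem_ker, ← QuotientGroup.eq_one_iff]
    exact Subtype.ext_iff
  have hNC : N ≤ Subgroup.centralizer (N : Set G) := fun x hx =>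
    Subgroup.mem_centralizer_iff.2 fun y hy => hNc y hy x hx
  have hND : N ≤ D := fun x hx => by
    change (QuotientGroup.mk' N) x ∈ D'
    rw [QuotientGroup.mk'_apply, (QuotientGroup.eq_one_iff _).2 hx]
    exact D'.one_mem
  let r : D →* MulAut N := (MulAut.conjNormal : G →* MulAut N).comp D.subtype
  let A := D ⊓ Subgroup.centralizer (N : Set G)
  have hAchar : A.Characteristic := inferInstance
  have hrker : r.ker.map D.subtype = A := by
    ext x
    simp only [A, Subgroup.mem_inf, ← Subgroup.ker_conjNormal N]
    exact ⟨by rintro ⟨y, hy, rfl⟩; exact ⟨y.2, hy⟩, fun h => ⟨⟨x, h.1⟩, h.2, rfl⟩⟩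
  have hr : IsCyclic r.range := r.isCyclic_range_of_ker_le g fun x hx => by
    have h1 := hNC ((hgker x).1 hx)
    rw [← Subgroup.ker_conjNormal N] at h1
    exact h1
  have hrcard : Nat.card r.range ≤ p := hNcard ▸ card_le_of_isCyclic_mulAut_of_elementary
    (fun a b => Subtype.ext (hNc a a.2 b b.2)) (fun a => Subtype.ext (hNp a a.2)) r.range
  have hAD : Nat.card A * Nat.card r.range = Nat.card D := by
    rw [← r.card_ker_mul_card_range, ← hrker, Subgroup.card_map_of_injective D.subtype_injective]
  have hNA : N ≤ A := le_inf hND hNC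
  have hA : ∀ a ∈ A, ∀ b ∈ A, a * b = b * a := fun a ha b hb => by
    let gA : A →* D' := g.comp (Subgroup.inclusion inf_le_left)
    exact Subtype.ext_iff.1 (gA.comm_of_isCyclic_of_ker_le_center (fun x hx =>
      Subgroup.mem_center_iff.2 fun y => Subtype.ext
        ((Subgroup.mem_centralizer_iff.1 y.2.2 x ((hgker _).1 hx)).symm)) ⟨a, ha⟩ ⟨b, hb⟩)
  have hAcyc : IsCyclic A := hEC.isCyclic hAchar hA
  by_cases hDN : D ≤ Subgroup.centralizer (N : Set G)
  · exact (Subgroup.card_le_of_le (le_inf le_rfl hDN)).trans (hmax A hAchar hAcyc)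
  obtain ⟨x, hxD, hxN⟩ := SetLike.not_le_iff_exists.1 hDN
  have hxA : ∀ a ∈ A, x * a * x⁻¹ * a⁻¹ ∈ N := fun a ha => by
    have h1 : g ⟨x, hxD⟩ * g ⟨a, ha.1⟩ = g ⟨a, ha.1⟩ * g ⟨x, hxD⟩ :=
      IsMulCommutative.is_comm.comm _ _
    rw [← map_mul, ← map_mul, ← mul_inv_eq_one, ← map_inv, ← map_mul, mul_inv_rev,
      ← mul_assoc] at h1
    exact (hgker _).1 h1
  let δ : A →* G := MonoidHom.mk' (fun a => x * a * x⁻¹ * (a : G)⁻¹) fun a b => by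
    have h1 := Subgroup.mem_centralizer_iff.1 (Subgroup.inv_mem _ a.2.2) _ (hxA b b.2)
    calc x * (a * b : G) * x⁻¹ * (a * b : G)⁻¹
        = x * a * x⁻¹ * ((x * b * x⁻¹ * (b : G)⁻¹) * (a : G)⁻¹) := by group
      _ = _ := by rw [h1]; group
  let B := δ.ker.map A.subtype
  have hB : ∀ b ∈ B, b ∈ A ∧ x * b = b * x := by
    rintro _ ⟨b, hb, rfl⟩
    refine ⟨b.2, ?_⟩
    have h1 : x * b * x⁻¹ * (b : G)⁻¹ = 1 := hb
    rwa [mul_inv_eq_one, mul_inv_eq_iff_eq_mul] at h1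
  have hAB : Nat.card A ≤ Nat.card B * p := by
    rw [← δ.card_ker_mul_card_range, ← Subgroup.card_map_of_injective A.subtype_injective, ← hNcard]
    refine Nat.mul_le_mul_left _ (Subgroup.card_le_of_le ?_)
    rintro _ ⟨a, rfl⟩
    exact hxA a a.2
  have hBp : (Nat.card B).Coprime (p ^ 2) := by
    refine Nat.Coprime.pow_right 2 ((Nat.Prime.coprime_iff_not_dvd hp).2 fun hdvd => hxN ?_).symm
    obtain ⟨b, hb⟩ := exists_prime_orderOf_dvd_card' p hdvd
    rw [← Subgroup.orderOf_coe] at hb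
    obtain ⟨hbA, hbx⟩ := hB b b.2
    refine Subgroup.mem_centralizer_iff.2 fun n hn => ?_
    obtain ⟨k, rfl⟩ := Subgroup.mem_zpowers_iff.1
      (Subgroup.mem_zpowers_of_isCyclic hbA (hNA hn) (by rw [hb]; exact hNp n hn))
    exact (show Commute x b from hbx).zpow_right k |>.symm
  let T := A.torsion hA (Nat.card B)
  have hT : T.Characteristic := hAchar.torsion hA _
  let P := C.torsion hCc (p ^ 2)
  have hP : P.Characteristic := hC.torsion hCc _
  have hBT : B ≤ T := fun b hb => Subgroup.mem_torsion.2 ⟨(hB b hb).1, by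
    exact Subtype.ext_iff.1 (pow_card_eq_one' (x := (⟨b, hb⟩ : B)))⟩
  have hTP : Disjoint T P := Subgroup.disjoint_def.2 fun {y} h1 h2 => by
    have h3 := orderOf_dvd_of_pow_eq_one (Subgroup.mem_torsion.1 h1).2
    have h4 := orderOf_dvd_of_pow_eq_one (Subgroup.mem_torsion.1 h2).2
    exact orderOf_eq_one_iff.1 (Nat.eq_one_of_dvd_coprimes hBp h3 h4)
  have hTPcomm : ∀ a ∈ T, ∀ b ∈ P, a * b = b * a := fun a ha b hb =>
    Subgroup.commute_of_normal_of_disjoint T P inferInstance inferInstance hTP a b ha hb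
  have hTPab : ∀ a ∈ T ⊔ P, ∀ b ∈ T ⊔ P, a * b = b * a := by
    intro a ha b hb
    obtain ⟨t, ht, c, hc, rfl⟩ := Subgroup.mem_sup_of_normal_left.1 ha
    obtain ⟨t', ht', c', hc', rfl⟩ := Subgroup.mem_sup_of_normal_left.1 hb
    have h1 : Commute t t' := hA t (Subgroup.mem_torsion.1 ht).1 t' (Subgroup.mem_torsion.1 ht').1
    have h2 : Commute c c' := hCc c (Subgroup.mem_torsion.1 hc).1 c' (Subgroup.mem_torsion.1 hc').1
    have h3 : Commute t c' := hTPcomm t ht c' hc'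
    have h4 : Commute t' c := hTPcomm t' ht' c hc
    exact ((h1.mul_right h3).mul_left (h4.symm.mul_right h2)).eq
  have hTPcard : Nat.card B * p ^ 2 ≤ Nat.card C := by
    calc Nat.card B * p ^ 2 ≤ Nat.card T * Nat.card P :=
          Nat.mul_le_mul (Subgroup.card_le_of_le hBT) (C.le_card_torsion hCc hpC)
      _ = Nat.card (T × P) := (Nat.card_prod _ _).symm
      _ ≤ Nat.card ↥(T ⊔ P) := Nat.card_le_card_of_injective
          (fun y => ⟨y.1 * y.2, Subgroup.mul_mem_sup y.1.2 y.2.2⟩) fun y z hyz =>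
            Subgroup.mul_injective_of_disjoint hTP (Subtype.ext_iff.1 hyz)
      _ ≤ Nat.card C := hmax _ inferInstance (hEC.isCyclic inferInstance hTPab)
  calc Nat.card D ≤ Nat.card B * p * p := by rw [← hAD]; exact Nat.mul_le_mul hAB hrcard
    _ ≤ Nat.card C := by rwa [mul_assoc, ← sq]

end SquareDivisor

section SquarefreeCyclic

theorem exists_eq_zpow_mul_zpow_of_coprime {G : Type*} [Group G] {m n : ℕ} (h : m.Coprime n)
    (x : G) : ∃ u v : ℤ, x = (x ^ m) ^ u * (x ^ n) ^ v := by
  refine ⟨m.gcdA n, m.gcdB n, ?_⟩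
  have h1 := Nat.gcd_eq_gcd_ab m n
  rw [h.gcd_eq_one, Nat.cast_one] at h1
  rw [← zpow_natCast, ← zpow_natCast, ← zpow_mul, ← zpow_mul, ← zpow_add, ← h1, zpow_one]

theorem pow_mem_and_exists_monoidHom_of_le_center {K : Type} [Group K] [Finite K] {p n : ℕ}
    (hp : p.Prime) (N : Subgroup K) (hN : N ≤ Subgroup.center K) (hNcard : Nat.card N = p)
    (hK : Nat.card K = n * p) (hpn : n.Coprime p) :
    (∀ x : K, x ^ n ∈ N) ∧ ∃ φ : K →* K, ∀ x, φ x = x ^ n := by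
  have := Fact.mk hp
  have hindex : N.index = n := by
    have h1 := N.card_mul_index
    rw [hNcard, hK, mul_comm n] at h1
    exact Nat.eq_of_mul_eq_mul_left hp.pos h1
  obtain ⟨t, ht⟩ := Subgroup.index_dvd_of_le hN
  let f := MonoidHom.transferCenterPow K
  have hf : ∀ x, x ^ n = (f x : K) ^ t := fun x => by
    rw [MonoidHom.transferCenterPow_apply, ← pow_mul, ← ht, hindex]
  have hcenter : ∀ x y : K, Commute (f x : K) y := fun x y =>
    (Subgroup.mem_center_iff.1 (f x).2 y).symm
  let φ : K →* K := MonoidHom.mk' (fun x => x ^ n) fun x y => by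
    rw [hf, hf, hf, map_mul, Subgroup.coe_mul, (hcenter x _).mul_pow]
  have hφ : ∀ x, φ x = x ^ n := fun _ => rfl
  refine ⟨?_, φ, hφ⟩
  have hcomm : ∀ a b : φ.range, a * b = b * a := by
    rintro ⟨_, a, rfl⟩ ⟨_, b, rfl⟩
    refine Subtype.ext ?_
    change φ a * φ b = φ b * φ a
    rw [hφ, hφ, hf]
    exact (hcenter a _).pow_left t
  have hexp : ∀ a : φ.range, a ^ p = 1 := by
    rintro ⟨_, a, rfl⟩
    refine Subtype.ext ?_
    change φ a ^ p = 1
    rw [hφ, ← pow_mul, ← hK, pow_card_eq_one']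
  obtain ⟨k, hk, -⟩ := exists_mulEquiv_pi_zmod hcomm hexp
  have hk1 : k ≤ 1 := by
    by_contra! hk1
    have h1 : p ^ 2 ∣ n * p := by
      rw [← hK]
      exact (pow_dvd_pow p hk1).trans (hk ▸ φ.range.card_subgroup_dvd_card)
    rw [sq] at h1
    exact hp.one_lt.ne' (Nat.eq_one_of_dvd_coprimes hpn (Nat.dvd_of_mul_dvd_mul_right hp.pos h1)
      dvd_rfl)
  have hle : N ≤ φ.range := fun x hx => by
    obtain ⟨u, v, huv⟩ := exists_eq_zpow_mul_zpow_of_coprime hpn x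
    have hxp : x ^ p = 1 := by
      have := pow_card_eq_one' (x := (⟨x, hx⟩ : N))
      rw [hNcard] at this
      exact Subtype.ext_iff.1 this
    refine ⟨x ^ u, ?_⟩
    rw [map_zpow, hφ]
    exact (huv.trans (by rw [hxp, one_zpow, mul_one])).symm
  have heq : N = φ.range := Subgroup.eq_of_le_of_card_ge hle (by
    rw [hk, hNcard]
    exact (Nat.pow_le_pow_right hp.pos hk1).trans (pow_one p).le)
  exact fun x => heq ▸ ⟨x, hφ x⟩

theorem Nat.not_dvd_totient_of_squarefree {n p : ℕ} (hn : Squarefree n) (hp : p.Prime)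
    (hmax : ∀ r : ℕ, r.Prime → r ∣ n → r ≤ p) : ¬ p ∣ n.totient := by
  rw [Nat.totient_eq_div_primeFactors_mul, Nat.prod_primeFactors_of_squarefree hn,
    Nat.div_self (Nat.pos_of_ne_zero hn.ne_zero), one_mul, hp.prime.dvd_finsetProd_iff]
  rintro ⟨r, hr, hpr⟩
  have h1 := Nat.prime_of_mem_primeFactors hr
  have h2 := hmax r h1 (Nat.dvd_of_mem_primeFactors hr)
  have h3 := h1.two_le
  have := Nat.le_of_dvd (by omega) hpr
  omega


theorem noetherNumber_le_of_squarefree {ε : ℝ} (hε0 : 0 < ε) (hε1 : ε ≤ 0.1) {G : Type} [Group G]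
    [Finite G] (C : Subgroup G) [C.Normal] (hCcyc : IsCyclic C) (hsq : Squarefree (Nat.card C))
    (hCC : Subgroup.centralizer (C : Set G) = C) :
    (noetherNumber G : ℝ) ≤ (Nat.card C : ℝ) ^ ε * (Nat.card G : ℝ) ^ (1 - ε) := by
  generalize hc : Nat.card C = c
  induction c using Nat.strong_induction_on generalizing G with
  | _ c ih =>
  subst hc
  have hCc : ∀ a ∈ C, ∀ b ∈ C, a * b = b * a := fun a ha b hb =>
    Subtype.ext_iff.1 (IsMulCommutative.is_comm.comm (⟨a, ha⟩ : C) ⟨b, hb⟩)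
  rcases eq_or_ne (Nat.card C) 1 with h1 | h1
  · have hG : Nat.card G = 1 := by
      rw [← Subgroup.card_top, ← h1]
      congr 2
      refine (top_unique ?_).symm
      rw [← hCC, Subgroup.card_eq_one.1 h1]
      exact fun x _ => Subgroup.mem_centralizer_iff.2 fun y hy => by
        rw [Subgroup.mem_bot.1 hy, one_mul, mul_one]
    have h2 := noetherNumber_le_card G
    rw [hG] at h2
    rw [h1, hG, Nat.cast_one, Real.one_rpow, Real.one_rpow, one_mul]
    exact_mod_cast h2
  obtain ⟨p, hpmem, hpmax⟩ := Finset.exists_max_image (Nat.card C).primeFactors id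
    (Nat.nonempty_primeFactors.2 (lt_of_le_of_ne Nat.card_pos h1.symm))
  have hp := Nat.prime_of_mem_primeFactors hpmem
  have hpC := Nat.dvd_of_mem_primeFactors hpmem
  have := Fact.mk hp
  have hpidx : ¬ p ∣ C.index := fun hdvd => by
    refine Nat.not_dvd_totient_of_squarefree hsq hp (fun r hr hrC =>
      hpmax r (Nat.mem_primeFactors.2 ⟨hr, hrC, hsq.ne_zero⟩)) (hdvd.trans ?_)
    have hker : (MulAut.conjNormal : G →* MulAut C).ker = C := (Subgroup.ker_conjNormal C).trans hCC
    have hidx := Subgroup.index_ker (MulAut.conjNormal : G →* MulAut C)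
    rw [hker] at hidx
    rw [← IsCyclic.card_mulAut C, hidx]
    exact Subgroup.card_subgroup_dvd_card _
  obtain ⟨m, hm⟩ := hpC
  have hpm : ¬ p ∣ m := fun hdvd => hp.not_isUnit (hsq p (hm ▸ mul_dvd_mul_left p hdvd))
  let N := C.torsion hCc p
  have hN : ∀ x, x ∈ N ↔ x ∈ C ∧ x ^ p = 1 := fun x => Subgroup.mem_torsion
  have hNC : N ≤ C := fun x hx => ((hN x).1 hx).1
  have hNcyc : IsCyclic N := isCyclic_of_injective (Subgroup.inclusion hNC)
    (Subgroup.inclusion_injective hNC)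
  have hNn : N.Normal := ⟨fun x hx g => (hN _).2
      ⟨Subgroup.Normal.conj_mem inferInstance x (hNC hx) g,
    by rw [conj_pow, ((hN x).1 hx).2, mul_one, mul_inv_cancel]⟩⟩
  have hNcard : Nat.card N = p := by
    refine le_antisymm ?_ (C.le_card_torsion hCc ⟨m, hm⟩)
    obtain ⟨g, hg⟩ := IsCyclic.exists_ofOrder_eq_natCard (α := N)
    rw [← hg]
    exact Nat.le_of_dvd hp.pos (orderOf_dvd_of_pow_eq_one (Subtype.ext ((hN g).1 g.2).2))
  let K := Subgroup.centralizer (N : Set G)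
  have hCK : C ≤ K := fun x hx => Subgroup.mem_centralizer_iff.2 fun y hy => hCc y (hNC hy) x hx
  let n := m * C.relIndex K
  have hKcard : Nat.card K = n * p := by
    have h2 : Nat.card C * C.relIndex K = Nat.card K := by
      rw [← Subgroup.relIndex_bot_left, ← Subgroup.relIndex_bot_left,
        Subgroup.relIndex_mul_relIndex _ _ _ bot_le hCK]
    rw [← h2, hm]
    ring
  have hpn : n.Coprime p := by
    refine ((Nat.Prime.coprime_iff_not_dvd hp).2 fun hdvd => ?_).symm
    rcases hp.dvd_mul.1 hdvd with h | h
    · exact hpm h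
    · exact hpidx (h.trans (Subgroup.relIndex_dvd_index_of_normal C K))
  have hKN : ∀ k ∈ K, ∀ x ∈ N, x * k = k * x := fun k hk => Subgroup.mem_centralizer_iff.1 hk
  obtain ⟨hpow, φ, hφ⟩ := pow_mem_and_exists_monoidHom_of_le_center (K := K) hp (N.subgroupOf K)
    (fun x hx => Subgroup.mem_center_iff.2 fun y => Subtype.ext (hKN y y.2 x hx).symm)
    (by rw [Nat.card_congr (Subgroup.subgroupOfEquivOfLe (hNC.trans hCK)).toEquiv, hNcard])
    hKcard hpn
  let Z := φ.ker.map K.subtype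
  have hZ : ∀ x, x ∈ Z ↔ x ∈ K ∧ x ^ n = 1 := by
    refine fun x => ⟨?_, fun h => ⟨⟨x, h.1⟩, (hφ _).trans (Subtype.ext h.2), rfl⟩⟩
    rintro ⟨y, hy, rfl⟩
    exact ⟨y.2, Subtype.ext_iff.1 ((hφ y).symm.trans hy)⟩
  have hKn : K.Normal := inferInstance
  have hZn : Z.Normal := ⟨fun x hx g => (hZ _).2 ⟨hKn.conj_mem x ((hZ x).1 hx).1 g,
    by rw [conj_pow, ((hZ x).1 hx).2, mul_one, mul_inv_cancel]⟩⟩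
  have hZN : Disjoint Z N := Subgroup.disjoint_def.2 fun {y} h1 h2 =>
    orderOf_eq_one_iff.1 (Nat.eq_one_of_dvd_coprimes hpn
      (orderOf_dvd_of_pow_eq_one ((hZ y).1 h1).2) (orderOf_dvd_of_pow_eq_one ((hN y).1 h2).2))
  have hdec : ∀ k ∈ K, ∃ a ∈ N, ∃ b ∈ Z, k = a * b := fun k hk => by
    obtain ⟨u, v, huv⟩ := exists_eq_zpow_mul_zpow_of_coprime hpn k
    refine ⟨_, N.zpow_mem (hpow ⟨k, hk⟩) u, _, Z.zpow_mem ((hZ (k ^ p)).2 ⟨K.pow_mem hk p, ?_⟩) v,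
      huv⟩
    rw [← pow_mul, mul_comm, ← hKcard]
    exact Subtype.ext_iff.1 (pow_card_eq_one' (x := (⟨k, hk⟩ : K)))
  let CZ := C.subgroupOf Z
  have hCZcard : Nat.card CZ = Nat.card ↥(C ⊓ Z) := by
    rw [← Subgroup.subgroupOf_map_subtype, Subgroup.card_map_of_injective Z.subtype_injective]
  have hCZp : Nat.card CZ * p ≤ Nat.card C := by
    have hdisj : Disjoint (C ⊓ Z) N := hZN.mono_left inf_le_right
    rw [hCZcard, ← hNcard, ← Nat.card_prod]
    exact Nat.card_le_card_of_injective
      (fun y : ↥(C ⊓ Z) × N => (⟨y.1 * y.2, C.mul_mem y.1.2.1 (hNC y.2.2)⟩ : C)) fun y z hyz =>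
        Subgroup.mul_injective_of_disjoint hdisj (Subtype.ext_iff.1 hyz)
  have hCZcyc : IsCyclic CZ := isCyclic_of_injective
    (Z.subtype.subgroupComap C) fun x y hxy => by
    have h2 := Subtype.ext_iff.1 hxy
    exact Subtype.ext (Subtype.ext h2)
  have hCZsq : Squarefree (Nat.card CZ) := hsq.squarefree_of_dvd
    (hCZcard ▸ Subgroup.card_dvd_of_le inf_le_left)
  have hCZC : Subgroup.centralizer (CZ : Set Z) = CZ := by
    refine le_antisymm (fun z hz => ?_) fun x hx => Subgroup.mem_centralizer_iff.2 fun y hy =>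
      Subtype.ext (hCc y hy x hx)
    change (z : G) ∈ C
    rw [← hCC]
    refine Subgroup.mem_centralizer_iff.2 fun x hx => ?_
    obtain ⟨a, ha, b, hb, rfl⟩ := hdec x (hCK hx)
    have h2 : Commute a (z : G) := hKN z ((hZ z).1 z.2).1 a ha
    have h3 : Commute b (z : G) := Subtype.ext_iff.1 (Subgroup.mem_centralizer_iff.1 hz ⟨b, hb⟩
      ((C.mul_mem_cancel_left (hNC ha)).1 hx))
    exact h2.mul_left h3
  have hpos : 0 < Nat.card CZ := Nat.card_pos
  have hγZ := ih _ (lt_of_lt_of_le (by nlinarith [hp.two_le]) hCZp) CZ hCZcyc hCZsq hCZC rfl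
  let π := QuotientGroup.mk' Z
  have hπ : ∀ x, π x = 1 ↔ x ∈ Z := QuotientGroup.eq_one_iff
  let N' := N.map π
  have hN'n : N'.Normal := hNn.map π (QuotientGroup.mk'_surjective Z)
  have hN'card : Nat.card N' = p := by
    refine ((Nat.dvd_prime hp).1 (hNcard ▸ N.card_map_dvd π)).resolve_left fun h2 => ?_
    rw [Subgroup.card_eq_one, Subgroup.map_eq_bot_iff, QuotientGroup.ker_mk'] at h2
    exact hp.one_lt.ne' (by rw [← hNcard, Subgroup.card_eq_one]; exact (hZN.symm.eq_bot_of_le h2))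
  have hN'C : Subgroup.centralizer (N' : Set (G ⧸ Z)) = N' := by
    refine le_antisymm (fun y hy => ?_) ?_
    · obtain ⟨g, rfl⟩ := QuotientGroup.mk'_surjective Z y
      have hg : g ∈ K := Subgroup.mem_centralizer_iff.2 fun x hx => by
        have h2 := Subgroup.mem_centralizer_iff.1 hy (π x) ⟨x, hx, rfl⟩
        rw [← map_mul, ← map_mul, ← mul_inv_eq_one, ← map_inv, ← map_mul, hπ] at h2
        rw [← mul_inv_eq_one]
        refine Subgroup.disjoint_def.1 hZN h2 ?_
        rw [mul_inv_rev, mul_assoc, ← mul_assoc g]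
        exact N.mul_mem hx (hNn.conj_mem _ (N.inv_mem hx) g)
      obtain ⟨a, ha, b, hb, rfl⟩ := hdec g hg
      refine ⟨a, ha, ?_⟩
      rw [map_mul, (hπ b).2 hb, mul_one]
    · rintro _ ⟨x, hx, rfl⟩
      refine Subgroup.mem_centralizer_iff.2 ?_
      rintro _ ⟨y, hy, rfl⟩
      rw [← map_mul, ← map_mul, hCc y (hNC hy) x (hNC hx)]
  have hγQ := noetherNumber_le_of_frobenius N' hN'card hN'C
  have hQ : Nat.card (G ⧸ Z) = p * N'.index := by rw [← hN'card, Subgroup.card_mul_index]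
  have hγG : (noetherNumber G : ℝ) ≤ noetherNumber Z * noetherNumber (G ⧸ Z) := by
    exact_mod_cast noetherNumber_le_mul_quotient Z
  have hG : (Nat.card G : ℝ) = p * N'.index * Nat.card Z := by
    exact_mod_cast hQ ▸ Z.card_eq_card_quotient_mul_card_subgroup
  have hp0 : (0 : ℝ) < p := by exact_mod_cast hp.pos
  have hi : (1 : ℝ) ≤ N'.index := by exact_mod_cast Nat.pos_of_ne_zero N'.index_ne_zero_of_finite
  have hCZp' : (Nat.card CZ : ℝ) * p ≤ Nat.card C := by exact_mod_cast hCZp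
  rw [hG]
  calc (noetherNumber G : ℝ) ≤ noetherNumber Z * noetherNumber (G ⧸ Z) := hγG
    _ ≤ ((Nat.card CZ : ℝ) ^ ε * (Nat.card Z : ℝ) ^ (1 - ε)) *
        (p * (N'.index : ℝ) ^ (0.9 : ℝ)) := by gcongr
    _ ≤ ((Nat.card CZ : ℝ) ^ ε * (Nat.card Z : ℝ) ^ (1 - ε)) *
        (p * (N'.index : ℝ) ^ (1 - ε)) := by
      have := Real.rpow_le_rpow_of_exponent_le hi (show (0.9 : ℝ) ≤ 1 - ε by linarith)
      gcongr
    _ = ((Nat.card CZ : ℝ) ^ ε * (Nat.card Z : ℝ) ^ (1 - ε)) *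
        ((p : ℝ) ^ ε * (p : ℝ) ^ (1 - ε) * (N'.index : ℝ) ^ (1 - ε)) := by
      rw [← Real.rpow_add hp0, add_sub_cancel, Real.rpow_one]
    _ = ((Nat.card CZ : ℝ) * p) ^ ε * (p * N'.index * Nat.card Z : ℝ) ^ (1 - ε) := by
      rw [Real.mul_rpow (by positivity) hp0.le, Real.mul_rpow (by positivity) (by positivity),
        Real.mul_rpow hp0.le (by positivity)]
      ring
    _ ≤ _ := by
      have : 0 ≤ 1 - ε := by linarith
      gcongr

end SquarefreeCyclic

section Reduction

theorem AlmostSimpleBound.cyclicBound {ε : ℝ} (hε0 : 0 < ε) (hε1 : ε ≤ 0.1) {G : Type} [Group G]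
    [Finite G] (h : AlmostSimpleBound ε G) : CyclicBound ε G := by
  generalize hn : Nat.card G = n
  induction n using Nat.strong_induction_on generalizing G with
  | _ n ih =>
  subst hn
  have ih' : ∀ (G' : Type) [Group G'] [Finite G'], Nat.card G' < Nat.card G →
      AlmostSimpleBound ε G' → CyclicBound ε G' := fun G' _ _ hlt h' => ih _ hlt h' rfl
  have ihQ : ∀ V : Subgroup G, ∀ _ : V.Characteristic, V ≠ ⊥ → CyclicBound ε (G ⧸ V) := by
    refine fun V hV hne => ih' _ ?_ (h.of_surjective (QuotientGroup.mk' V)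
      (QuotientGroup.mk'_surjective V))
    rw [V.card_eq_card_quotient_mul_card_subgroup]
    exact lt_mul_of_one_lt_right Nat.card_pos (V.one_lt_card_iff_ne_bot.2 hne)
  by_cases hEC : CharacteristicElementaryCyclic G
  swap
  · exact cyclicBound_of_not_characteristicElementaryCyclic hε0 hε1 hEC ihQ
  obtain ⟨C, ⟨hC, hCcyc⟩, hmax⟩ := Set.exists_max_image
    {D : Subgroup G | D.Characteristic ∧ IsCyclic D} (fun D => Nat.card D) (Set.toFinite _)
    ⟨⊥, inferInstance, inferInstance⟩
  have hmax' : ∀ D : Subgroup G, D.Characteristic → IsCyclic D → Nat.card D ≤ Nat.card C :=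
    fun D hD hDcyc => hmax D ⟨hD, hDcyc⟩
  have hCle : C ≤ Subgroup.centralizer (C : Set G) := fun x hx =>
    Subgroup.mem_centralizer_iff.2 fun y hy =>
      Subtype.ext_iff.1 (IsMulCommutative.is_comm.comm (⟨y, hy⟩ : C) ⟨x, hx⟩)
  rcases hCle.lt_or_eq with hlt | heq
  · obtain ⟨M, ⟨hM, hCM, hMC⟩, hmin⟩ := Set.exists_min_image
      {M : Subgroup G | M.Characteristic ∧ C < M ∧ M ≤ Subgroup.centralizer (C : Set G)}
      (fun M => Nat.card M) (Set.toFinite _) ⟨_, inferInstance, hlt, le_rfl⟩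
    have hmin' : ∀ L : Subgroup G, L.Characteristic → C ≤ L → L ≤ M → L ≠ C → L = M :=
      fun L hL hCL hLM hne => Subgroup.eq_of_le_of_card_ge hLM
        (hmin L ⟨hL, lt_of_le_of_ne hCL hne.symm, hLM.trans hMC⟩)
    by_cases hab : ∀ a ∈ M, ∀ b ∈ M, a * b * a⁻¹ * b⁻¹ ∈ C
    · exact cyclicBound_of_abelian hε0 hε1 hEC C hC hmax' M hM hCM hMC hmin' hab h ih'
    · exact cyclicBound_of_nonabelian hε0 C hC M hM hCM.le hmin' hab h ih'
  · by_cases hsq : Squarefree (Nat.card C)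
    · exact ⟨C, hC, hCcyc, noetherNumber_le_of_squarefree hε0 hε1 C hCcyc hsq heq.symm⟩
    · rw [Nat.squarefree_iff_prime_squarefree] at hsq
      push Not at hsq
      obtain ⟨p, hp, hdvd⟩ := hsq
      exact cyclicBound_of_sq_dvd hε0 hEC C hC hCcyc hmax' hp (by rwa [sq]) ihQ

end Reduction

/-- **Theorem (reduction to almost simple groups).**  Let `G` be a finite group and
`0 < ε ≤ 0.1` a constant such that `β(H) ≤ 2^(-ε)·|H|^(1-ε)` for every almost
simple group `H` (a finite group with a non-Abelian simple normal subgroup `S`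
satisfying `C_H(S) = 1`) whose socle `S` is isomorphic to a composition factor of
`G`.  If `C` is a characteristic cyclic subgroup of maximal order in `G`, then
`β(G) ≤ |C|^ε · |G|^(1-ε)`. -/
theorem noetherNumber_le_of_almost_simple_bound
    (G : Type) [Group G] [Finite G] (ε : ℝ) (hε0 : 0 < ε) (hε1 : ε ≤ 0.1)
    (halmost : ∀ (H : Type) [Group H] [Finite H] (S : Subgroup H),
      S.Normal → IsSimpleGroup ↥S → (¬ ∀ a b : ↥S, a * b = b * a) →
      Subgroup.centralizer (S : Set H) = ⊥ →
      IsCompositionFactor ↥S G →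
      (noetherNumber H : ℝ) ≤ (2 : ℝ) ^ (-ε) * (Nat.card H : ℝ) ^ (1 - ε))
    (C : Subgroup G) (hchar : C.Characteristic) (hcyc : IsCyclic ↥C)
    (hmax : ∀ D : Subgroup G, D.Characteristic → IsCyclic ↥D →
      Nat.card D ≤ Nat.card C) :
    (noetherNumber G : ℝ) ≤ (Nat.card C : ℝ) ^ ε * (Nat.card G : ℝ) ^ (1 - ε) := by
  have h : AlmostSimpleBound ε G := fun H _ _ S hS hsimple hna hcent hfactor =>
    halmost H S hS hsimple hna hcent hfactor.isCompositionFactor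
  obtain ⟨D, hD, hDcyc, hbound⟩ := h.cyclicBound hε0 hε1
  refine hbound.trans ?_
  have hle : (Nat.card D : ℝ) ≤ Nat.card C := Nat.cast_le.2 (hmax D hD hDcyc)
  gcongr
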